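/- Let B be an even simple Bratteli diagram with full group G=G_B and path space X=X_B, and suppose (X,G) admits exactly k ergodic G-invariant Borel probability measures μ_1,…,μ_k, where 1≤k<∞. If φ is an ergodic invariant random subgroup of G, then either φ=δ_{{e}} (the Dirac measure at the trivial subgroup) or φ=φ_α for some α∈Z_{≥0}^k, where φ_α is the stabilizer distribution of the diagonal action of G on (X^{|α|}, μ_α) with μ_α=μ_1^{α_1}×…×μ_k^{α_k}. -/

import Mathlib

open MeasureTheory Filter
open scoped ENNReal ComplexOrder

noncomputable section

/-- A Bratteli diagram: vertex levels `V i`, edge levels `E i` (edges from `V i` to `V (i+1)`),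
all levels finite and nonempty, a single root vertex, and source/range maps that are
surjective (every vertex emits and receives an edge). -/
structure BratteliDiagram where
  V : ℕ → Type
  E : ℕ → Type
  fintypeV : ∀ i, Fintype (V i)
  fintypeE : ∀ i, Fintype (E i)
  nonemptyV : ∀ i, Nonempty (V i)
  nonemptyE : ∀ i, Nonempty (E i)
  subsingleton_root : Subsingleton (V 0)
  src : ∀ i, E i → V i
  rng : ∀ i, E i → V (i + 1)
  src_surj : ∀ i, Function.Surjective (src i)
  rng_surj : ∀ i, Function.Surjective (rng i)

namespace BratteliDiagram

variable (B : BratteliDiagram)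

/-- The path space `X_B`: infinite paths starting at the root. -/
def Path : Type :=
  { x : ∀ i, B.E i // ∀ i, B.rng i (x i) = B.src (i + 1) (x (i + 1)) }

instance (i : ℕ) : UniformSpace (B.E i) := ⊥

instance instUniformSpacePath : UniformSpace B.Path :=
  inferInstanceAs (UniformSpace { x : ∀ i, B.E i // ∀ i, B.rng i (x i) = B.src (i + 1) (x (i + 1)) })

instance instMeasurableSpacePath : MeasurableSpace B.Path := borel _

/-- Finite segments of `L+1` consecutive edges starting at level `n`. -/
def Seg (n L : ℕ) : Type :=
  { f : ∀ i : Fin (L + 1), B.E (n + (i : ℕ)) //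
    ∀ (i : ℕ) (hi : i < L),
      B.rng (n + i) (f ⟨i, by omega⟩) = B.src (n + (i + 1)) (f ⟨i + 1, by omega⟩) }

/-- The number of finite paths connecting `v ∈ V n` to `w ∈ V (n + L + 1)`. -/
def numPaths (n L : ℕ) (v : B.V n) (w : B.V (n + L + 1)) : ℕ :=
  Nat.card { f : B.Seg n L //
    B.src n (f.1 ⟨0, by omega⟩) = v ∧ B.rng (n + L) (f.1 ⟨L, by omega⟩) = w }

/-- A Bratteli diagram is simple if every vertex of a given level is connected
to every vertex of some deeper level. -/
def IsSimple : Prop :=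
  ∀ n : ℕ, ∃ L : ℕ, ∀ (v : B.V n) (w : B.V (n + L + 1)), 0 < B.numPaths n L v w

/-- A Bratteli diagram is even if every vertex of a given level is connected to every
vertex of some deeper level by a (positive) even number of paths. -/
def IsEven : Prop :=
  ∀ n : ℕ, ∃ L : ℕ, ∀ (v : B.V n) (w : B.V (n + L + 1)),
    0 < B.numPaths n L v w ∧ Even (B.numPaths n L v w)

/-- A permutation of the path space "of level `n`": it changes only the first `n` edges,
and what it does to the first `n` edges depends only on the first `n` edges. -/
def IsLevel (n : ℕ) (g : Equiv.Perm B.Path) : Prop :=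
  (∀ (x : B.Path) (i : ℕ), n ≤ i → (g x).1 i = x.1 i) ∧
  (∀ x y : B.Path, (∀ i : ℕ, i < n → x.1 i = y.1 i) → ∀ i : ℕ, i < n → (g x).1 i = (g y).1 i)

theorem isLevel_one (n : ℕ) : B.IsLevel n 1 :=
  ⟨fun _ _ _ => rfl, fun _ _ h i hi => h i hi⟩

theorem IsLevel.mul {n : ℕ} {a b : Equiv.Perm B.Path} (ha : B.IsLevel n a)
    (hb : B.IsLevel n b) : B.IsLevel n (a * b) := by
  constructor
  · intro x i hi
    have h1 := ha.1 (b x) i hi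
    have h2 := hb.1 x i hi
    simpa [Equiv.Perm.mul_apply] using h1.trans h2
  · intro x y hxy i hi
    have h2 := hb.2 x y hxy
    have := ha.2 (b x) (b y) h2 i hi
    simpa [Equiv.Perm.mul_apply] using this

theorem IsLevel.mono {n m : ℕ} (hnm : n ≤ m) {g : Equiv.Perm B.Path}
    (h : B.IsLevel n g) : B.IsLevel m g := by
  refine ⟨fun x i hi => h.1 x i (hnm.trans hi), fun x y hxy i hi => ?_⟩
  rcases lt_or_ge i n with h' | h'
  · exact h.2 x y (fun j hj => hxy j (hj.trans_le hnm)) i h'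
  · rw [h.1 x i h', h.1 y i h']
    exact hxy i hi

/-- The group `G_n` of homeomorphisms of the path space permuting only the
first `n` edges of infinite paths. -/
def level (n : ℕ) : Subgroup (Equiv.Perm B.Path) where
  carrier := { g | B.IsLevel n g ∧ B.IsLevel n g⁻¹ }
  one_mem' := ⟨B.isLevel_one n, by simpa using B.isLevel_one n⟩
  mul_mem' := by
    intro a b ha hb
    exact ⟨ha.1.mul B hb.1, by rw [mul_inv_rev]; exact IsLevel.mul B hb.2 ha.2⟩
  inv_mem' := by
    intro a ha
    exact ⟨ha.2, by simpa using ha.1⟩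

theorem level_mono {n m : ℕ} (h : n ≤ m) : B.level n ≤ B.level m := by
  intro g hg
  exact ⟨hg.1.mono B h, hg.2.mono B h⟩

/-- The full group `G_B = ⋃ n, G_n` of the Bratteli diagram. -/
def fullGroup : Subgroup (Equiv.Perm B.Path) where
  carrier := { g | ∃ n, g ∈ B.level n }
  one_mem' := ⟨0, one_mem _⟩
  mul_mem' := by
    rintro a b ⟨n, ha⟩ ⟨m, hb⟩
    exact ⟨max n m, mul_mem (B.level_mono (le_max_left n m) ha)
      (B.level_mono (le_max_right n m) hb)⟩
  inv_mem' := by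
    rintro a ⟨n, ha⟩
    exact ⟨n, inv_mem ha⟩

/-- `G_n` viewed as a subgroup of the full group. -/
def levelIn (n : ℕ) : Subgroup ↥B.fullGroup := (B.level n).comap B.fullGroup.subtype

/-- The subgroup `G°(A)` of elements of the full group fixing `A` pointwise. -/
def Gcirc (A : Set B.Path) : Subgroup ↥B.fullGroup :=
  ⨅ x ∈ A, MulAction.stabilizer ↥B.fullGroup x

/-- `G°_n(A) = G_n ∩ G°(A)`. -/
def GcircN (n : ℕ) (A : Set B.Path) : Subgroup ↥B.fullGroup :=
  B.levelIn n ⊓ B.Gcirc A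

end BratteliDiagram

/-- Conjugation of a subgroup: `g • H = gHg⁻¹`. -/
def conjSub {Γ : Type*} [Group Γ] (g : Γ) (H : Subgroup Γ) : Subgroup Γ :=
  Subgroup.map (MulAut.conj g).toMonoidHom H

/-- The Borel structure on the space `Sub(Γ)` of subgroups of `Γ`,
induced from the product space `{0,1}^Γ` (equivalently `Set Γ`). -/
instance subgroupMeasurableSpace {Γ : Type*} [Group Γ] : MeasurableSpace (Subgroup Γ) :=
  MeasurableSpace.comap (fun H => (H : Set Γ)) inferInstance

namespace BratteliDiagram

variable (B : BratteliDiagram)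

/-- `F(A)`: the collection of subgroups of the full group normalized by `G°(A)`. -/
def FF (A : Set B.Path) : Set (Subgroup ↥B.fullGroup) :=
  { H | ∀ g ∈ B.Gcirc A, conjSub g H = H }

end BratteliDiagram

/-- A measure `ν` on `Y` is invariant under the action of `G`. -/
def MeasInv (G : Type*) [Group G] {Y : Type*} [MeasurableSpace Y] [MulAction G Y]
    (ν : Measure Y) : Prop :=
  ∀ (g : G) (s : Set Y), MeasurableSet s → ν ((fun y => g • y) ⁻¹' s) = ν s

/-- The action of `G` on `(Y, ν)` is ergodic: every invariant measurable set is null or conull. -/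
def MeasErg (G : Type*) [Group G] {Y : Type*} [MeasurableSpace Y] [MulAction G Y]
    (ν : Measure Y) : Prop :=
  ∀ s : Set Y, MeasurableSet s → (∀ g : G, (fun y => g • y) ⁻¹' s = s) → ν s = 0 ∨ ν s = 1

/-- An invariant random subgroup: a conjugation-invariant Borel probability measure on `Sub(G)`. -/
def IsIRS (G : Type*) [Group G] (φ : Measure (Subgroup G)) : Prop :=
  IsProbabilityMeasure φ ∧
    ∀ (g : G) (s : Set (Subgroup G)), MeasurableSet s → φ (conjSub g ⁻¹' s) = φ s

/-- An ergodic invariant random subgroup. -/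
def IsErgodicIRS (G : Type*) [Group G] (φ : Measure (Subgroup G)) : Prop :=
  IsIRS G φ ∧
    ∀ s : Set (Subgroup G), MeasurableSet s → (∀ g : G, conjSub g ⁻¹' s = s) →
      φ s = 0 ∨ φ s = 1

/-- A character of a group: normalized, central, positive semidefinite complex function. -/
def IsCharacter (G : Type*) [Group G] (χ : G → ℂ) : Prop :=
  χ 1 = 1 ∧ (∀ a b : G, χ (a * b) = χ (b * a)) ∧
    ∀ (n : ℕ) (g : Fin n → G) (c : Fin n → ℂ),
      0 ≤ ∑ i, ∑ j, (starRingEnd ℂ) (c i) * c j * χ (g i * (g j)⁻¹)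

namespace BratteliDiagram

variable (B : BratteliDiagram)

/-- The product measure `μ_α = μ_1^{α_1} × ⋯ × μ_k^{α_k}` on `X^{|α|}`,
realized on the index type `Σ i : Fin k, Fin (α i)` (of cardinality `|α| = Σ α i`). -/
def prodMeasure {k : ℕ} (μ : Fin k → Measure B.Path) (α : Fin k → ℕ) :
    Measure ((Σ i : Fin k, Fin (α i)) → B.Path) :=
  Measure.pi fun p => μ p.1

/-- The stabilizer distribution `φ_α` of the diagonal action of the full group
on `(X^{|α|}, μ_α)`. -/
def stabDist {k : ℕ} (μ : Fin k → Measure B.Path) (α : Fin k → ℕ) :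
    Measure (Subgroup ↥B.fullGroup) :=
  Measure.map (fun y => MulAction.stabilizer ↥B.fullGroup y) (B.prodMeasure μ α)

end BratteliDiagram

namespace BratteliDiagram

variable {B : BratteliDiagram}

attribute [instance] BratteliDiagram.fintypeV BratteliDiagram.fintypeE

/-- vertex of level `n` on a path -/
def vtx (n : ℕ) (x : B.Path) : B.V n := B.src n (x.1 n)

theorem vtx_succ (n : ℕ) (x : B.Path) : vtx (n + 1) x = B.rng n (x.1 n) := (x.2 n).symm

theorem vtx_congr {n : ℕ} {x y : B.Path} (h : ∀ i, i < n → x.1 i = y.1 i) :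
    vtx n x = vtx n y := by
  cases n with
  | zero => exact B.subsingleton_root.elim _ _
  | succ n => rw [vtx_succ, vtx_succ, h n (Nat.lt_succ_self n)]

/-- splice: first `n` edges of `x`, then edges of `y` -/
def splice (n : ℕ) (x y : B.Path) (h : vtx n x = vtx n y) : B.Path :=
  ⟨fun i => if i < n then x.1 i else y.1 i, by
    intro i
    by_cases h1 : i + 1 < n
    · have h2 : i < n := by omega
      simp only [h1, h2, if_true]; exact x.2 i
    · by_cases h2 : i < n
      · have h3 : n = i + 1 := by omega
        subst h3
        simp only [h1, h2, if_true, if_false]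
        rw [← vtx_succ]; exact h
      · simp only [h1, h2, if_false]; exact y.2 i⟩

theorem splice_lt {n : ℕ} {x y : B.Path} {h : vtx n x = vtx n y} {i : ℕ} (hi : i < n) :
    (splice n x y h).1 i = x.1 i := by simp [splice, hi]

theorem splice_ge {n : ℕ} {x y : B.Path} {h : vtx n x = vtx n y} {i : ℕ} (hi : n ≤ i) :
    (splice n x y h).1 i = y.1 i := by simp [splice, not_lt.mpr hi]

/-- agreement on the first `n` edges -/
def psetoid (B : BratteliDiagram) (n : ℕ) : Setoid B.Path where
  r x y := ∀ i, i < n → x.1 i = y.1 i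
  iseqv := ⟨fun _ _ _ => rfl, fun h i hi => (h i hi).symm,
    fun h h' i hi => (h i hi).trans (h' i hi)⟩

/-- prefixes of length `n` -/
def P (B : BratteliDiagram) (n : ℕ) : Type := Quotient (psetoid B n)

/-- the prefix of a path -/
def pr (n : ℕ) (x : B.Path) : B.P n := Quotient.mk (psetoid B n) x

theorem pr_eq {n : ℕ} {x y : B.Path} : pr n x = pr n y ↔ ∀ i, i < n → x.1 i = y.1 i :=
  Quotient.eq (r := psetoid B n)

theorem pr_surj (n : ℕ) : Function.Surjective (pr (B := B) n) := Quotient.mk_surjective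

/-- a representative -/
def rep {n : ℕ} (p : B.P n) : B.Path := Quotient.out (s := psetoid B n) p

@[simp] theorem pr_rep {n : ℕ} (p : B.P n) : pr n (rep p) = p :=
  Quotient.out_eq (s := psetoid B n) p

instance (n : ℕ) : Finite (B.P n) := by
  apply Finite.of_injective (β := ∀ i : Fin n, B.E i) (fun p i => (rep p).1 i)
  intro p q h
  rw [← pr_rep p, ← pr_rep q, pr_eq]
  intro i hi
  exact congrFun h ⟨i, hi⟩

instance (n : ℕ) : Fintype (B.P n) := Fintype.ofFinite _
instance (n : ℕ) : DecidableEq (B.P n) := Classical.decEq _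
instance (n : ℕ) : DecidableEq (B.V n) := Classical.decEq _

/-- end vertex of a prefix -/
def rv {n : ℕ} (p : B.P n) : B.V n := vtx n (rep p)

@[simp] theorem rv_pr {n : ℕ} (x : B.Path) : rv (pr n x) = vtx n x :=
  vtx_congr (pr_eq.mp (pr_rep (pr n x)))

/-- restriction of prefixes -/
def res (n : ℕ) {N : ℕ} (p : B.P N) : B.P n := pr n (rep p)

theorem pr_mono {n N : ℕ} (h : n ≤ N) {x y : B.Path} (hxy : pr N x = pr N y) :
    pr n x = pr n y := by
  rw [pr_eq] at *
  exact fun i hi => hxy i (hi.trans_le h)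

theorem res_pr {n N : ℕ} (h : n ≤ N) (x : B.Path) : res n (pr N x) = pr n x :=
  pr_mono h (pr_rep (pr N x))

theorem res_self {n : ℕ} (p : B.P n) : res n p = p := pr_rep p

theorem res_res {n m N : ℕ} (h : n ≤ m) (p : B.P N) : res n (res m p) = res n p := by
  unfold res
  exact pr_mono h (pr_rep _)

theorem path_ext {n : ℕ} {x y : B.Path} (h : pr n x = pr n y)
    (h' : ∀ i, n ≤ i → x.1 i = y.1 i) : x = y := by
  apply Subtype.ext
  funext i
  rcases lt_or_ge i n with hi | hi
  · exact pr_eq.mp h i hi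
  · exact h' i hi

theorem pr_splice {n : ℕ} {x y : B.Path} {h : vtx n x = vtx n y} :
    pr n (splice n x y h) = pr n x := pr_eq.mpr fun _ hi => splice_lt hi

theorem vtx_splice {n N : ℕ} (hN : n ≤ N) {x y : B.Path} {h : vtx n x = vtx n y} :
    vtx N (splice n x y h) = vtx N y := by
  unfold vtx
  rw [splice_ge hN]

theorem exists_path (good : ∀ i, B.E i → Prop) (h0 : ∃ e, good 0 e)
    (hs : ∀ i e, good i e → ∃ e', good (i + 1) e' ∧ B.rng i e = B.src (i + 1) e') :
    ∃ x : B.Path, ∀ i, good i (x.1 i) := by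
  choose e0 he0 using h0
  choose f hf1 hf2 using hs
  let z : ∀ i, { e : B.E i // good i e } := fun i =>
    Nat.rec (motive := fun i => { e : B.E i // good i e }) ⟨e0, he0⟩
      (fun i e => ⟨f i e.1 e.2, hf1 i e.1 e.2⟩) i
  exact ⟨⟨fun i => (z i).1, fun i => hf2 i (z i).1 (z i).2⟩, fun i => (z i).2⟩

instance : Nonempty B.Path := by
  obtain ⟨x, -⟩ := exists_path (B := B) (fun _ _ => True) ⟨(B.nonemptyE 0).some, trivial⟩
    (fun i e _ => by
      obtain ⟨e', he'⟩ := B.src_surj (i + 1) (B.rng i e)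
      exact ⟨e', trivial, he'.symm⟩)
  exact ⟨x⟩

instance (n : ℕ) : Nonempty (B.P n) := ⟨pr n (Classical.arbitrary _)⟩

/-- extensions of `a` to level `N` ending at `v` -/
def extF {n : ℕ} (N : ℕ) (a : B.P n) (v : B.V N) : Finset (B.P N) :=
  Finset.univ.filter fun c => res n c = a ∧ rv c = v

theorem mem_extF {n N : ℕ} {a : B.P n} {v : B.V N} {c : B.P N} :
    c ∈ extF N a v ↔ res n c = a ∧ rv c = v := by simp [extF]

theorem card_extF_seg (n L : ℕ) (a : B.P n) (w : B.V (n + L + 1)) :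
    (extF (n + L + 1) a w).card = B.numPaths n L (rv a) w := by
  classical
  unfold numPaths
  have hcard : (extF (n + L + 1) a w).card = Nat.card (extF (n+L+1) a w : Set (B.P (n+L+1))) := by
    simp
  refine hcard.trans ?_
  let Φ : (extF (n+L+1) a w : Set (B.P (n+L+1))) → { f : B.Seg n L //
      B.src n (f.1 ⟨0, by omega⟩) = rv a ∧ B.rng (n + L) (f.1 ⟨L, by omega⟩) = w } := fun c =>
    ⟨⟨fun i => (rep c.1).1 (n + i), fun i hi => (rep c.1).2 (n + i)⟩, by
      have h := mem_extF.mp c.2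
      refine ⟨?_, ?_⟩
      · exact (rv_pr (n := n) (rep c.1)).symm.trans (congrArg rv h.1)
      · exact ((rep c.1).2 (n + L)).trans h.2⟩
  refine Nat.card_congr (Equiv.ofBijective Φ ⟨?_, ?_⟩)
  · intro c d hcd
    apply Subtype.ext
    rw [← pr_rep c.1, ← pr_rep d.1, pr_eq]
    intro i hi
    have hc := (mem_extF.mp c.2).1
    have hd := (mem_extF.mp d.2).1
    rcases lt_or_ge i n with h | h
    · exact pr_eq.mp (hc.trans hd.symm) i h
    · obtain ⟨j, rfl⟩ := Nat.exists_eq_add_of_le h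
      have := congrArg (fun f => f.1.1 ⟨j, by omega⟩) hcd
      exact this
  · rintro ⟨f, hf1, hf2⟩
    obtain ⟨x, hx⟩ := exists_path (B := B)
      (fun i e => (i < n → e = (rep a).1 i) ∧
        (∀ (j : ℕ) (hj : j < L + 1), i = n + j → HEq e (f.1 ⟨j, hj⟩)))
      (by
        rcases Nat.eq_zero_or_pos n with h | h
        · subst h
          refine ⟨cast (by simp) (f.1 ⟨0, by omega⟩), by simp, ?_⟩
          intro j hj h
          have : j = 0 := by omega
          subst this
          exact cast_heq _ _
        · refine ⟨(rep a).1 0, fun _ => rfl, ?_⟩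
          intro j hj h'
          omega)
      (by
        rintro i e ⟨h1, h2⟩
        by_cases hin : i + 1 < n
        · refine ⟨(rep a).1 (i + 1), ⟨fun _ => rfl, fun j hj h => by omega⟩, ?_⟩
          rw [h1 (by omega)]
          exact (rep a).2 i
        · by_cases hin2 : i + 1 = n
          · subst hin2
            refine ⟨f.1 ⟨0, by omega⟩, ⟨fun h => by omega, ?_⟩, ?_⟩
            · intro j hj h
              have : j = 0 := by omega
              subst this
              rfl
            · rw [h1 (by omega)]
              have := hf1
              unfold rv at this
              rw [vtx_succ] at this
              exact this.symm
          · obtain ⟨j, rfl⟩ : ∃ j, i = n + j := Nat.exists_eq_add_of_le (by omega)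
            by_cases hj : j < L
            · refine ⟨f.1 ⟨j + 1, by omega⟩, ⟨fun h => by omega, ?_⟩, ?_⟩
              · intro j' hj' h
                have : j' = j + 1 := by omega
                subst this
                rfl
              · have h3 := h2 j (by omega) rfl
                rw [eq_of_heq h3]
                exact f.2 j hj
            · obtain ⟨e', he'⟩ := B.src_surj (n + j + 1) (B.rng (n + j) e)
              exact ⟨e', ⟨fun h => by omega, fun j' hj' h => by omega⟩, he'.symm⟩)
    have hx2 : ∀ (j : ℕ) (hj : j < L + 1), x.1 (n + j) = f.1 ⟨j, hj⟩ := fun j hj =>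
      eq_of_heq ((hx (n + j)).2 j hj rfl)
    have hxa : pr n x = a := by
      rw [← pr_rep a, pr_eq]
      exact fun i hi => (hx i).1 hi
    have hmem : pr (n + L + 1) x ∈ extF (n+L+1) a w := by
      rw [mem_extF, res_pr (by omega), rv_pr]
      refine ⟨hxa, ?_⟩
      rw [vtx_succ, hx2 L (by omega), hf2]
    refine ⟨⟨_, hmem⟩, ?_⟩
    apply Subtype.ext
    apply Subtype.ext
    funext j
    show (rep (pr (n + L + 1) x)).1 (n + j) = _
    rw [pr_eq.mp (pr_rep (pr (n+L+1) x)) (n + j) (by omega)]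
    exact hx2 j j.2

theorem card_extF_le {n N : ℕ} (h : n ≤ N) {a b : B.P n} (hab : rv a = rv b) (v : B.V N) :
    (extF N a v).card ≤ (extF N b v).card := by
  have key : ∀ c ∈ extF N a v, vtx n (rep b) = vtx n (rep c) := by
    intro c hc
    have := (mem_extF.mp hc).1
    rw [← rv_pr (n := n) (rep c)]
    change rv b = rv (res n c)
    rw [this, hab]
  refine Finset.card_le_card_of_injOn
    (fun c => if hc : c ∈ extF N a v then pr N (splice n (rep b) (rep c) (key c hc)) else c) ?_ ?_
  · intro c hc
    have hc' := mem_extF.mp hc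
    simp only [Finset.mem_coe] at hc
    simp only [hc, dif_pos, Finset.mem_coe, mem_extF, res_pr h, pr_splice, rv_pr, vtx_splice h]
    exact ⟨pr_rep b, hc'.2⟩
  · intro c hc d hd hcd
    have hc' := mem_extF.mp hc
    have hd' := mem_extF.mp hd
    simp only [Finset.mem_coe] at hc hd
    simp only [hc, hd, dif_pos] at hcd
    rw [← pr_rep c, ← pr_rep d, pr_eq]
    intro i hi
    rcases lt_or_ge i n with h1 | h1
    · exact pr_eq.mp (hc'.1.trans hd'.1.symm) i h1
    · have := pr_eq.mp hcd i hi
      rwa [splice_ge h1, splice_ge h1] at this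

theorem card_extF_congr {n N : ℕ} (h : n ≤ N) {a b : B.P n} (hab : rv a = rv b) (v : B.V N) :
    (extF N a v).card = (extF N b v).card :=
  le_antisymm (card_extF_le h hab v) (card_extF_le h hab.symm v)

theorem card_extF_comp {n m N : ℕ} (h : n ≤ m) (a : B.P n) (v : B.V N) :
    (extF N a v).card = ∑ b ∈ Finset.univ.filter (fun b : B.P m => res n b = a),
      (extF N b v).card := by
  rw [Finset.card_eq_sum_card_fiberwise (f := res m)
    (t := Finset.univ.filter (fun b : B.P m => res n b = a))]
  · refine Finset.sum_congr rfl fun b hb => ?_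
    congr 1
    ext c
    simp only [Finset.mem_filter, mem_extF, Finset.mem_univ, true_and] at hb ⊢
    constructor
    · rintro ⟨⟨-, h2⟩, h3⟩; exact ⟨h3, h2⟩
    · rintro ⟨h3, h2⟩
      refine ⟨⟨?_, h2⟩, h3⟩
      rw [← res_res h, h3, hb]
  · intro c hc
    have := (mem_extF.mp hc).1
    simp [res_res h, this]

theorem extF_even (heven : B.IsEven) (n : ℕ) : ∃ N0, n ≤ N0 ∧ ∀ N, N0 ≤ N →
    ∀ (a : B.P n) (v : B.V N), Even (extF N a v).card := by
  obtain ⟨L, hL⟩ := heven n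
  refine ⟨n + L + 1, by omega, fun N hN a v => ?_⟩
  rw [card_extF_comp (m := n + L + 1) (by omega)]
  rw [← Finset.sum_fiberwise (g := rv)]
  refine Finset.even_sum _ fun w _ => ?_
  have he : Even (extF (n + L + 1) a w).card := by
    rw [card_extF_seg]; exact (hL _ _).2
  have hset : (Finset.univ.filter (fun b : B.P (n+L+1) => res n b = a)).filter (fun b => rv b = w)
      = extF (n + L + 1) a w := by
    ext c; simp [mem_extF]
  rw [hset]
  rcases (extF (n + L + 1) a w).eq_empty_or_nonempty with h0 | ⟨b0, hb0⟩
  · simp [h0]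
  · rw [Finset.sum_congr rfl (g := fun _ => (extF N b0 v).card)]
    · rw [Finset.sum_const, smul_eq_mul]
      exact he.mul_right _
    · intro b hb
      exact card_extF_congr hN ((mem_extF.mp hb).2.trans (mem_extF.mp hb0).2.symm) v

theorem extF_mono {n m N : ℕ} (h : n ≤ m) (h' : m ≤ N) (a : B.P n) (c0 : B.P N) :
    (extF m a (rv (res m c0))).card ≤ (extF N a (rv c0)).card := by
  have key : ∀ c ∈ extF m a (rv (res m c0)), vtx m (rep c) = vtx m (rep c0) := by
    intro c hc
    have := (mem_extF.mp hc).2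
    rw [← rv_pr (n := m) (rep c0), ← rv_pr (n := m) (rep c), pr_rep]
    exact this
  refine Finset.card_le_card_of_injOn
    (fun c => if hc : c ∈ extF m a (rv (res m c0)) then
      pr N (splice m (rep c) (rep c0) (key c hc)) else c0) ?_ ?_
  · intro c hc
    have hc' := mem_extF.mp hc
    simp only [Finset.mem_coe] at hc
    simp only [hc, dif_pos, Finset.mem_coe, mem_extF, rv_pr, vtx_splice h']
    refine ⟨?_, rfl⟩
    rw [res_pr (h.trans h'), ← res_pr h, pr_splice, pr_rep, hc'.1]
  · intro c hc d hd hcd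
    simp only [Finset.mem_coe] at hc hd
    simp only [hc, hd, dif_pos] at hcd
    have := pr_mono h' hcd
    rwa [pr_splice, pr_splice, pr_rep, pr_rep] at this

theorem extF_grow (heven : B.IsEven) (n M : ℕ) : ∃ N0, n ≤ N0 ∧ ∀ N, N0 ≤ N →
    ∀ (a : B.P n) (c0 : B.P N), M ≤ (extF N a (rv c0)).card := by
  suffices h : ∃ N0, n ≤ N0 ∧ ∀ (a : B.P n) (v : B.V N0), M ≤ (extF N0 a v).card by
    obtain ⟨N0, h0, h1⟩ := h
    exact ⟨N0, h0, fun N hN a c0 => (h1 a _).trans (extF_mono h0 hN a c0)⟩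
  induction M with
  | zero => exact ⟨n, le_rfl, by simp⟩
  | succ M ih =>
    obtain ⟨m, hm, h1⟩ := ih
    obtain ⟨L, hL⟩ := heven m
    refine ⟨m + L + 1, by omega, fun a v => ?_⟩
    rw [card_extF_comp hm]
    have h2 : ∀ b : B.P m, 2 ≤ (extF (m + L + 1) b v).card := by
      intro b
      rw [card_extF_seg]
      obtain ⟨h3, k, hk⟩ := hL (rv b) v
      omega
    refine le_trans ?_ (Finset.sum_le_sum fun b _ => h2 b)
    rw [Finset.sum_const, smul_eq_mul]
    set K := Finset.univ.filter (fun b : B.P m => res n b = a) with hK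
    have h3 : M ≤ K.card := by
      refine (h1 a (rv (Classical.arbitrary (B.P m)))).trans (Finset.card_le_card ?_)
      intro c hc
      simp [hK, (mem_extF.mp hc).1]
    have h4 : 0 < K.card := by
      rw [Finset.card_pos]
      exact ⟨pr m (rep a), by simp [hK, res_pr hm]⟩
    omega

end BratteliDiagram

namespace BratteliDiagram

variable {B : BratteliDiagram}

/-- the full group as a type -/
abbrev FG (B : BratteliDiagram) : Type := ↥B.fullGroup

theorem mem_levelIn {N : ℕ} {g : FG B} : g ∈ B.levelIn N ↔ g.1 ∈ B.level N := Iff.rfl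

theorem level_pr {N : ℕ} {g : FG B} (hg : g ∈ B.levelIn N) {x y : B.Path}
    (h : pr N x = pr N y) : pr N (g • x) = pr N (g • y) :=
  pr_eq.mpr fun i hi => hg.1.2 x y (pr_eq.mp h) i hi

theorem level_tail {N : ℕ} {g : FG B} (hg : g ∈ B.levelIn N) (x : B.Path) {i : ℕ} (hi : N ≤ i) :
    (g • x).1 i = x.1 i := hg.1.1 x i hi

theorem level_vtx {N m : ℕ} (hm : N ≤ m) {g : FG B} (hg : g ∈ B.levelIn N) (x : B.Path) :
    vtx m (g • x) = vtx m x := by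
  unfold vtx
  rw [level_tail hg x hm]

theorem levelIn_mono {n N : ℕ} (h : n ≤ N) : B.levelIn n ≤ B.levelIn N :=
  fun _ hg => B.level_mono h hg

theorem exists_level (g : FG B) : ∃ N, g ∈ B.levelIn N := g.2

theorem fg_ext {g g' : FG B} (h : ∀ x : B.Path, g • x = g' • x) : g = g' :=
  Subtype.ext (Equiv.ext h)

theorem level_ext {N : ℕ} {g g' : FG B} (hg : g ∈ B.levelIn N) (hg' : g' ∈ B.levelIn N)
    (h : ∀ x : B.Path, pr N (g • x) = pr N (g' • x)) : g = g' :=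
  fg_ext fun x => path_ext (h x) fun i hi => by rw [level_tail hg x hi, level_tail hg' x hi]

/-- permutations of prefixes preserving the end vertex -/
def SN (B : BratteliDiagram) (N : ℕ) : Subgroup (Equiv.Perm (B.P N)) where
  carrier := { σ | ∀ p, rv (σ p) = rv p }
  one_mem' := fun _ => rfl
  mul_mem' := fun {a b} ha hb p => (ha (b p)).trans (hb p)
  inv_mem' := fun {a} ha p => by
    have := ha (a⁻¹ p)
    have h2 : a (a⁻¹ p) = p := a.apply_symm_apply p
    rw [h2] at this
    exact this.symm

theorem mem_SN {N : ℕ} {σ : Equiv.Perm (B.P N)} : σ ∈ SN B N ↔ ∀ p, rv (σ p) = rv p := Iff.rfl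

theorem swap_mem_SN {N : ℕ} {c d : B.P N} (h : rv c = rv d) : Equiv.swap c d ∈ SN B N := by
  intro p
  rw [Equiv.swap_apply_def]
  split_ifs with h1 h2
  · rw [h1, h]
  · rw [h2, h]
  · rfl

/-- the lift of a permutation of prefixes to the path space -/
def liftFun {N : ℕ} (σ : SN B N) (x : B.Path) : B.Path :=
  splice N (rep (σ.1 (pr N x))) x (by
    rw [← rv_pr (n := N) (rep _), pr_rep, σ.2, rv_pr])

theorem pr_liftFun {N : ℕ} (σ : SN B N) (x : B.Path) : pr N (liftFun σ x) = σ.1 (pr N x) := by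
  rw [liftFun, pr_splice, pr_rep]

theorem liftFun_tail {N : ℕ} (σ : SN B N) (x : B.Path) {i : ℕ} (hi : N ≤ i) :
    (liftFun σ x).1 i = x.1 i := splice_ge hi

theorem liftFun_mul {N : ℕ} (σ τ : SN B N) (x : B.Path) :
    liftFun (σ * τ) x = liftFun σ (liftFun τ x) := by
  apply path_ext (n := N)
  · simp only [pr_liftFun]; rfl
  · intro i hi
    simp only [liftFun_tail _ _ hi]

theorem liftFun_one {N : ℕ} (x : B.Path) : liftFun (1 : SN B N) x = x := by
  apply path_ext (n := N)
  · simp only [pr_liftFun]; rfl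
  · intro i hi
    simp only [liftFun_tail _ _ hi]

/-- the lift as a permutation -/
def liftPerm {N : ℕ} (σ : SN B N) : Equiv.Perm B.Path where
  toFun := liftFun σ
  invFun := liftFun σ⁻¹
  left_inv x := by rw [← liftFun_mul, inv_mul_cancel, liftFun_one]
  right_inv x := by rw [← liftFun_mul, mul_inv_cancel, liftFun_one]

theorem isLevel_liftPerm {N : ℕ} (σ : SN B N) : B.IsLevel N (liftPerm σ) :=
  ⟨fun x i hi => liftFun_tail σ x hi, fun x y h => by
    apply pr_eq.mp
    change pr N (liftFun σ x) = pr N (liftFun σ y)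
    rw [pr_liftFun, pr_liftFun, pr_eq.mpr h]⟩

/-- the homomorphism from prefix permutations to the full group -/
def rho (B : BratteliDiagram) (N : ℕ) : SN B N →* FG B where
  toFun σ := ⟨liftPerm σ, N, isLevel_liftPerm σ, isLevel_liftPerm σ⁻¹⟩
  map_one' := Subtype.ext (Equiv.ext fun x => liftFun_one x)
  map_mul' σ τ := Subtype.ext (Equiv.ext fun x => liftFun_mul σ τ x)

theorem rho_mem {N : ℕ} (σ : SN B N) : rho B N σ ∈ B.levelIn N :=
  ⟨isLevel_liftPerm σ, isLevel_liftPerm σ⁻¹⟩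

theorem pr_rho {N : ℕ} (σ : SN B N) (x : B.Path) : pr N (rho B N σ • x) = σ.1 (pr N x) :=
  pr_liftFun σ x

theorem exists_rho {N : ℕ} {g : FG B} (hg : g ∈ B.levelIn N) : ∃ σ : SN B N, rho B N σ = g := by
  let f : FG B → B.P N → B.P N := fun g p => pr N (g • rep p)
  have hf : ∀ g ∈ B.levelIn N, ∀ x, f g (pr N x) = pr N (g • x) := fun g hg x =>
    level_pr hg (pr_rep _)
  have hff : ∀ g ∈ B.levelIn N, ∀ g' ∈ B.levelIn N, g * g' = 1 → ∀ p, f g (f g' p) = p := by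
    intro g hg g' hg' h p
    obtain ⟨x, rfl⟩ := pr_surj N p
    rw [hf g' hg', hf g hg, ← mul_smul, h, one_smul]
  let σ : Equiv.Perm (B.P N) := ⟨f g, f g⁻¹, hff _ (inv_mem hg) _ hg (inv_mul_cancel g),
    hff _ hg _ (inv_mem hg) (mul_inv_cancel g)⟩
  have hσ : σ ∈ SN B N := by
    intro p
    obtain ⟨x, rfl⟩ := pr_surj N p
    change rv (f g (pr N x)) = _
    rw [hf g hg, rv_pr, rv_pr, level_vtx le_rfl hg]
  refine ⟨⟨σ, hσ⟩, level_ext (rho_mem _) hg fun x => ?_⟩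
  rw [pr_rho]
  exact hf g hg x

instance (N : ℕ) : Finite (B.levelIn N) := by
  refine Finite.of_surjective (fun σ : SN B N => (⟨rho B N σ, rho_mem σ⟩ : B.levelIn N)) ?_
  rintro ⟨g, hg⟩
  obtain ⟨σ, h⟩ := exists_rho hg
  exact ⟨σ, Subtype.ext h⟩

instance : Countable (FG B) := by
  have : (Set.univ : Set (FG B)) = ⋃ N, (B.levelIn N : Set (FG B)) := by
    ext g
    simpa using exists_level g
  rw [← Set.countable_univ_iff, this]
  exact Set.countable_iUnion fun N =>
    Set.countable_coe_iff.mp (inferInstanceAs (Countable (B.levelIn N)))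

theorem rho_up {n N : ℕ} (h : n ≤ N) (σ : SN B n) : ∃ σ' : SN B N, rho B N σ' = rho B n σ ∧
    (∀ c, res n (σ'.1 c) = σ.1 (res n c)) ∧ (∀ c, σ.1 (res n c) = res n c → σ'.1 c = c) := by
  obtain ⟨σ', hσ'⟩ := exists_rho (levelIn_mono h (rho_mem σ))
  refine ⟨σ', hσ', fun c => ?_, fun c hc => ?_⟩
  · obtain ⟨x, rfl⟩ := pr_surj N c
    rw [← pr_rho, res_pr h, res_pr h, hσ', pr_rho]
  · obtain ⟨x, rfl⟩ := pr_surj N c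
    rw [← pr_rho, hσ']
    rw [res_pr h, ← pr_rho] at hc
    rw [path_ext hc]
    intro i hi
    exact level_tail (rho_mem σ) x hi

/-- permutations of prefixes of level `N` lying in the subgroup `K` -/
def HN (K : Subgroup (FG B)) (N : ℕ) : Subgroup (Equiv.Perm (B.P N)) :=
  (K.comap (rho B N)).map (SN B N).subtype

theorem mem_HN {K : Subgroup (FG B)} {N : ℕ} {σ : Equiv.Perm (B.P N)} :
    σ ∈ HN K N ↔ ∃ h : σ ∈ SN B N, rho B N ⟨σ, h⟩ ∈ K := by
  constructor
  · rintro ⟨σ', h, rfl⟩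
    exact ⟨σ'.2, h⟩
  · rintro ⟨h, h'⟩
    exact ⟨⟨σ, h⟩, h', rfl⟩

/-- the rigid stabilizer -/
def Rst (V : Set B.Path) : Subgroup (FG B) where
  carrier := { g | ∀ x, x ∉ V → g • x = x }
  one_mem' := fun x _ => one_smul _ x
  mul_mem' := fun {a b} ha hb x hx => by rw [mul_smul, hb x hx, ha x hx]
  inv_mem' := fun {a} ha x hx => by rw [inv_smul_eq_iff, ha x hx]

theorem mem_Rst {V : Set B.Path} {g : FG B} : g ∈ Rst V ↔ ∀ x, x ∉ V → g • x = x := Iff.rfl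

theorem Rst_maps {V : Set B.Path} {g : FG B} (hg : g ∈ Rst V) {x : B.Path} (hx : x ∈ V) :
    g • x ∈ V := by
  by_contra h
  have := (Rst V).inv_mem hg (g • x) h
  rw [inv_smul_smul] at this
  rw [← this] at h
  exact h hx

theorem Rst_comm {V W : Set B.Path} (h : Disjoint V W) {a b : FG B} (ha : a ∈ Rst V)
    (hb : b ∈ Rst W) : a * b = b * a := by
  apply fg_ext
  intro x
  rw [mul_smul, mul_smul]
  by_cases hV : x ∈ V
  · have h1 : x ∉ W := Set.disjoint_left.mp h hV
    have h2 : a • x ∉ W := Set.disjoint_left.mp h (Rst_maps ha hV)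
    rw [hb x h1, hb _ h2]
  · by_cases hW : x ∈ W
    · have h2 : b • x ∉ V := Set.disjoint_right.mp h (Rst_maps hb hW)
      rw [ha x hV, ha _ h2]
    · rw [hb x hW, ha x hV, hb x hW]

theorem Rst_conj {V : Set B.Path} (h : FG B) {a : FG B} (ha : a ∈ Rst V) :
    h * a * h⁻¹ ∈ Rst {x | h⁻¹ • x ∈ V} := by
  intro x hx
  rw [mul_smul, mul_smul, ha _ hx, smul_inv_smul]

/-! topology -/

instance (i : ℕ) : DiscreteTopology (B.E i) := ⟨rfl⟩

theorem path_isClosed : IsClosed { x : ∀ i, B.E i |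
    ∀ i, B.rng i (x i) = B.src (i + 1) (x (i + 1)) } := by
  simp only [Set.ofPred_forall]
  refine isClosed_iInter fun i => ?_
  let F : B.E i × B.E (i + 1) → Prop := fun p => B.rng i p.1 = B.src (i + 1) p.2
  have : { x : ∀ i, B.E i | B.rng i (x i) = B.src (i + 1) (x (i + 1)) } =
      (fun x : ∀ i, B.E i => (x i, x (i + 1))) ⁻¹' { p | F p } := rfl
  rw [this]
  exact (isClosed_discrete _).preimage (by fun_prop)

instance : CompactSpace B.Path :=
  isCompact_iff_compactSpace.mp (path_isClosed (B := B)).isCompact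

instance : T2Space B.Path :=
  inferInstanceAs (T2Space { x : ∀ i, B.E i // ∀ i, B.rng i (x i) = B.src (i + 1) (x (i + 1)) })

instance (i : ℕ) : SecondCountableTopology (B.E i) :=
  have : Countable (B.E i) := Finite.to_countable
  inferInstance

instance : SecondCountableTopology B.Path :=
  Topology.IsInducing.secondCountableTopology (f := fun x : B.Path => x.1) ⟨rfl⟩

instance : BorelSpace B.Path := ⟨rfl⟩

theorem continuous_coord (i : ℕ) : Continuous fun x : B.Path => x.1 i :=
  (continuous_apply i).comp continuous_subtype_val

theorem isClopen_pr {n : ℕ} (T : Set (B.P n)) : IsClopen { x : B.Path | pr n x ∈ T } := by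
  have key : ∀ p : B.P n, IsClopen { x : B.Path | pr n x = p } := by
    intro p
    have : { x : B.Path | pr n x = p } =
        ⋂ i ∈ Finset.range n, { x : B.Path | x.1 i = (rep p).1 i } := by
      ext x
      simp only [Set.mem_ofPred_eq, Set.mem_iInter, Finset.mem_range]
      rw [← pr_eq, pr_rep]
    rw [this]
    exact isClopen_biInter_finset fun i _ =>
      (isClopen_discrete {(rep p).1 i}).preimage (continuous_coord i)
  have : { x : B.Path | pr n x ∈ T } = ⋃ p ∈ T, { x : B.Path | pr n x = p } := by
    ext x; simp
  rw [this]
  exact (Set.toFinite T).isClopen_biUnion fun p _ => key p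

theorem exists_cyl {U : Set B.Path} (hU : IsOpen U) {x : B.Path} (hx : x ∈ U) :
    ∃ n, ∀ y, pr n y = pr n x → y ∈ U := by
  obtain ⟨U', hU', rfl⟩ := isOpen_induced_iff.mp hU
  rw [isOpen_pi_iff] at hU'
  obtain ⟨I, u, hu, hI⟩ := hU' x.1 hx
  refine ⟨I.sup id + 1, fun y hy => hI fun i hi => ?_⟩
  have : y.1 i = x.1 i := pr_eq.mp hy i (Nat.lt_succ_of_le (Finset.le_sup (f := id) hi))
  rw [this]
  exact (hu i hi).2

theorem continuous_fg (g : FG B) : Continuous fun x : B.Path => g • x := by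
  rw [continuous_iff_continuousAt]
  intro x
  obtain ⟨N, hg⟩ := exists_level g
  rw [ContinuousAt, tendsto_def]
  intro s hs
  obtain ⟨U, hUs, hU, hxU⟩ := mem_nhds_iff.mp hs
  obtain ⟨n, hn⟩ := exists_cyl hU hxU
  have hop : IsOpen { y : B.Path | pr (max n N) y ∈ ({pr (max n N) x} : Set _) } :=
    (isClopen_pr _).isOpen
  refine mem_nhds_iff.mpr ⟨_, ?_, hop, rfl⟩
  intro y hy
  refine hUs (hn _ (pr_mono (le_max_left n N) ?_))
  exact level_pr (levelIn_mono (le_max_right n N) hg) hy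

theorem measurable_fg (g : FG B) : Measurable fun x : B.Path => g • x :=
  (continuous_fg g).measurable

theorem measurableSet_pr {n : ℕ} (T : Set (B.P n)) : MeasurableSet { x : B.Path | pr n x ∈ T } :=
  (isClopen_pr T).isOpen.measurableSet

theorem exists_pr_ne {x y : B.Path} (h : x ≠ y) : ∃ n, ∀ N, n ≤ N → pr N x ≠ pr N y := by
  have : ∃ i, x.1 i ≠ y.1 i := by
    by_contra hc
    push Not at hc
    exact h (Subtype.ext (funext hc))
  obtain ⟨i, hi⟩ := this
  exact ⟨i + 1, fun N hN hc => hi (pr_eq.mp hc i (by omega))⟩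

end BratteliDiagram

namespace BratteliDiagram

variable {B : BratteliDiagram}

open Equiv in
theorem pair_lemma {Q V : Type*} [DecidableEq Q] [DecidableEq V] (K : Subgroup (Perm Q))
    (r : Q → V) (A : Finset Q) : ∀ (σ : Perm Q), (∀ x, σ (σ x) = x) → (∀ x ∈ A, σ x ∉ A) →
    (∀ x, σ x ≠ x → x ∈ A ∨ σ x ∈ A) → (∀ v, Even (A.filter fun x => r x = v).card) →
    (∀ c ∈ A, ∀ d ∈ A, c ≠ d → r c = r d → swap c (σ c) * swap d (σ d) ∈ K) → σ ∈ K := by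
  induction A using Finset.strongInduction with
  | H A ih =>
  intro σ hσ hA hmv hev hK
  rcases A.eq_empty_or_nonempty with rfl | ⟨c, hc⟩
  · have : σ = 1 := by
      ext x
      by_contra h
      simpa using hmv x h
    rw [this]
    exact one_mem _
  · have hcf : c ∈ A.filter fun x => r x = r c := by simp [hc]
    have h2 : 1 < (A.filter fun x => r x = r c).card := by
      have h0 : 0 < (A.filter fun x => r x = r c).card := Finset.card_pos.mpr ⟨c, hcf⟩
      obtain ⟨t, ht⟩ := hev (r c)
      omega
    obtain ⟨d, hdf, hdc⟩ := Finset.exists_mem_ne h2 c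
    obtain ⟨hd, hrd⟩ := Finset.mem_filter.mp hdf
    have hcσ : σ c ≠ c := fun h => hA c hc (by rw [h]; exact hc)
    have hdσ : σ d ≠ d := fun h => hA d hd (by rw [h]; exact hd)
    have hcd : σ c ≠ d := fun h => hA c hc (h ▸ hd)
    have hdc' : σ d ≠ c := fun h => hA d hd (h ▸ hc)
    have hσcd : σ c ≠ σ d := fun h => hdc (σ.injective h).symm
    set s := swap c (σ c) * swap d (σ d) with hs
    have hsK : s ∈ K := hK c hc d hd hdc.symm hrd.symm
    set σ' := s * σ with hσ'
    have hval : ∀ x, σ' x = if x = c ∨ x = σ c ∨ x = d ∨ x = σ d then x else σ x := by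
      intro x
      have e1 : σ' x = swap c (σ c) (swap d (σ d) (σ x)) := rfl
      rw [e1]
      split_ifs with h
      · rcases h with rfl | rfl | rfl | rfl
        · rw [swap_apply_of_ne_of_ne hcd hσcd, swap_apply_right]
        · rw [hσ, swap_apply_of_ne_of_ne hdc.symm hdc'.symm, swap_apply_left]
        · rw [swap_apply_right, swap_apply_of_ne_of_ne hdc hcd.symm]
        · rw [hσ, swap_apply_left, swap_apply_of_ne_of_ne hdc' hσcd.symm]
      · push Not at h
        obtain ⟨a1, a2, a3, a4⟩ := h
        have b1 : σ x ≠ c := fun h => a2 (by rw [← h, hσ])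
        have b2 : σ x ≠ σ c := fun h => a1 (σ.injective h)
        have b3 : σ x ≠ d := fun h => a4 (by rw [← h, hσ])
        have b4 : σ x ≠ σ d := fun h => a3 (σ.injective h)
        rw [swap_apply_of_ne_of_ne b3 b4, swap_apply_of_ne_of_ne b1 b2]
    have hnot : ∀ x ∈ (A.erase c).erase d, ¬ (x = c ∨ x = σ c ∨ x = d ∨ x = σ d) := by
      intro x hx
      simp only [Finset.mem_erase] at hx
      rintro (rfl | rfl | rfl | rfl)
      · exact hx.2.1 rfl
      · exact hA c hc hx.2.2
      · exact hx.1 rfl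
      · exact hA d hd hx.2.2
    have hval' : ∀ x ∈ (A.erase c).erase d, σ' x = σ x := fun x hx => by
      rw [hval, if_neg (hnot x hx)]
    have hfin : σ' ∈ K := by
      apply ih ((A.erase c).erase d)
      · exact (Finset.erase_subset _ _).trans_ssubset (Finset.erase_ssubset hc)
      · intro x
        by_cases h : x = c ∨ x = σ c ∨ x = d ∨ x = σ d
        · rw [hval x, if_pos h, hval x, if_pos h]
        · have h' : ¬ (σ x = c ∨ σ x = σ c ∨ σ x = d ∨ σ x = σ d) := by
            rintro (h1 | h1 | h1 | h1)
            · exact h (Or.inr (Or.inl (by rw [← h1, hσ])))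
            · exact h (Or.inl (σ.injective h1))
            · exact h (Or.inr (Or.inr (Or.inr (by rw [← h1, hσ]))))
            · exact h (Or.inr (Or.inr (Or.inl (σ.injective h1))))
          rw [hval x, if_neg h, hval (σ x), if_neg h', hσ]
      · intro x hx hx'
        rw [hval' x hx] at hx'
        simp only [Finset.mem_erase] at hx hx'
        exact hA x hx.2.2 hx'.2.2
      · intro x hx
        by_cases h : x = c ∨ x = σ c ∨ x = d ∨ x = σ d
        · rw [hval x, if_pos h] at hx
          exact absurd rfl hx
        · rw [hval x, if_neg h] at hx ⊢
          push Not at h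
          obtain ⟨a1, a2, a3, a4⟩ := h
          have b1 : σ x ≠ c := fun h => a2 (by rw [← h, hσ])
          have b3 : σ x ≠ d := fun h => a4 (by rw [← h, hσ])
          simp only [Finset.mem_erase]
          rcases hmv x hx with h | h
          · exact Or.inl ⟨a3, a1, h⟩
          · exact Or.inr ⟨b3, b1, h⟩
      · intro v
        rw [Finset.filter_erase, Finset.filter_erase]
        by_cases hv : r c = v
        · have m1 : d ∈ (A.filter fun x => r x = v).erase c := by
            simp [hdc, hd, hrd, hv]
          have m2 : c ∈ A.filter fun x => r x = v := by simp [hc, hv]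
          rw [Finset.card_erase_of_mem m1, Finset.card_erase_of_mem m2]
          have := hev v
          rw [Nat.even_iff] at this ⊢
          have h0 : 1 < (A.filter fun x => r x = v).card := by rw [← hv]; exact h2
          omega
        · have m2 : c ∉ A.filter fun x => r x = v := by simp [hv]
          have m1 : d ∉ A.filter fun x => r x = v := by simp [hrd, hv]
          rw [Finset.erase_eq_of_notMem m2, Finset.erase_eq_of_notMem m1]
          exact hev v
      · intro c' hc' d' hd' hne hr
        rw [hval' c' hc', hval' d' hd']
        simp only [Finset.mem_erase] at hc' hd'
        exact hK c' hc'.2.2 d' hd'.2.2 hne hr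
    have : σ = s⁻¹ * σ' := by rw [hσ']; group
    rw [this]
    exact mul_mem (inv_mem hsK) hfin

open Equiv in
/-- the form in which the pairing lemma is used -/
theorem pair_apply (heven : B.IsEven) (n : ℕ) : ∃ N0, n ≤ N0 ∧ ∀ N, N0 ≤ N →
    ∀ (K : Subgroup (FG B)) (a b : B.P n), rv a = rv b → a ≠ b →
    (∀ c c' d d' : B.P N, res n c = a → res n c' = b → res n d = a → res n d' = b →
      rv c = rv c' → rv d = rv d' → rv c = rv d → c ≠ d → c' ≠ d' → c ≠ c' → d ≠ d' →
      c ≠ d' → d ≠ c' → swap c c' * swap d d' ∈ HN K N) → swap a b ∈ HN K n := by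
  obtain ⟨N0, h0, hN0⟩ := extF_even heven n
  refine ⟨N0, h0, fun N hN K a b hr hab hK => ?_⟩
  have hnN : n ≤ N := h0.trans hN
  obtain ⟨σ, h1, h2, h3⟩ := rho_up hnN ⟨swap a b, swap_mem_SN hr⟩
  have hinv : ∀ c, σ.1 (σ.1 c) = c := by
    have hh : σ * σ = 1 := by
      apply Subtype.ext
      ext c
      by_cases hc : swap a b (res n c) = res n c
      · have := h3 c hc
        change σ.1 (σ.1 c) = c
        rw [this, this]
      · have e1 : rho B N (σ * σ) = 1 := by
          rw [map_mul, h1, ← map_mul]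
          have : (⟨swap a b, swap_mem_SN hr⟩ * ⟨swap a b, swap_mem_SN hr⟩ : SN B n) = 1 :=
            Subtype.ext (swap_mul_self a b)
          rw [this, map_one]
        obtain ⟨x, rfl⟩ := pr_surj N c
        rw [← pr_rho, e1, one_smul]
        rfl
    intro c
    have := congrArg (fun s : SN B N => s.1 c) hh
    exact this
  have hmem : σ.1 ∈ HN K N := by
    apply pair_lemma (HN K N) rv (Finset.univ.filter fun c : B.P N => res n c = a) σ.1 hinv
    · intro c hc hc'
      simp only [Finset.mem_filter, Finset.mem_univ, true_and] at hc hc'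
      rw [h2, hc] at hc'
      simp only [swap_apply_left] at hc'
      exact hab hc'.symm
    · intro c hc
      simp only [Finset.mem_filter, Finset.mem_univ, true_and, h2]
      by_contra hcon
      push Not at hcon
      apply hc
      apply h3
      change swap a b _ = _
      apply swap_apply_of_ne_of_ne hcon.1
      intro hb
      apply hcon.2
      rw [hb]
      exact swap_apply_right a b
    · intro v
      have := hN0 N hN a v
      unfold extF at this
      rwa [Finset.filter_filter]
    · intro c hc d hd hcd hrcd
      simp only [Finset.mem_filter, Finset.mem_univ, true_and] at hc hd
      have h4 : ∀ c, res n c = a → res n (σ.1 c) = b := fun c hc => by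
        rw [h2, hc]; exact swap_apply_left a b
      have h5 : ∀ c d, res n c = a → res n d = a → c ≠ σ.1 d := fun c d hc hd h => by
        have := h4 d hd
        rw [← h, hc] at this
        exact hab this
      exact hK c (σ.1 c) d (σ.1 d) hc (h4 c hc) hd (h4 d hd) (σ.2 c).symm (σ.2 d).symm hrcd hcd
        (fun h => hcd (σ.1.injective h)) (h5 c c hc hc) (h5 d d hd hd) (h5 c d hc hd) (h5 d c hd hc)
  obtain ⟨h', hk⟩ := mem_HN.mp hmem
  refine mem_HN.mpr ⟨swap_mem_SN hr, ?_⟩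
  rw [← h1]
  exact hk

open Equiv in
theorem pigeon {Q F : Type*} [DecidableEq Q] [Group F] [Fintype F] {L : Subgroup (Perm Q)}
    (f : L →* F) (A : Finset Q) (t : Q → Q → L)
    (ht : ∀ e ∈ A, ∀ e' ∈ A, (t e e' : Perm Q) = swap e e') (hcard : Fintype.card F + 1 < A.card) :
    ∀ c ∈ A, ∀ c' ∈ A, ∀ d ∈ A, ∀ d' ∈ A, c ≠ c' → d ≠ d' → f (t c c' * t d d') = 1 := by
  have hne : A.Nonempty := Finset.card_pos.mp (by omega)
  obtain ⟨c0, hc0⟩ := hne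
  have hc : (Finset.univ : Finset F).card < (A.erase c0).card := by
    rw [Finset.card_erase_of_mem hc0, Finset.card_univ]; omega
  obtain ⟨d, hd, d', hd', hdd, hfd⟩ := Finset.exists_ne_map_eq_of_card_lt_of_maps_to hc
    (f := fun d => f (t c0 d)) (fun _ _ => Finset.mem_coe.mpr (Finset.mem_univ _))
  simp only [Finset.mem_erase] at hd hd'
  set θ := f (t c0 d) with hθ
  have h1 : ∀ e ∈ A, e ≠ c0 → f (t c0 e) = θ := by
    intro e he hec
    by_cases hed : e = d
    · rw [hed]
    by_cases hed' : e = d'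
    · rw [hed', hθ]; exact hfd.symm
    have a1 : t d' e * t c0 d * t d' e = t c0 d := by
      apply Subtype.ext
      rw [Subgroup.coe_mul, Subgroup.coe_mul, ht _ hd'.2 _ he, ht _ hc0 _ hd.2]
      have : swap d' e * swap c0 d * swap d' e = swap d' e * swap c0 d * (swap d' e)⁻¹ := by
        rw [swap_inv]
      rw [this, ← Equiv.swap_apply_apply, swap_apply_of_ne_of_ne hd'.1.symm hec.symm,
        swap_apply_of_ne_of_ne hdd (Ne.symm hed)]
    have a2 : t d' e * t c0 d' * t d' e = t c0 e := by
      apply Subtype.ext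
      rw [Subgroup.coe_mul, Subgroup.coe_mul, ht _ hd'.2 _ he, ht _ hc0 _ hd'.2, ht _ hc0 _ he]
      have : swap d' e * swap c0 d' * swap d' e = swap d' e * swap c0 d' * (swap d' e)⁻¹ := by
        rw [swap_inv]
      rw [this, ← Equiv.swap_apply_apply, swap_apply_of_ne_of_ne hd'.1.symm hec.symm,
        swap_apply_left]
    rw [← a2, hθ, ← a1, map_mul, map_mul, map_mul, map_mul]
    rw [← hfd]
  have hθ2 : θ * θ = 1 := by
    rw [hθ, ← map_mul]
    have : t c0 d * t c0 d = 1 := by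
      apply Subtype.ext
      rw [Subgroup.coe_mul, ht _ hc0 _ hd.2, swap_mul_self]; rfl
    rw [this, map_one]
  have h2 : ∀ e ∈ A, ∀ e' ∈ A, e ≠ e' → f (t e e') = θ := by
    intro e he e' he' hee
    by_cases h : e = c0
    · rw [h]; exact h1 e' he' (fun h' => hee (h.trans h'.symm))
    by_cases h' : e' = c0
    · have : t e e' = t e' e := Subtype.ext (by rw [ht _ he _ he', ht _ he' _ he, swap_comm])
      rw [this, h']; exact h1 e he h
    have a2 : t c0 e * t c0 e' * t c0 e = t e e' := by
      apply Subtype.ext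
      rw [Subgroup.coe_mul, Subgroup.coe_mul, ht _ hc0 _ he, ht _ hc0 _ he', ht _ he _ he']
      have : swap c0 e * swap c0 e' * swap c0 e = swap c0 e * swap c0 e' * (swap c0 e)⁻¹ := by
        rw [swap_inv]
      rw [this, ← Equiv.swap_apply_apply, swap_apply_left,
        swap_apply_of_ne_of_ne h' hee.symm]
    rw [← a2, map_mul, map_mul, h1 e he h, h1 e' he' h', hθ2, one_mul]
  intro c hc c' hc' d hd d' hd' h h'
  rw [map_mul, h2 c hc c' hc' h, h2 d hd d' hd' h', hθ2]

end BratteliDiagram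

namespace BratteliDiagram

variable {B : BratteliDiagram}

theorem rho_fix {N : ℕ} (σ : SN B N) {x : B.Path} (h : σ.1 (pr N x) = pr N x) :
    rho B N σ • x = x :=
  path_ext (n := N) (by rw [pr_rho, h]) fun _ hi => level_tail (rho_mem σ) x hi

/-- the lift of a transposition -/
def tau {N : ℕ} (a b : B.P N) (h : rv a = rv b) : FG B := rho B N ⟨Equiv.swap a b, swap_mem_SN h⟩

theorem tau_fix {N : ℕ} {a b : B.P N} (h : rv a = rv b) {x : B.Path} (h1 : pr N x ≠ a)
    (h2 : pr N x ≠ b) : tau a b h • x = x :=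
  rho_fix _ (Equiv.swap_apply_of_ne_of_ne h1 h2)

theorem pr_tau {N : ℕ} {a b : B.P N} (h : rv a = rv b) (x : B.Path) :
    pr N (tau a b h • x) = Equiv.swap a b (pr N x) := pr_rho _ x

theorem tau_inv {N : ℕ} {a b : B.P N} (h : rv a = rv b) : (tau a b h)⁻¹ = tau a b h := by
  unfold tau
  rw [← map_inv]
  congr 1

theorem tau_mem_HN {N : ℕ} {a b : B.P N} (h : rv a = rv b) {K : Subgroup (FG B)} :
    Equiv.swap a b ∈ HN K N ↔ tau a b h ∈ K := by
  rw [mem_HN]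
  exact ⟨fun ⟨_, h⟩ => h, fun h' => ⟨_, h'⟩⟩

/-- clopen set given by a set of prefixes -/
def cyl (n : ℕ) (T : Set (B.P n)) : Set B.Path := { x | pr n x ∈ T }

theorem mem_cyl {n : ℕ} {T : Set (B.P n)} {x : B.Path} : x ∈ cyl n T ↔ pr n x ∈ T := Iff.rfl

theorem tau_mem_Rst {n N : ℕ} (hn : n ≤ N) {T : Set (B.P n)} {a b : B.P N} (h : rv a = rv b)
    (ha : res n a ∈ T) (hb : res n b ∈ T) : tau a b h ∈ Rst (cyl n T) := by
  intro x hx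
  apply tau_fix
  · rintro rfl
    rw [res_pr hn] at ha
    exact hx ha
  · rintro rfl
    rw [res_pr hn] at hb
    exact hx hb

theorem good_of_index (heven : B.IsEven) (n : ℕ) (T : Set (B.P n)) (K : Subgroup (FG B)) (M : ℕ)
    (hM : ∀ N, ¬ ∃ f : Fin M → FG B, (∀ i, f i ∈ Rst (cyl n T) ⊓ B.levelIn N) ∧
      ∀ i j, i ≠ j → f i * (f j)⁻¹ ∉ K) :
    ∀ m, n ≤ m → ∀ (a b : B.P m) (h : rv a = rv b), res n a ∈ T → res n b ∈ T → tau a b h ∈ K := by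
  intro m hm a b hr ha hb
  by_cases hab : a = b
  · subst hab
    have : tau a a hr = 1 := by
      unfold tau
      have : (⟨Equiv.swap a a, swap_mem_SN hr⟩ : SN B m) = 1 := Subtype.ext (Equiv.swap_self a)
      rw [this, map_one]
    rw [this]
    exact one_mem _
  rw [← tau_mem_HN]
  obtain ⟨N1, hN1, hpair⟩ := pair_apply heven m
  obtain ⟨N2, hN2, hgrow⟩ := extF_grow heven n (M.factorial + 2)
  set N := max N1 N2 with hN
  have hmN : m ≤ N := hN1.trans (le_max_left _ _)
  have hnN : n ≤ N := hm.trans hmN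
  apply hpair N (le_max_left _ _) K a b hr hab
  intro c c' d d' hc hc' hd hd' rc rd rcd hcd hcd' hcc hdd _ _
  classical
  let L := HN (Rst (cyl n T)) N
  let K' := (HN K N).subgroupOf L
  have : Finite (L ⧸ K') := inferInstance
  have : Fintype (L ⧸ K') := Fintype.ofFinite _
  have hidx : Fintype.card (L ⧸ K') < M := by
    by_contra hlt
    push Not at hlt
    obtain ⟨q⟩ := Function.Embedding.nonempty_of_card_le (α := Fin M) (β := L ⧸ K') (by simpa using hlt)
    have hl : ∀ l : L, ∃ g : FG B, g ∈ Rst (cyl n T) ⊓ B.levelIn N ∧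
        ∃ h : l.1 ∈ SN B N, g = rho B N ⟨l.1, h⟩ := fun l => by
      obtain ⟨h, h'⟩ := mem_HN.mp l.2
      exact ⟨_, ⟨h', rho_mem _⟩, h, rfl⟩
    choose g hg1 hg2 hg3 using hl
    apply hM N
    refine ⟨fun i => g ((q i).out)⁻¹, fun i => hg1 _, ?_⟩
    intro i j hij hK
    apply hij
    apply q.injective
    rw [← QuotientGroup.out_eq' (q i), ← QuotientGroup.out_eq' (q j), QuotientGroup.eq]
    rw [Subgroup.mem_subgroupOf, mem_HN]
    refine ⟨?_, ?_⟩
    · exact mul_mem (hg2 ((q i).out)⁻¹) (hg2 _)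
    · beta_reduce at hK
      rw [hg3, hg3, ← map_inv, ← map_mul] at hK
      convert hK using 2
      apply Subtype.ext
      simp [L]
  let f : L →* Equiv.Perm (L ⧸ K') := MulAction.toPermHom L (L ⧸ K')
  let A : Finset (B.P N) := Finset.univ.filter fun e => res n e ∈ T ∧ rv e = rv c
  have hAsw : ∀ e ∈ A, ∀ e' ∈ A, Equiv.swap e e' ∈ L := by
    intro e he e' he'
    simp only [A, Finset.mem_filter, Finset.mem_univ, true_and] at he he'
    exact (tau_mem_HN (he.2.trans he'.2.symm)).mpr (tau_mem_Rst hnN _ he.1 he'.1)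
  let t : B.P N → B.P N → L := fun e e' => if h : Equiv.swap e e' ∈ L then ⟨_, h⟩ else 1
  have ht : ∀ e ∈ A, ∀ e' ∈ A, (t e e' : Equiv.Perm (B.P N)) = Equiv.swap e e' := by
    intro e he e' he'
    simp only [t, dif_pos (hAsw e he e' he')]
  have hcard : Fintype.card (Equiv.Perm (L ⧸ K')) + 1 < A.card := by
    have h1 : Fintype.card (Equiv.Perm (L ⧸ K')) ≤ M.factorial := by
      rw [Fintype.card_perm]
      exact Nat.factorial_le hidx.le
    have h2 := hgrow N (le_max_right _ _) (res n c) c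
    have h3 : (extF N (res n c) (rv c)).card ≤ A.card := by
      apply Finset.card_le_card
      intro e he
      rw [mem_extF] at he
      simp only [A, Finset.mem_filter, Finset.mem_univ, true_and, he.1, he.2, and_true]
      rw [← res_res hm c, hc]
      exact ha
    omega
  have hTa : ∀ e : B.P N, res m e = a → res n e ∈ T := fun e he => by
    rw [← res_res hm e, he]; exact ha
  have hTb : ∀ e : B.P N, res m e = b → res n e ∈ T := fun e he => by
    rw [← res_res hm e, he]; exact hb
  have mA : ∀ e : B.P N, res n e ∈ T → rv e = rv c → e ∈ A := fun e h1 h2 => by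
    simp [A, h1, h2]
  have c1 := mA c (hTa c hc) rfl
  have c2 := mA c' (hTb c' hc') rc.symm
  have c3 := mA d (hTa d hd) rcd.symm
  have c4 := mA d' (hTb d' hd') (rd.symm.trans rcd.symm)
  have hf := pigeon f A t ht hcard c c1 c' c2 d c3 d' c4 hcc hdd
  have hk : t c c' * t d d' ∈ K' := by
    have e1 : (f (t c c' * t d d')) (((1 : L) : L ⧸ K')) = ((1 : L) : L ⧸ K') := by
      rw [hf]; rfl
    have e2 : ((t c c' * t d d' * 1 : L) : L ⧸ K') = ((1 : L) : L ⧸ K') := e1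
    rw [mul_one, QuotientGroup.eq, mul_one] at e2
    exact inv_mem_iff.mp e2
  rw [Subgroup.mem_subgroupOf, Subgroup.coe_mul, ht _ c1 _ c2, ht _ c3 _ c4] at hk
  exact hk

end BratteliDiagram

theorem mem_conjSub {Γ : Type*} [Group Γ] {g x : Γ} {H : Subgroup Γ} :
    x ∈ conjSub g H ↔ g⁻¹ * x * g ∈ H := by
  unfold conjSub
  rw [Subgroup.mem_map]
  constructor
  · rintro ⟨y, hy, rfl⟩
    simpa [mul_assoc] using hy
  · intro h
    exact ⟨_, h, by simp [mul_assoc]⟩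

theorem measurableSet_memSub {Γ : Type*} [Group Γ] (g : Γ) : MeasurableSet {H : Subgroup Γ | g ∈ H} :=
  ⟨{s | g ∈ s}, measurableSet_mem g, rfl⟩

namespace BratteliDiagram

variable {B : BratteliDiagram}

/-- elements of `Rst V` which extend by `Rst W` to an element of `H` -/
def KK (V W : Set B.Path) (hd : Disjoint V W) (H : Subgroup (FG B)) : Subgroup (FG B) where
  carrier := { γ | γ ∈ Rst V ∧ ∃ γ' ∈ Rst W, γ * γ' ∈ H }
  one_mem' := ⟨one_mem _, 1, one_mem _, by rw [one_mul]; exact one_mem _⟩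
  mul_mem' := by
    rintro a b ⟨ha, a', ha', haH⟩ ⟨hb, b', hb', hbH⟩
    refine ⟨mul_mem ha hb, a' * b', mul_mem ha' hb', ?_⟩
    have : a * b * (a' * b') = (a * a') * (b * b') := by
      rw [mul_assoc a b, ← mul_assoc b, Rst_comm hd hb ha', mul_assoc, mul_assoc]
    rw [this]
    exact mul_mem haH hbH
  inv_mem' := by
    rintro a ⟨ha, a', ha', haH⟩
    refine ⟨inv_mem ha, a'⁻¹, inv_mem ha', ?_⟩
    rw [← mul_inv_rev, ← Rst_comm hd ha ha']
    exact inv_mem haH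

theorem mem_KK {V W : Set B.Path} {hd : Disjoint V W} {H : Subgroup (FG B)} {γ : FG B} :
    γ ∈ KK V W hd H ↔ γ ∈ Rst V ∧ ∃ γ' ∈ Rst W, γ * γ' ∈ H := Iff.rfl

theorem KK_conj {V W : Set B.Path} {hd : Disjoint V W} {H : Subgroup (FG B)} {γ a : FG B}
    (hγ : γ ∈ Rst V) (ha : a ∈ KK V W hd H) : γ * a * γ⁻¹ ∈ KK V W hd (conjSub γ H) := by
  obtain ⟨ha, a', ha', haH⟩ := ha
  refine ⟨mul_mem (mul_mem hγ ha) (inv_mem hγ), a', ha', ?_⟩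
  rw [mem_conjSub]
  have : γ⁻¹ * (γ * a * γ⁻¹ * a') * γ = a * a' := by
    rw [mul_assoc _ γ⁻¹ a', Rst_comm hd (inv_mem hγ) ha']; group
  rw [this]
  exact haH

theorem KK_conj_iff {V W : Set B.Path} {hd : Disjoint V W} {H : Subgroup (FG B)} {γ a : FG B}
    (hγ : γ ∈ Rst V) : γ * a * γ⁻¹ ∈ KK V W hd (conjSub γ H) ↔ a ∈ KK V W hd H := by
  refine ⟨fun h => ?_, KK_conj hγ⟩
  have := KK_conj (inv_mem hγ) h
  have e1 : γ⁻¹ * (γ * a * γ⁻¹) * γ⁻¹⁻¹ = a := by group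
  have e2 : conjSub γ⁻¹ (conjSub γ H) = H := by
    ext x
    rw [mem_conjSub, mem_conjSub]
    have : γ⁻¹ * (γ⁻¹⁻¹ * x * γ⁻¹) * γ = x := by group
    rw [this]
  rwa [e1, e2] at this

theorem KK_of_conj {V : Set B.Path} {h : FG B} (hd : Disjoint V {x | h⁻¹ • x ∈ V})
    {H : Subgroup (FG B)} {a b : FG B} (ha : a ∈ Rst V) (hb : b ∈ Rst V)
    (haH : a * h * a⁻¹ ∈ H) (hbH : b * h * b⁻¹ ∈ H) : a * b⁻¹ ∈ KK V _ hd H := by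
  have hc : h * (a⁻¹ * b) * h⁻¹ ∈ Rst {x | h⁻¹ • x ∈ V} := Rst_conj h (mul_mem (inv_mem ha) hb)
  refine ⟨mul_mem ha (inv_mem hb), _, hc, ?_⟩
  have : a * b⁻¹ * (h * (a⁻¹ * b) * h⁻¹) = a * h * a⁻¹ * (b * h * b⁻¹)⁻¹ := by
    rw [mul_assoc a b⁻¹, Rst_comm hd (inv_mem hb) hc]; group
  rw [this]
  exact mul_mem haH (inv_mem hbH)

theorem measurableSet_KK {V W : Set B.Path} (hd : Disjoint V W) (γ : FG B) :
    MeasurableSet {H : Subgroup (FG B) | γ ∈ KK V W hd H} := by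
  by_cases h : γ ∈ Rst V
  · have : {H : Subgroup (FG B) | γ ∈ KK V W hd H} =
        ⋃ γ' : FG B, ⋃ _ : γ' ∈ Rst W, {H | γ * γ' ∈ H} := by
      ext H
      simp [mem_KK, h]
    rw [this]
    exact MeasurableSet.iUnion fun γ' => MeasurableSet.iUnion fun _ => measurableSet_memSub _
  · have : {H : Subgroup (FG B) | γ ∈ KK V W hd H} = ∅ := by
      ext H
      simp [mem_KK, h]
    rw [this]
    exact MeasurableSet.empty

/-- large index event -/
def DD (V W : Set B.Path) (hd : Disjoint V W) (M N : ℕ) : Set (Subgroup (FG B)) :=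
  { H | ∃ f : Fin M → FG B, (∀ i, f i ∈ Rst V ⊓ B.levelIn N) ∧
      ∀ i j, i ≠ j → f i * (f j)⁻¹ ∉ KK V W hd H }

theorem measurableSet_DD (V W : Set B.Path) (hd : Disjoint V W) (M N : ℕ) :
    MeasurableSet (DD V W hd M N) := by
  have : DD V W hd M N = ⋃ f : Fin M → FG B, ⋃ _ : ∀ i, f i ∈ Rst V ⊓ B.levelIn N,
      ⋂ i, ⋂ j, ⋂ _ : i ≠ j, {H : Subgroup (FG B) | f i * (f j)⁻¹ ∈ KK V W hd H}ᶜ := by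
    ext H
    simp [DD]
  rw [this]
  exact MeasurableSet.iUnion fun f => MeasurableSet.iUnion fun _ => MeasurableSet.iInter fun i =>
    MeasurableSet.iInter fun j => MeasurableSet.iInter fun _ => (measurableSet_KK hd _).compl

theorem DD_conj {V W : Set B.Path} {hd : Disjoint V W} {M N : ℕ} {γ : FG B}
    (hγ : γ ∈ Rst V ⊓ B.levelIn N) (H : Subgroup (FG B)) (h : H ∈ DD V W hd M N) :
    conjSub γ H ∈ DD V W hd M N := by
  obtain ⟨f, hf, hK⟩ := h
  refine ⟨fun i => γ * f i * γ⁻¹, fun i => mul_mem (mul_mem hγ (hf i)) (inv_mem hγ), ?_⟩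
  intro i j hij hh
  have e : γ * f i * γ⁻¹ * (γ * f j * γ⁻¹)⁻¹ = γ * (f i * (f j)⁻¹) * γ⁻¹ := by group
  rw [e, KK_conj_iff hγ.1] at hh
  exact hK i j hij hh

theorem conjSub_inv_self {Γ : Type*} [Group Γ] (γ : Γ) (H : Subgroup Γ) :
    conjSub γ⁻¹ (conjSub γ H) = H := by
  ext x
  rw [mem_conjSub, mem_conjSub]
  have : γ⁻¹ * (γ⁻¹⁻¹ * x * γ⁻¹) * γ = x := by group
  rw [this]

theorem avg_bound {φ : Measure (Subgroup (FG B))} (hφ : IsIRS (FG B) φ) {V : Set B.Path} {h : FG B}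
    (hd : Disjoint V {x | h⁻¹ • x ∈ V}) (M N : ℕ) :
    M * φ ({H | h ∈ H} ∩ DD V _ hd M N) ≤ 1 := by
  classical
  have hprob := hφ.1
  set D := DD V _ hd M N with hD
  have hDm : MeasurableSet D := measurableSet_DD _ _ _ _ _
  set Γ : Subgroup (FG B) := Rst V ⊓ B.levelIn N with hΓ
  have hfin : Finite Γ := by
    have : (Γ : Set (FG B)) ⊆ (B.levelIn N : Set (FG B)) := fun g hg => hg.2
    have h2 : (B.levelIn N : Set (FG B)).Finite := Set.finite_coe_iff.mp (inferInstanceAs (Finite (B.levelIn N)))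
    exact (h2.subset this).to_subtype
  have : Fintype Γ := Fintype.ofFinite _
  let E : Γ → Set (Subgroup (FG B)) := fun γ => {H | γ.1 * h * γ.1⁻¹ ∈ H} ∩ D
  have hEm : ∀ γ, MeasurableSet (E γ) := fun γ => (measurableSet_memSub _).inter hDm
  have hE : ∀ γ : Γ, φ (E γ) = φ ({H | h ∈ H} ∩ D) := by
    intro γ
    rw [← hφ.2 γ.1⁻¹ _ ((measurableSet_memSub h).inter hDm)]
    congr 1
    ext H
    simp only [E, Set.mem_inter_iff, Set.mem_ofPred_eq, Set.mem_preimage, mem_conjSub, inv_inv]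
    refine and_congr Iff.rfl ⟨fun h => DD_conj (inv_mem γ.2) H h, fun h => ?_⟩
    have := DD_conj γ.2 _ h
    have e := conjSub_inv_self γ.1⁻¹ H
    rw [inv_inv] at e
    rwa [e] at this
  have hpt : ∀ H, (M : ℝ≥0∞) * ∑ γ : Γ, (E γ).indicator (fun _ => (1 : ℝ≥0∞)) H ≤
      (Fintype.card Γ : ℝ≥0∞) := by
    intro H
    by_cases hH : H ∈ D
    · obtain ⟨f, hf, hK⟩ := hH
      let R : Finset Γ := Finset.univ.filter fun γ => γ.1 * h * γ.1⁻¹ ∈ H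
      have e1 : ∑ γ : Γ, (E γ).indicator (fun _ => (1 : ℝ≥0∞)) H = (R.card : ℝ≥0∞) := by
        have : ∀ γ : Γ, (E γ).indicator (fun _ => (1 : ℝ≥0∞)) H =
            if γ.1 * h * γ.1⁻¹ ∈ H then 1 else 0 := by
          intro γ
          have hiff : H ∈ E γ ↔ γ.1 * h * γ.1⁻¹ ∈ H :=
            ⟨fun h => h.1, fun h => ⟨h, f, hf, hK⟩⟩
          rw [Set.indicator_apply]
          simp only [hiff]
        simp only [this]
        rw [Finset.sum_boole]
      rw [e1]
      have hinj : (Finset.univ ×ˢ R : Finset (Fin M × Γ)).card ≤ (Finset.univ : Finset Γ).card := by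
        apply Finset.card_le_card_of_injOn (fun p => (⟨f p.1, hf p.1⟩ : Γ)⁻¹ * p.2)
        · intro _ _; exact Finset.mem_coe.mpr (Finset.mem_univ _)
        · rintro ⟨i, a⟩ hia ⟨j, b⟩ hjb hab
          simp only [Finset.coe_product, Set.mem_prod, Finset.mem_coe, R, Finset.mem_filter,
            Finset.mem_univ, true_and] at hia hjb
          have hab' : (f i)⁻¹ * a.1 = (f j)⁻¹ * b.1 := congrArg Subtype.val hab
          have hij : i = j := by
            by_contra hij
            apply hK i j hij
            have : f i * (f j)⁻¹ = a.1 * b.1⁻¹ := by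
              rw [eq_mul_inv_iff_mul_eq, mul_assoc, ← hab']; group
            rw [this]
            exact KK_of_conj hd a.2.1 b.2.1 hia hjb
          subst hij
          rw [Prod.mk.injEq]
          exact ⟨rfl, Subtype.ext (mul_left_cancel hab')⟩
      rw [Finset.card_product, Finset.card_univ, Finset.card_univ, Fintype.card_fin] at hinj
      exact_mod_cast hinj
    · have : ∀ γ : Γ, (E γ).indicator (fun _ => (1 : ℝ≥0∞)) H = 0 := fun γ =>
        Set.indicator_of_notMem (fun h => hH h.2) _
      simp [this]
  have hIneq : (M : ℝ≥0∞) * ∑ γ : Γ, φ (E γ) ≤ Fintype.card Γ := by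
    have e1 : ∑ γ : Γ, φ (E γ) = ∫⁻ H, ∑ γ : Γ, (E γ).indicator (fun _ => (1 : ℝ≥0∞)) H ∂φ := by
      rw [lintegral_finsetSum _ fun γ _ => measurable_const.indicator (hEm γ)]
      refine Finset.sum_congr rfl fun γ _ => ?_
      rw [lintegral_indicator (hEm γ)]; simp
    rw [e1, ← lintegral_const_mul _ (Finset.measurable_sum _
      fun γ _ => measurable_const.indicator (hEm γ))]
    refine (lintegral_mono hpt).trans ?_
    simp
  simp only [hE, Finset.sum_const, Finset.card_univ, nsmul_eq_mul] at hIneq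
  have hc : (Fintype.card Γ : ℝ≥0∞) ≠ 0 := by
    have : 0 < Fintype.card Γ := Fintype.card_pos
    exact_mod_cast this.ne'
  have hc' : (Fintype.card Γ : ℝ≥0∞) ≠ ⊤ := ENNReal.natCast_ne_top _
  rw [mul_left_comm] at hIneq
  have h3 : (Fintype.card Γ : ℝ≥0∞) * (M * φ ({H | h ∈ H} ∩ D)) ≤ Fintype.card Γ * 1 := by
    rw [mul_one]; exact hIneq
  exact (ENNReal.mul_le_mul_iff_right hc hc').mp h3

theorem DD_mono {V W : Set B.Path} {hd : Disjoint V W} {M : ℕ} : Monotone (DD V W hd M) := by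
  rintro N N' h H ⟨f, hf, hK⟩
  exact ⟨f, fun i => ⟨(hf i).1, levelIn_mono h (hf i).2⟩, hK⟩

/-- goodness of `H` for an element `h` displacing the clopen set -/
def Good (H : Subgroup (FG B)) (h : FG B) (n : ℕ) (T : Set (B.P n)) : Prop :=
  ∀ m, n ≤ m → ∀ (a b : B.P m) (hr : rv a = rv b), res n a ∈ T → res n b ∈ T →
    ∃ γ' ∈ Rst {x | h⁻¹ • x ∈ cyl n T}, tau a b hr * γ' ∈ H

theorem ae_good_one (heven : B.IsEven) {φ : Measure (Subgroup (FG B))} (hφ : IsIRS (FG B) φ)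
    (h : FG B) (n : ℕ) (T : Set (B.P n)) (hd : Disjoint (cyl n T) {x | h⁻¹ • x ∈ cyl n T}) :
    ∀ᵐ H ∂φ, h ∈ H → Good H h n T := by
  have hz : φ (⋂ M, ({H | h ∈ H} ∩ ⋃ N, DD _ _ hd M N)) = 0 := by
    have hb : ∀ M : ℕ, M * φ ({H | h ∈ H} ∩ ⋃ N, DD _ _ hd M N) ≤ 1 := by
      intro M
      rw [Set.inter_iUnion]
      have hm : Monotone fun N => {H : Subgroup (FG B) | h ∈ H} ∩ DD _ _ hd M N :=
        fun a b hab => Set.inter_subset_inter_right _ (DD_mono hab)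
      rw [hm.measure_iUnion, ENNReal.mul_iSup]
      exact iSup_le fun N => avg_bound hφ hd M N
    have hb2 : ∀ M : ℕ, (M : ℝ≥0∞) * φ (⋂ M, ({H | h ∈ H} ∩ ⋃ N, DD _ _ hd M N)) ≤ 1 := fun M =>
      (mul_le_mul_right (measure_mono (Set.iInter_subset _ M)) _).trans (hb M)
    by_contra hne
    obtain ⟨M, hM⟩ := ENNReal.exists_nat_mul_gt hne ENNReal.one_ne_top
    exact absurd (hb2 M) (not_le.mpr hM)
  rw [ae_iff]
  refine measure_mono_null ?_ hz
  intro H hH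
  simp only [Set.mem_ofPred_eq, Classical.not_imp] at hH
  simp only [Set.mem_iInter]
  by_contra hcon
  push Not at hcon
  obtain ⟨M, hM⟩ := hcon
  apply hH.2
  have hM' : ∀ N, H ∉ DD _ _ hd M N := fun N hN => hM ⟨hH.1, Set.mem_iUnion.mpr ⟨N, hN⟩⟩
  intro m hm a b hr ha hb
  exact (good_of_index heven n T (KK _ _ hd H) M hM' m hm a b hr ha hb).2

theorem ae_good (heven : B.IsEven) {φ : Measure (Subgroup (FG B))} (hφ : IsIRS (FG B) φ) :
    ∀ᵐ H ∂φ, ∀ h ∈ H, ∀ n (T : Set (B.P n)), Disjoint (cyl n T) {x | h⁻¹ • x ∈ cyl n T} →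
      Good H h n T := by
  have : ∀ᵐ H ∂φ, ∀ h : FG B, ∀ n (T : Set (B.P n)),
      Disjoint (cyl n T) {x | h⁻¹ • x ∈ cyl n T} → h ∈ H → Good H h n T := by
    rw [ae_all_iff]; intro h
    rw [ae_all_iff]; intro n
    rw [ae_all_iff]; intro T
    by_cases hd : Disjoint (cyl n T) {x | h⁻¹ • x ∈ cyl n T}
    · filter_upwards [ae_good_one heven hφ h n T hd] with H hH _ using hH
    · exact Filter.Eventually.of_forall fun H h => absurd h hd
  filter_upwards [this] with H hH h hh n T hd using hH h n T hd hh

end BratteliDiagram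

namespace BratteliDiagram

variable {B : BratteliDiagram}

/-- the good property for all displaced clopen sets -/
def AllGood (H : Subgroup (FG B)) : Prop :=
  ∀ h ∈ H, ∀ n (T : Set (B.P n)), Disjoint (cyl n T) {x | h⁻¹ • x ∈ cyl n T} → Good H h n T

theorem comm_lemma {G : Type*} [Group G] (H : Subgroup G) {γ γ' δ δ' : G} (h1 : γ * γ' ∈ H)
    (h2 : δ * δ' ∈ H) (c1 : γ * γ' = γ' * γ) (c2 : δ * γ' = γ' * δ) (c3 : γ' * δ' = δ' * γ')
    (c4 : γ * δ' = δ' * γ) : γ * δ * γ⁻¹ * δ⁻¹ ∈ H := by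
  have : γ * δ * γ⁻¹ * δ⁻¹ = (γ * γ') * (δ * δ') * (γ * γ')⁻¹ * (δ * δ')⁻¹ := by
    have k1 : Commute γ γ' := c1
    have k2 : Commute δ γ' := c2
    have k3 : Commute γ' δ' := c3
    have k4 : Commute γ δ' := c4
    have e1 : γ' * (δ * δ') * γ'⁻¹ = δ * δ' := by
      rw [mul_inv_eq_iff_eq_mul]; exact (k2.symm.mul_right k3).eq
    have e2 : δ' * γ⁻¹ = γ⁻¹ * δ' := (k4.symm.inv_right).eq
    calc γ * δ * γ⁻¹ * δ⁻¹ = γ * δ * (γ⁻¹ * δ') * δ'⁻¹ * δ⁻¹ := by group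
      _ = γ * (δ * δ') * γ⁻¹ * (δ * δ')⁻¹ := by rw [← e2]; group
      _ = γ * (γ' * (δ * δ') * γ'⁻¹) * γ⁻¹ * (δ * δ')⁻¹ := by rw [e1]
      _ = _ := by group
  rw [this]
  exact mul_mem (mul_mem (mul_mem h1 h2) (inv_mem h1)) (inv_mem h2)

open Equiv in
theorem CL (heven : B.IsEven) {H : Subgroup (FG B)} (hg : AllGood H) {h h' : FG B} (hh : h ∈ H)
    (hh' : h' ∈ H) {n : ℕ} {T : Set (B.P n)} (d1 : Disjoint (cyl n T) {x | h⁻¹ • x ∈ cyl n T})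
    (d2 : Disjoint (cyl n T) {x | h'⁻¹ • x ∈ cyl n T})
    (d3 : Disjoint {x | h⁻¹ • x ∈ cyl n T} {x | h'⁻¹ • x ∈ cyl n T}) :
    ∀ m, n ≤ m → ∀ (a b : B.P m) (hr : rv a = rv b), res n a ∈ T → res n b ∈ T →
      tau a b hr ∈ H := by
  intro m hm a b hr ha hb
  by_cases hab : a = b
  · subst hab
    have : tau a a hr = 1 := by
      unfold tau
      have : (⟨Equiv.swap a a, swap_mem_SN hr⟩ : SN B m) = 1 := Subtype.ext (Equiv.swap_self a)
      rw [this, map_one]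
    rw [this]
    exact one_mem _
  rw [← tau_mem_HN]
  obtain ⟨N, hN, hpair⟩ := pair_apply heven m
  apply hpair N le_rfl H a b hr hab
  intro c c' d d' hc hc' hd hd' rc rd rcd hcd hcd' hcc hdd hcd1 hdc1
  have hTa : ∀ e : B.P N, res m e = a → res n e ∈ T := fun e he => by
    rw [← res_res hm e, he]; exact ha
  have hTb : ∀ e : B.P N, res m e = b → res n e ∈ T := fun e he => by
    rw [← res_res hm e, he]; exact hb
  have hnN := hm.trans hN
  have rcd' : rv c' = rv d' := rc.symm.trans (rcd.trans rd)
  have Tc := hTa c hc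
  have Td := hTa d hd
  have Tc' := hTb c' hc'
  have Td' := hTb d' hd'
  obtain ⟨γ', hγ', hγH⟩ := hg h hh n T d1 N hnN c c' rc Tc Tc'
  have k1 : tau c d rcd ∈ KK _ _ d2 H := ⟨tau_mem_Rst hnN _ Tc Td,
    hg h' hh' n T d2 N hnN c d rcd Tc Td⟩
  have k2 : tau c' d' rcd' ∈ KK _ _ d2 H := ⟨tau_mem_Rst hnN _ Tc' Td',
    hg h' hh' n T d2 N hnN c' d' rcd' Tc' Td'⟩
  obtain ⟨hδ, δ', hδ', hδH⟩ := mul_mem k1 k2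
  have hγ : tau c c' rc ∈ Rst (cyl n T) := tau_mem_Rst hnN _ Tc Tc'
  have key := comm_lemma H hγH hδH (Rst_comm d1 hγ hγ') (Rst_comm d1 hδ hγ') (Rst_comm d3 hγ' hδ')
    (Rst_comm d2 hγ hδ')
  rw [mem_HN]
  refine ⟨mul_mem (swap_mem_SN rc) (swap_mem_SN rd), ?_⟩
  convert key using 1
  unfold tau
  rw [← map_mul, ← map_mul, ← map_inv, ← map_mul, ← map_inv, ← map_mul]
  congr 1
  apply Subtype.ext
  change swap c c' * swap d d' = swap c c' * (swap c d * swap c' d') * (swap c c')⁻¹ *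
    (swap c d * swap c' d')⁻¹
  have e : (swap c d * swap c' d') * (swap c c') * (swap c d * swap c' d')⁻¹ = swap d d' := by
    rw [← Equiv.swap_apply_apply]
    congr 1
    · rw [Perm.mul_apply, swap_apply_of_ne_of_ne hcc hcd1, swap_apply_left]
    · rw [Perm.mul_apply, swap_apply_left, swap_apply_of_ne_of_ne hcd1.symm hdd.symm]
  rw [← e, swap_inv]
  simp only [mul_assoc]

/-- fixed point set of a subgroup -/
def FixS (H : Subgroup (FG B)) : Set B.Path := { x | ∀ g ∈ H, g • x = x }

theorem local_good (heven : B.IsEven) {H : Subgroup (FG B)} (hg : AllGood H) {x : B.Path}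
    (hx : x ∉ FixS H) : ∃ m, ∀ N, m ≤ N → ∀ (a b : B.P N) (hr : rv a = rv b),
      res m a = pr m x → res m b = pr m x → tau a b hr ∈ H := by
  have : ∃ h ∈ H, h • x ≠ x := by
    by_contra hcon
    push Not at hcon
    exact hx hcon
  obtain ⟨h, hh, hhx⟩ := this
  obtain ⟨N1, hN1⟩ := exists_level h
  obtain ⟨N2, hN2⟩ := exists_pr_ne hhx
  set n := max N1 N2
  have hmap : ∀ y : B.Path, pr n y = pr n x → pr n (h • y) ≠ pr n x := fun y hy => by
    rw [level_pr (levelIn_mono (le_max_left _ _) hN1) hy]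
    exact hN2 n (le_max_right _ _)
  have hd : Disjoint (cyl n {pr n x}) {y | h⁻¹ • y ∈ cyl n {pr n x}} := by
    rw [Set.disjoint_left]
    intro y hy hy'
    have := hmap _ hy'
    rw [smul_inv_smul] at this
    exact this hy
  obtain ⟨N, hN, hgrow⟩ := extF_grow heven n 2
  have h2 := hgrow N le_rfl (pr n x) (pr N x)
  have hxm : pr N x ∈ extF N (pr n x) (rv (pr N x)) := mem_extF.mpr ⟨res_pr hN x, rfl⟩
  obtain ⟨d, hdm, hdc⟩ := Finset.exists_mem_ne (by omega : 1 < (extF N (pr n x) (rv (pr N x))).card)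
    (pr N x)
  obtain ⟨hd1, hd2⟩ := mem_extF.mp hdm
  obtain ⟨γ', hγ', hγH⟩ := hg h hh n _ hd N hN (pr N x) d hd2.symm (res_pr hN x) hd1
  set c := pr N x with hc
  have hmap2 : ∀ y : B.Path, pr N y = c → pr N ((tau c d hd2.symm * γ') • y) = d := by
    intro y hy
    have hyV : y ∈ cyl n {pr n x} := by
      have : pr n y = pr n x := by rw [← res_pr hN y, hy, hc, res_pr hN]
      exact this
    rw [mul_smul, hγ' y (Set.disjoint_left.mp hd hyV), pr_tau, hy, Equiv.swap_apply_left]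
  have hsub : ∀ y, (tau c d hd2.symm * γ')⁻¹ • y ∈ cyl N {c} → pr N y = d := by
    intro y hy
    have := hmap2 _ hy
    rwa [smul_inv_smul] at this
  have hsubV : ∀ y, y ∈ cyl N {c} → y ∈ cyl n {pr n x} := by
    intro y hy
    have hy : pr N y = c := hy
    have : pr n y = pr n x := by rw [← res_pr hN y, hy, hc, res_pr hN]
    exact this
  refine ⟨N, fun M hM a b hr ha hb => ?_⟩
  refine CL heven hg (T := {c}) hγH hh ?_ ?_ ?_ M hM a b hr ha hb
  · rw [Set.disjoint_left]
    intro y hy hy'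
    exact hdc ((hsub y hy').symm.trans hy)
  · exact hd.mono (fun y hy => hsubV y hy) (fun y (hy : h⁻¹ • y ∈ cyl N {c}) => hsubV (h⁻¹ • y) hy)
  · rw [Set.disjoint_left]
    intro y hy hy'
    have hyd := hsub y hy
    have hyV : y ∈ cyl n {pr n x} := by
      have : pr n y = pr n x := by rw [← res_pr hN y, hyd, hd1]
      exact this
    exact Set.disjoint_left.mp hd hyV (hsubV _ hy')

theorem exists_two {α : Type*} [DecidableEq α] {s : Finset α} (h : 3 ≤ s.card) (c : α) :
    ∃ d ∈ s, ∃ e ∈ s, d ≠ c ∧ e ≠ c ∧ d ≠ e := by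
  have h1 : 1 < (s.erase c).card := by
    have := Finset.pred_card_le_card_erase (s := s) (a := c)
    omega
  obtain ⟨d, hd, e, he, hde⟩ := Finset.one_lt_card.mp h1
  simp only [Finset.mem_erase] at hd he
  exact ⟨d, hd.2, e, he.2, hd.1, he.1, hde⟩

theorem two_good (heven : B.IsEven) {H : Subgroup (FG B)} (hg : AllGood H) {x y : B.Path}
    (hx : x ∉ FixS H) (hy : y ∉ FixS H) (hxy : x ≠ y) :
    ∃ m, ∀ N, m ≤ N → ∀ (a b : B.P N) (hr : rv a = rv b),
      res m a = pr m x → res m b = pr m y → tau a b hr ∈ H := by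
  obtain ⟨m1, hm1⟩ := local_good heven hg hx
  obtain ⟨m2, hm2⟩ := local_good heven hg hy
  obtain ⟨m3, hm3⟩ := exists_pr_ne hxy
  set m := max m1 (max m2 m3) with hm
  have l1 : m1 ≤ m := le_max_left _ _
  have l2 : m2 ≤ m := (le_max_left _ _).trans (le_max_right _ _)
  have l3 : m3 ≤ m := (le_max_right _ _).trans (le_max_right _ _)
  obtain ⟨N, hN, hgrow⟩ := extF_grow heven m 3
  obtain ⟨d1, hd1, e1, he1, n1, n2, n3⟩ :=
    exists_two (hgrow N le_rfl (pr m x) (pr N x)) (pr N x)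
  obtain ⟨d2, hd2, e2, he2, k1, k2, k3⟩ :=
    exists_two (hgrow N le_rfl (pr m y) (pr N y)) (pr N y)
  rw [mem_extF] at hd1 he1 hd2 he2
  have hc1 : res m (pr N x) = pr m x := res_pr hN x
  have hc2 : res m (pr N y) = pr m y := res_pr hN y
  set c1 := pr N x with hc1'
  set c2 := pr N y with hc2'
  have hne : ∀ p q : B.P N, res m p = pr m x → res m q = pr m y → p ≠ q := by
    rintro p q hp hq rfl
    exact hm3 m l3 (hp.symm.trans hq)
  have hH1 : ∀ (p q : B.P N) (hr : rv p = rv q), res m p = pr m x → res m q = pr m x →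
      tau p q hr ∈ H := fun p q hr hp hq => hm1 N (l1.trans hN) p q hr
    (by rw [← res_res l1, hp, res_pr l1]) (by rw [← res_res l1, hq, res_pr l1])
  have hH2 : ∀ (p q : B.P N) (hr : rv p = rv q), res m p = pr m y → res m q = pr m y →
      tau p q hr ∈ H := fun p q hr hp hq => hm2 N (l2.trans hN) p q hr
    (by rw [← res_res l2, hp, res_pr l2]) (by rw [← res_res l2, hq, res_pr l2])
  have hh := mul_mem (hH1 c1 d1 hd1.2.symm hc1 hd1.1) (hH2 c2 d2 hd2.2.symm hc2 hd2.1)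
  have hh' := mul_mem (hH1 c1 e1 he1.2.symm hc1 he1.1) (hH2 c2 e2 he2.2.symm hc2 he2.1)
  have img : ∀ (f1 f2 : B.P N) (r1 : rv c1 = rv f1) (r2 : rv c2 = rv f2), res m f1 = pr m x →
      res m f2 = pr m y → ∀ z : B.Path, (tau c1 f1 r1 * tau c2 f2 r2)⁻¹ • z ∈ cyl N {c1, c2} →
      pr N z = f1 ∨ pr N z = f2 := by
    intro f1 f2 r1 r2 hf1 hf2 z hz
    have e : pr N z = Equiv.swap c1 f1 (Equiv.swap c2 f2
        (pr N ((tau c1 f1 r1 * tau c2 f2 r2)⁻¹ • z))) := by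
      rw [← pr_tau r2, ← pr_tau r1, ← mul_smul, smul_inv_smul]
    rcases hz with hz | hz
    · left
      rw [e, hz, Equiv.swap_apply_of_ne_of_ne (hne _ _ hc1 hc2) (hne _ _ hc1 hf2),
        Equiv.swap_apply_left]
    · right
      have hz' : pr N ((tau c1 f1 r1 * tau c2 f2 r2)⁻¹ • z) = c2 := hz
      rw [e, hz', Equiv.swap_apply_left,
        Equiv.swap_apply_of_ne_of_ne (hne _ _ hc1 hf2).symm (hne _ _ hf1 hf2).symm]
  refine ⟨N, fun M hM a b hr ha hb => ?_⟩
  refine CL heven hg (T := {c1, c2}) hh hh' ?_ ?_ ?_ M hM a b hr (Or.inl ha) (Or.inr hb)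
  · rw [Set.disjoint_left]
    intro z hz hz'
    have h1 := img _ _ _ _ hd1.1 hd2.1 z hz'
    rcases hz with hz | hz <;> rcases h1 with h1 | h1
    · exact n1 (h1.symm.trans hz)
    · exact hne _ _ hc1 hd2.1 (hz.symm.trans h1)
    · exact hne _ _ hd1.1 hc2 (h1.symm.trans hz)
    · exact k1 (h1.symm.trans hz)
  · rw [Set.disjoint_left]
    intro z hz hz'
    have h1 := img _ _ _ _ he1.1 he2.1 z hz'
    rcases hz with hz | hz <;> rcases h1 with h1 | h1
    · exact n2 (h1.symm.trans hz)
    · exact hne _ _ hc1 he2.1 (hz.symm.trans h1)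
    · exact hne _ _ he1.1 hc2 (h1.symm.trans hz)
    · exact k2 (h1.symm.trans hz)
  · rw [Set.disjoint_left]
    intro z hz hz'
    have h1 := img _ _ _ _ hd1.1 hd2.1 z hz
    have h2 := img _ _ _ _ he1.1 he2.1 z hz'
    rcases h2 with hz | hz <;> rcases h1 with h1 | h1
    · exact n3 (h1.symm.trans hz)
    · exact hne _ _ he1.1 hd2.1 (hz.symm.trans h1)
    · exact hne _ _ hd1.1 he2.1 (h1.symm.trans hz)
    · exact k3 (h1.symm.trans hz)

open Equiv in
theorem perm_mem_of_swaps {Q : Type*} [Finite Q] [DecidableEq Q] (K : Subgroup (Perm Q)) (σ : Perm Q)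
    (h : ∀ c, σ c ≠ c → swap c (σ c) ∈ K) : σ ∈ K := by
  let S : Set (Perm Q) := {τ | ∃ c, σ c ≠ c ∧ τ = swap c (σ c)}
  have hS : Subgroup.closure S ≤ K := by
    rw [Subgroup.closure_le]
    rintro _ ⟨c, hc, rfl⟩
    exact h c hc
  apply hS
  rw [_root_.mem_closure_isSwap]
  · refine ⟨Set.toFinite _, fun x => ?_⟩
    by_cases hx : σ x = x
    · rw [hx]; exact MulAction.mem_orbit_self x
    · exact ⟨⟨_, Subgroup.subset_closure ⟨x, hx, rfl⟩⟩, swap_apply_left x (σ x)⟩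
  · rintro _ ⟨c, hc, rfl⟩
    exact ⟨c, σ c, Ne.symm hc, rfl⟩

theorem mem_of_fix (heven : B.IsEven) {H : Subgroup (FG B)} (hg : AllGood H) {g : FG B}
    (hgf : ∀ x ∈ FixS H, g • x = x) : g ∈ H := by
  obtain ⟨N1, hN1⟩ := exists_level g
  have hloc : ∀ x : B.Path, ∃ m, N1 ≤ m ∧ ∀ M, m ≤ M → ∀ y : B.Path, pr m y = pr m x →
      g • y ≠ y → Equiv.swap (pr M y) (pr M (g • y)) ∈ HN H M := by
    intro x
    by_cases hx : g • x = x
    · refine ⟨N1, le_rfl, fun M hM y hy hne => absurd ?_ hne⟩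
      have h1 := level_pr hN1 hy
      rw [hx, ← hy] at h1
      exact path_ext h1 fun i hi => level_tail hN1 y hi
    · have h1 : x ∉ FixS H := fun h => hx (hgf x h)
      have h2 : g • x ∉ FixS H := fun h => hx (smul_left_cancel g (hgf _ h))
      obtain ⟨m, hm⟩ := two_good heven hg h1 h2 (Ne.symm hx)
      refine ⟨max N1 m, le_max_left _ _, fun M hM y hy hne => ?_⟩
      have hMm : m ≤ M := (le_max_right _ _).trans hM
      have hMN : N1 ≤ M := (le_max_left _ _).trans hM
      have hr : rv (pr M y) = rv (pr M (g • y)) := by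
        rw [rv_pr, rv_pr, level_vtx hMN hN1]
      rw [tau_mem_HN hr]
      apply hm M hMm
      · rw [res_pr hMm, pr_mono (le_max_right N1 m) hy]
      · rw [res_pr hMm]
        exact pr_mono (le_max_right N1 m) (level_pr (levelIn_mono (le_max_left N1 m) hN1) hy)
  choose m hm1 hm2 using hloc
  obtain ⟨t, ht⟩ := isCompact_univ.elim_finite_subcover (fun x : B.Path => cyl (m x) {pr (m x) x})
    (fun x => (isClopen_pr _).isOpen) (fun x _ => Set.mem_iUnion.mpr ⟨x, rfl⟩)
  set M := max N1 (t.sup m)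
  obtain ⟨σ, hσ⟩ := exists_rho (levelIn_mono (le_max_left _ _ : N1 ≤ M) hN1)
  have hmem : σ.1 ∈ HN H M := by
    apply perm_mem_of_swaps
    intro c hc
    obtain ⟨y, rfl⟩ := pr_surj M c
    rw [← pr_rho, hσ] at hc ⊢
    obtain ⟨x, hxt, hyx⟩ := Set.mem_iUnion₂.mp (ht (Set.mem_univ y))
    exact hm2 x M ((Finset.le_sup hxt).trans (le_max_right _ _)) y hyx fun h => hc (by rw [h])
  obtain ⟨h1, h2⟩ := mem_HN.mp hmem
  rw [← hσ]
  exact h2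

end BratteliDiagram

namespace BratteliDiagram

variable {B : BratteliDiagram}

theorem measurableSet_cyl {n : ℕ} (T : Set (B.P n)) : MeasurableSet (cyl n T) := measurableSet_pr T

theorem isClopen_cyl {n : ℕ} (T : Set (B.P n)) : IsClopen (cyl n T) := isClopen_pr T

theorem cyl_up {n N : ℕ} (h : n ≤ N) (T : Set (B.P n)) : cyl n T = cyl N {p | res n p ∈ T} := by
  ext x
  show pr n x ∈ T ↔ res n (pr N x) ∈ T
  rw [res_pr h]

theorem cyl_inter {n : ℕ} (T S : Set (B.P n)) : cyl n T ∩ cyl n S = cyl n (T ∩ S) := rfl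

theorem borel_cyl : (instMeasurableSpacePath B) =
    MeasurableSpace.generateFrom {s | ∃ n, ∃ T : Set (B.P n), s = cyl n T} := by
  have hb : TopologicalSpace.IsTopologicalBasis {s : Set B.Path | ∃ n, ∃ T : Set (B.P n), s = cyl n T} := by
    apply TopologicalSpace.isTopologicalBasis_of_isOpen_of_nhds
    · rintro s ⟨n, T, rfl⟩
      exact (isClopen_cyl T).isOpen
    · intro x U hx hU
      obtain ⟨n, hn⟩ := exists_cyl hU hx
      exact ⟨cyl n {pr n x}, ⟨n, _, rfl⟩, rfl, fun y hy => hn y hy⟩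
  exact hb.borel_eq_generateFrom

theorem ext_cyl {ν ν' : Measure B.Path} [IsFiniteMeasure ν]
    (h : ∀ n (T : Set (B.P n)), ν (cyl n T) = ν' (cyl n T)) : ν = ν' := by
  refine ext_of_generate_finite _ borel_cyl ?_ ?_ ?_
  · rintro _ ⟨n, T, rfl⟩ _ ⟨m, S, rfl⟩ -
    refine ⟨max n m, {p | res n p ∈ T} ∩ {p | res m p ∈ S}, ?_⟩
    rw [cyl_up (le_max_left n m), cyl_up (le_max_right n m), cyl_inter]
  · rintro _ ⟨n, T, rfl⟩
    exact h n T
  · have := h 0 Set.univ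
    simpa [cyl] using this

theorem preimage_cyl {n N : ℕ} (h : n ≤ N) (σ : SN B N) (T : Set (B.P n)) :
    (fun x : B.Path => rho B N σ • x) ⁻¹' cyl n T = cyl N {p | res n (σ.1 p) ∈ T} := by
  ext x
  show pr n (rho B N σ • x) ∈ T ↔ res n (σ.1 (pr N x)) ∈ T
  rw [← pr_rho, res_pr h]

theorem measInv_of_cyl {ν : Measure B.Path} [IsFiniteMeasure ν]
    (h : ∀ (g : FG B) n (T : Set (B.P n)), ν ((fun x : B.Path => g • x) ⁻¹' cyl n T) = ν (cyl n T)) :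
    MeasInv (FG B) ν := by
  intro g s hs
  have : Measure.map (fun x : B.Path => g • x) ν = ν := by
    have : IsFiniteMeasure (Measure.map (fun x : B.Path => g • x) ν) := by infer_instance
    apply ext_cyl
    intro n T
    rw [Measure.map_apply (measurable_fg g) (measurableSet_cyl T), h]
  conv_rhs => rw [← this]
  rw [Measure.map_apply (measurable_fg g) hs]

/-- index set of cylinders -/
abbrev CI (B : BratteliDiagram) : Type := Σ n, Set (B.P n)

/-- vector of cylinder values -/
def ev (ν : Measure B.Path) : CI B → ℝ := fun c => ν.real (cyl c.1 c.2)

theorem tendsto_ev {ι : Type*} {L : Filter ι} {ν : ProbabilityMeasure B.Path}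
    {νs : ι → ProbabilityMeasure B.Path} (h : Tendsto νs L (nhds ν)) (n : ℕ) (T : Set (B.P n)) :
    Tendsto (fun i => (νs i : Measure B.Path).real (cyl n T)) L
      (nhds ((ν : Measure B.Path).real (cyl n T))) := by
  have := ProbabilityMeasure.tendsto_measure_of_isClopen_of_tendsto h (isClopen_cyl T)
  exact (NNReal.continuous_coe.tendsto _).comp this

theorem exists_preimage_cyl (g : FG B) (n : ℕ) (T : Set (B.P n)) :
    ∃ N S, (fun x : B.Path => g • x) ⁻¹' cyl n T = cyl N S := by
  obtain ⟨N, hN⟩ := exists_level g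
  obtain ⟨σ, rfl⟩ := exists_rho (levelIn_mono (le_max_left N n) hN)
  exact ⟨_, _, preimage_cyl (le_max_right N n) σ T⟩

theorem limit_inv {ι : Type*} {L : Filter ι} [L.NeBot] {ν : ProbabilityMeasure B.Path}
    {νs : ι → ProbabilityMeasure B.Path} (h : Tendsto νs L (nhds ν))
    (hi : ∀ (g : FG B) n (T : Set (B.P n)), ∀ᶠ i in L, (νs i : Measure B.Path).real
      ((fun x : B.Path => g • x) ⁻¹' cyl n T) = (νs i : Measure B.Path).real (cyl n T)) :
    MeasInv (FG B) (ν : Measure B.Path) := by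
  apply measInv_of_cyl
  intro g n T
  have h1 := tendsto_ev h n T
  have h2 : Tendsto (fun i => (νs i : Measure B.Path).real ((fun x : B.Path => g • x) ⁻¹' cyl n T)) L
      (nhds ((ν : Measure B.Path).real ((fun x : B.Path => g • x) ⁻¹' cyl n T))) := by
    obtain ⟨N, S, hS⟩ := exists_preimage_cyl g n T
    rw [hS]
    exact tendsto_ev h N S
  have h3 := tendsto_nhds_unique (h2.congr' (hi g n T)) h1
  exact (measureReal_eq_measureReal_iff).1 h3

/-- vectors of invariant probability measures -/
def KI (B : BratteliDiagram) : Set (CI B → ℝ) :=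
  {f | ∃ ν : ProbabilityMeasure B.Path, MeasInv (FG B) (ν : Measure B.Path) ∧ ev (ν : Measure B.Path) = f}

theorem continuous_ev : Continuous fun ν : ProbabilityMeasure B.Path => ev (ν : Measure B.Path) := by
  apply continuous_pi
  rintro ⟨n, T⟩
  rw [continuous_iff_continuousAt]
  intro ν
  exact tendsto_ev tendsto_id n T

theorem KI_compact : IsCompact (KI B) := by
  have h1 : IsClosed {ν : ProbabilityMeasure B.Path | MeasInv (FG B) (ν : Measure B.Path)} := by
    rw [isClosed_iff_ultrafilter]
    intro ν u hu hm
    refine limit_inv (L := (u : Filter (ProbabilityMeasure B.Path))) (νs := fun x => x) hu ?_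
    intro g n T
    filter_upwards [hm] with i hi
    exact congrArg ENNReal.toReal (hi g _ (measurableSet_cyl T))
  have h2 := h1.isCompact.image continuous_ev
  exact h2

theorem KI_convex : Convex ℝ (KI B) := by
  rintro _ ⟨ν, hν, rfl⟩ _ ⟨ν', hν', rfl⟩ a b ha hb hab
  have hab' : ENNReal.ofReal a + ENNReal.ofReal b = 1 := by
    rw [← ENNReal.ofReal_add ha hb, hab, ENNReal.ofReal_one]
  refine ⟨⟨ENNReal.ofReal a • (ν : Measure B.Path) + ENNReal.ofReal b • (ν' : Measure B.Path), ⟨?_⟩⟩, ?_, ?_⟩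
  · simp [hab']
  · intro g s hs
    have h1 := hν g s hs
    have h2 := hν' g s hs
    simp [h1, h2]
  · ext ⟨n, T⟩
    simp only [ev, ProbabilityMeasure.coe_mk, Pi.add_apply, Pi.smul_apply, smul_eq_mul]
    rw [measureReal_add_apply (ENNReal.mul_ne_top ENNReal.ofReal_ne_top (measure_ne_top _ _))
      (ENNReal.mul_ne_top ENNReal.ofReal_ne_top (measure_ne_top _ _)), measureReal_ennreal_smul_apply, measureReal_ennreal_smul_apply,
      ENNReal.toReal_ofReal ha, ENNReal.toReal_ofReal hb]

theorem ev_inj {ν ν' : Measure B.Path} [IsFiniteMeasure ν] [IsFiniteMeasure ν'] (h : ev ν = ev ν') : ν = ν' := by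
  apply ext_cyl
  intro n T
  exact (measureReal_eq_measureReal_iff).1 (congrFun h ⟨n, T⟩)

theorem extreme_erg {ν : ProbabilityMeasure B.Path} (hν : MeasInv (FG B) (ν : Measure B.Path))
    (he : ev (ν : Measure B.Path) ∈ (KI B).extremePoints ℝ) : MeasErg (FG B) (ν : Measure B.Path) := by
  intro A hA hAi
  by_contra! hne
  obtain ⟨h0, h1⟩ := hne
  set m : Measure B.Path := (ν : Measure B.Path) with hm
  have hpm : IsProbabilityMeasure m := ν.2
  have hc0 : m Aᶜ ≠ 0 := by
    intro h
    exact h1 ((prob_compl_eq_zero_iff hA).1 h)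
  have key : ∀ A' : Set B.Path, MeasurableSet A' → (∀ g : FG B, (fun y => g • y) ⁻¹' A' = A') →
      m A' ≠ 0 → ∃ ν' : ProbabilityMeasure B.Path, (ν' : Measure B.Path) = ProbabilityTheory.cond m A' ∧
      ev (ν' : Measure B.Path) ∈ KI B := by
    intro A' hA' hi hn
    have := ProbabilityTheory.cond_isProbabilityMeasure hn
    refine ⟨⟨ProbabilityTheory.cond m A', this⟩, rfl, ⟨_, ?_, rfl⟩⟩
    intro g s hs
    simp only [ProbabilityMeasure.coe_mk]
    rw [ProbabilityTheory.cond_apply hA', ProbabilityTheory.cond_apply hA']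
    congr 1
    conv_lhs => rw [← hi g]
    rw [← Set.preimage_inter]
    exact hν g _ (hA'.inter hs)
  obtain ⟨ν1, e1, k1⟩ := key A hA hAi h0
  obtain ⟨ν2, e2, k2⟩ := key Aᶜ hA.compl (fun g => by rw [Set.preimage_compl, hAi g]) hc0
  have ha : 0 < m.real A := ENNReal.toReal_pos h0 (measure_ne_top _ _)
  have hb : 0 < m.real Aᶜ := ENNReal.toReal_pos hc0 (measure_ne_top _ _)
  have hab : m.real A + m.real Aᶜ = 1 := by
    rw [measureReal_add_measureReal_compl hA]; simp
  have hcomb : m.real A • ev (ν1 : Measure B.Path) + m.real Aᶜ • ev (ν2 : Measure B.Path) = ev m := by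
    ext ⟨n, T⟩
    simp only [ev, Pi.add_apply, Pi.smul_apply, smul_eq_mul]
    have hcr : ∀ A' : Set B.Path, MeasurableSet A' → ∀ t, (ProbabilityTheory.cond m A').real t =
        (m.real A')⁻¹ * m.real (A' ∩ t) := by
      intro A' hA' t
      simp [Measure.real, ProbabilityTheory.cond_apply hA']
    rw [e1, e2, hcr A hA, hcr Aᶜ hA.compl,
      mul_inv_cancel_left₀ ha.ne', mul_inv_cancel_left₀ hb.ne']
    rw [Set.inter_comm, Set.inter_comm Aᶜ, ← Set.sdiff_eq]
    exact measureReal_inter_add_sdiff hA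
  have heq : ev (ν1 : Measure B.Path) = ev m :=
    (mem_extremePoints.1 he).2 _ k1 _ k2 ⟨_, _, ha, hb, hab, hcomb⟩ |>.1
  have h3 : (ν1 : Measure B.Path) = m := ev_inj heq
  rw [e1] at h3
  have : ProbabilityTheory.cond m A Aᶜ = 0 := by
    rw [ProbabilityTheory.cond_apply hA]; simp
  rw [h3] at this
  exact hc0 this

/-- Claim B -/
theorem inv_decomp {k : ℕ} {μ : Fin k → Measure B.Path}
    (hcomplete : ∀ ν : Measure B.Path, IsProbabilityMeasure ν →
      MeasInv (FG B) ν → MeasErg (FG B) ν → ∃ i, ν = μ i)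
    (ν : ProbabilityMeasure B.Path) (hν : MeasInv (FG B) (ν : Measure B.Path)) :
    ∃ t ∈ stdSimplex ℝ (Fin k), ∀ n (T : Set (B.P n)),
      (ν : Measure B.Path).real (cyl n T) = ∑ i, t i * (μ i).real (cyl n T) := by
  let L : (Fin k → ℝ) →ₗ[ℝ] (CI B → ℝ) := ∑ i, (LinearMap.proj i).smulRight (ev (μ i))
  have hL : ∀ t, L t = ∑ i, t i • ev (μ i) := by intro t; simp [L]
  have hLc : Continuous L := by
    have : (L : (Fin k → ℝ) → (CI B → ℝ)) = fun t => ∑ i, t i • ev (μ i) := funext hL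
    rw [this]
    fun_prop
  have hD1 : IsCompact (L '' stdSimplex ℝ (Fin k)) := (isCompact_stdSimplex ℝ (Fin k)).image hLc
  have hD2 : Convex ℝ (L '' stdSimplex ℝ (Fin k)) := (convex_stdSimplex ℝ (Fin k)).linear_image L
  have hsub : (KI B).extremePoints ℝ ⊆ L '' stdSimplex ℝ (Fin k) := by
    intro f hf
    obtain ⟨ν', hν', rfl⟩ := hf.1
    obtain ⟨i, hi⟩ := hcomplete ν' ν'.2 hν' (extreme_erg hν' hf)
    refine ⟨Pi.single i 1, single_mem_stdSimplex ℝ i, ?_⟩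
    rw [hL, hi]
    rw [Finset.sum_eq_single i]
    · simp
    · intro j _ hj; simp [hj]
    · simp
  have hK : KI B ⊆ L '' stdSimplex ℝ (Fin k) := by
    rw [← closure_convexHull_extremePoints (KI_compact (B := B)) KI_convex]
    exact closure_minimal (convexHull_min hsub hD2) hD1.isClosed
  obtain ⟨t, ht, hte⟩ := hK ⟨ν, hν, rfl⟩
  refine ⟨t, ht, fun n T => ?_⟩
  have := congrFun hte ⟨n, T⟩
  rw [hL] at this
  simp only [Finset.sum_apply, Pi.smul_apply, smul_eq_mul] at this
  exact this.symm

end BratteliDiagram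

namespace BratteliDiagram

variable {B : BratteliDiagram}

/-- paths of level `N` ending at `v` -/
def fib (N : ℕ) (v : B.V N) : Finset (B.P N) := Finset.univ.filter fun c => rv c = v

theorem mem_fib {N : ℕ} {v : B.V N} {c : B.P N} : c ∈ fib N v ↔ rv c = v := by simp [fib]

open Classical in
/-- fraction of the fibre in `C` -/
def frac (N : ℕ) (C : Set (B.P N)) (v : B.V N) : ℝ :=
  (((fib N v).filter fun c => c ∈ C).card : ℝ) / (fib N v).card

theorem fib_pos {N : ℕ} (c : B.P N) : 0 < (fib N (rv c)).card :=
  Finset.card_pos.2 ⟨c, mem_fib.2 rfl⟩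

theorem frac_nonneg {N : ℕ} (C : Set (B.P N)) (v : B.V N) : 0 ≤ frac N C v := by
  unfold frac; positivity

theorem frac_le_one {N : ℕ} (C : Set (B.P N)) (v : B.V N) : frac N C v ≤ 1 := by
  classical
  unfold frac
  apply div_le_one_of_le₀ _ (by positivity)
  exact_mod_cast Finset.card_le_card (Finset.filter_subset _ _)

/-- uniform measure on a fibre -/
def um {N : ℕ} (c0 : B.P N) : Measure B.Path :=
  ((fib N (rv c0)).card : ℝ≥0∞)⁻¹ • ∑ c ∈ fib N (rv c0), Measure.dirac (rep c)

theorem um_real {N : ℕ} (c0 : B.P N) (n : ℕ) (T : Set (B.P n)) :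
    (um c0).real (cyl n T) = frac N {c | res n c ∈ T} (rv c0) := by
  classical
  unfold um frac
  rw [measureReal_ennreal_smul_apply, Measure.real, Measure.finsetSum_apply]
  simp only [Measure.dirac_apply' _ (measurableSet_cyl T)]
  have : ∀ c : B.P N, (cyl n T).indicator (1 : B.Path → ℝ≥0∞) (rep c) = if res n c ∈ T then 1 else 0 := by
    intro c
    simp only [Set.indicator_apply]
    rfl
  simp only [this]
  rw [Finset.sum_boole]
  simp only [ENNReal.toReal_inv, ENNReal.toReal_natCast]
  rw [div_eq_inv_mul]
  rfl

instance {N : ℕ} (c0 : B.P N) : IsProbabilityMeasure (um c0) := by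
  constructor
  unfold um
  rw [Measure.smul_apply, Measure.finsetSum_apply]
  simp only [measure_univ, Finset.sum_const, nsmul_eq_mul, mul_one, smul_eq_mul]
  apply ENNReal.inv_mul_cancel
  · simpa using (fib_pos c0).ne'
  · simp

theorem um_inv {n N : ℕ} (h : n ≤ N) (c0 : B.P N) {g : FG B} (hg : g ∈ B.levelIn N) (T : Set (B.P n)) :
    (um c0).real ((fun x : B.Path => g • x) ⁻¹' cyl n T) = (um c0).real (cyl n T) := by
  classical
  obtain ⟨σ, rfl⟩ := exists_rho hg
  rw [preimage_cyl h, um_real, um_real]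
  unfold frac
  congr 2
  apply Finset.card_bij (fun c _ => σ.1 c)
  · intro c hc
    simp only [Finset.mem_filter, mem_fib, Set.mem_ofPred_eq, res_self] at hc ⊢
    exact ⟨(mem_SN.1 σ.2 c).trans hc.1, hc.2⟩
  · intro a _ b _ hab
    exact σ.1.injective hab
  · intro b hb
    refine ⟨σ.1.symm b, ?_, by simp⟩
    simp only [Finset.mem_filter, mem_fib, Set.mem_ofPred_eq, res_self] at hb ⊢
    refine ⟨?_, by simpa using hb.2⟩
    rw [← hb.1, ← mem_SN.1 σ.2, Equiv.apply_symm_apply]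

/-- Claim A -/
theorem frac_approx {k : ℕ} {μ : Fin k → Measure B.Path}
    (hcomplete : ∀ ν : Measure B.Path, IsProbabilityMeasure ν →
      MeasInv (FG B) ν → MeasErg (FG B) ν → ∃ i, ν = μ i) (n : ℕ) {ε : ℝ} (hε : 0 < ε) :
    ∃ N0, ∀ N, N0 ≤ N → ∀ c0 : B.P N, ∃ t ∈ stdSimplex ℝ (Fin k), ∀ T : Set (B.P n),
      |frac N {c | res n c ∈ T} (rv c0) - ∑ i, t i * (μ i).real (cyl n T)| ≤ ε := by
  by_contra! hcon
  choose N hN c hc using hcon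
  let νs : ℕ → ProbabilityMeasure B.Path := fun j => ⟨um (c j), inferInstance⟩
  obtain ⟨ν, -, hν⟩ := (isCompact_univ (X := ProbabilityMeasure B.Path)).ultrafilter_le_nhds
    ((hyperfilter ℕ).map νs) (by simp)
  have hlim : Tendsto νs (hyperfilter ℕ : Filter ℕ) (nhds ν) := hν
  have hle : (hyperfilter ℕ : Filter ℕ) ≤ atTop := by
    rw [← Nat.cofinite_eq_atTop]; exact hyperfilter_le_cofinite
  have hinv : MeasInv (FG B) (ν : Measure B.Path) := by
    apply limit_inv hlim
    intro g m T
    obtain ⟨M, hM⟩ := exists_level g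
    filter_upwards [hle (eventually_ge_atTop (max m M))] with j hj
    exact um_inv ((le_max_left m M).trans (hj.trans (hN j))) (c j)
      (levelIn_mono ((le_max_right m M).trans (hj.trans (hN j))) hM) T
  obtain ⟨t, ht, hte⟩ := inv_decomp hcomplete ν hinv
  have hev : ∀ᶠ j in (hyperfilter ℕ : Filter ℕ), ∀ T : Set (B.P n),
      |(um (c j)).real (cyl n T) - (ν : Measure B.Path).real (cyl n T)| < ε := by
    rw [eventually_all]
    intro T
    have := tendsto_ev hlim n T
    have := (Metric.tendsto_nhds.1 this) ε hε
    simp only [Real.dist_eq] at this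
    exact this
  obtain ⟨j, hj⟩ := hev.exists
  obtain ⟨T, hT⟩ := hc j t ht
  have := hj T
  rw [um_real, hte] at this
  linarith

theorem frac_pos (heven : B.IsEven) {n : ℕ} (p : B.P n) : ∃ L, ∃ δ : ℝ, 0 < δ ∧ δ ≤ 1 ∧ ∀ N, L ≤ N → ∀ c0 : B.P N,
    δ ≤ frac N {c | res n c = p} (rv c0) := by
  classical
  obtain ⟨L, hnL, hL⟩ := extF_grow heven n 1
  have hPL : 0 < Fintype.card (B.P L) := Fintype.card_pos
  refine ⟨L, 1 / Fintype.card (B.P L), by positivity, ?_, ?_⟩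
  · rw [div_le_one (by positivity)]
    exact_mod_cast hPL
  intro N hN c0
  unfold frac
  have hf := fib_pos c0
  rw [div_le_div_iff₀ (by positivity) (by positivity), one_mul]
  have h1 : (fib N (rv c0)).card = ∑ b : B.P L, (extF N b (rv c0)).card := by
    rw [Finset.card_eq_sum_card_fiberwise (f := fun c => res L c) (t := Finset.univ) (by simp)]
    apply Finset.sum_congr rfl
    intro b _
    congr 1
    ext c
    simp only [Finset.mem_filter, mem_fib, mem_extF]
    tauto
  have h2 : ∀ b : B.P L, (extF N b (rv c0)).card ≤
      ((fib N (rv c0)).filter fun c => c ∈ {c | res n c = p}).card := by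
    intro b
    obtain ⟨b', hb'⟩ := Finset.card_pos.1 (hL L le_rfl p b)
    rw [mem_extF] at hb'
    rw [card_extF_congr hN hb'.2.symm]
    apply Finset.card_le_card
    intro c hc
    rw [mem_extF] at hc
    simp only [Finset.mem_filter, mem_fib, Set.mem_ofPred_eq]
    refine ⟨hc.2, ?_⟩
    rw [← res_res hnL, hc.1, hb'.1]
  have h3 : (fib N (rv c0)).card ≤ Fintype.card (B.P L) *
      ((fib N (rv c0)).filter fun c => c ∈ {c | res n c = p}).card := by
    rw [h1]
    refine (Finset.sum_le_sum fun b _ => h2 b).trans ?_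
    simp
  rw [mul_comm]
  exact_mod_cast h3

theorem fib_grow (heven : B.IsEven) (M : ℕ) : ∃ N0, ∀ N, N0 ≤ N → ∀ c0 : B.P N, M ≤ (fib N (rv c0)).card := by
  obtain ⟨N0, -, h⟩ := extF_grow heven 0 M
  refine ⟨N0, fun N hN c0 => (h N hN (Classical.arbitrary _) c0).trans ?_⟩
  apply Finset.card_le_card
  intro c hc
  exact mem_fib.2 (mem_extF.1 hc).2

end BratteliDiagram

namespace BratteliDiagram

variable {B : BratteliDiagram}

instance (N : ℕ) : Fintype (SN B N) := Fintype.ofFinite _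

open Classical in
/-- number of level permutations mapping `S` into `C` -/
def hitC {N : ℕ} (C : Set (B.P N)) (S : Finset (B.P N)) : ℕ :=
  (Finset.univ.filter fun σ : SN B N => ∀ p ∈ S, σ.1 p ∈ C).card

/-- probability that a random level permutation maps `S` into `C` -/
def hit {N : ℕ} (C : Set (B.P N)) (S : Finset (B.P N)) : ℝ := (hitC C S : ℝ) / Fintype.card (SN B N)

theorem card_SN_pos (N : ℕ) : (0 : ℝ) < Fintype.card (SN B N) := by
  exact_mod_cast Fintype.card_pos

theorem hitC_le {N : ℕ} (C : Set (B.P N)) (S : Finset (B.P N)) : hitC C S ≤ Fintype.card (SN B N) := by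
  classical
  unfold hitC
  exact Finset.card_le_univ _

theorem hit_le_one {N : ℕ} (C : Set (B.P N)) (S : Finset (B.P N)) : hit C S ≤ 1 :=
  (div_le_one (card_SN_pos N)).2 (by exact_mod_cast hitC_le C S)

theorem hit_nonneg {N : ℕ} (C : Set (B.P N)) (S : Finset (B.P N)) : 0 ≤ hit C S := by
  unfold hit; positivity

theorem hit_anti {N : ℕ} (C : Set (B.P N)) {S S' : Finset (B.P N)} (h : S' ⊆ S) : hit C S ≤ hit C S' := by
  classical
  unfold hit
  apply div_le_div_of_nonneg_right _ (card_SN_pos N).le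
  norm_cast
  unfold hitC
  apply Finset.card_le_card
  intro σ
  simp only [Finset.mem_filter, Finset.mem_univ, true_and]
  intro hs p hp
  exact hs p (h hp)

theorem hitC_swap {N : ℕ} (C : Set (B.P N)) (S : Finset (B.P N)) {p q : B.P N} (hp : p ∉ S) (hq : q ∉ S)
    (hpq : rv p = rv q) : hitC C (insert p S) = hitC C (insert q S) := by
  classical
  unfold hitC
  apply Finset.card_bij (fun σ _ => σ * ⟨Equiv.swap p q, swap_mem_SN hpq⟩)
  · intro σ
    simp only [Finset.mem_filter, Finset.mem_univ, true_and, Finset.mem_insert, forall_eq_or_imp]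
    rintro ⟨h1, h2⟩
    refine ⟨by simpa using h1, fun r hr => ?_⟩
    have : Equiv.swap p q r = r := Equiv.swap_apply_of_ne_of_ne (fun h => hp (h ▸ hr)) (fun h => hq (h ▸ hr))
    simpa [this] using h2 r hr
  · intro a _ b _ hab
    exact mul_right_cancel hab
  · intro σ
    simp only [Finset.mem_filter, Finset.mem_univ, true_and, Finset.mem_insert, forall_eq_or_imp]
    rintro ⟨h1, h2⟩
    refine ⟨σ * ⟨Equiv.swap p q, swap_mem_SN hpq⟩, ⟨by simpa using h1, fun r hr => ?_⟩, ?_⟩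
    · have : Equiv.swap p q r = r := Equiv.swap_apply_of_ne_of_ne (fun h => hp (h ▸ hr)) (fun h => hq (h ▸ hr))
      simpa [this] using h2 r hr
    · rw [mul_assoc]
      have : (⟨Equiv.swap p q, swap_mem_SN hpq⟩ : SN B N) * ⟨Equiv.swap p q, swap_mem_SN hpq⟩ = 1 := by
        ext; simp
      rw [this, mul_one]

theorem sum_hitC {N : ℕ} (C : Set (B.P N)) (S : Finset (B.P N)) (v : B.V N) [DecidablePred fun c => c ∈ C] :
    ∑ q ∈ fib N v, hitC C (insert q S) = ((fib N v).filter fun c => c ∈ C).card * hitC C S := by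
  classical
  have h1 : ∀ q, hitC C (insert q S) = ∑ σ ∈ Finset.univ.filter (fun σ : SN B N => ∀ p ∈ S, σ.1 p ∈ C),
      if σ.1 q ∈ C then 1 else 0 := by
    intro q
    rw [Finset.sum_boole, Finset.filter_filter]
    unfold hitC
    simp only [Nat.cast_id]
    congr 1
    ext σ
    simp [and_comm]
  simp only [h1]
  rw [Finset.sum_comm]
  have h2 : ∀ σ : SN B N, (∑ q ∈ fib N v, if σ.1 q ∈ C then 1 else 0) =
      ((fib N v).filter fun c => c ∈ C).card := by
    intro σ
    rw [Finset.sum_boole, Nat.cast_id]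
    apply Finset.card_bij (fun c _ => σ.1 c)
    · intro c hc
      simp only [Finset.mem_filter, mem_fib] at hc ⊢
      exact ⟨(mem_SN.1 σ.2 c).trans hc.1, hc.2⟩
    · intro a _ b _ hab
      exact σ.1.injective hab
    · intro b hb
      refine ⟨σ.1.symm b, ?_, by simp⟩
      simp only [Finset.mem_filter, mem_fib] at hb ⊢
      refine ⟨?_, by simpa using hb.2⟩
      rw [← hb.1, ← mem_SN.1 σ.2, Equiv.apply_symm_apply]
  simp only [h2, Finset.sum_const, smul_eq_mul]
  rw [mul_comm]
  unfold hitC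
  congr

theorem hit_step {N : ℕ} (C : Set (B.P N)) (S : Finset (B.P N)) {p : B.P N} (hp : p ∉ S) :
    |hit C (insert p S) - frac N C (rv p) * hit C S| ≤ (S.card : ℝ) / (fib N (rv p)).card := by
  classical
  have hs := sum_hitC C S (rv p)
  have hF : (0 : ℝ) < (fib N (rv p)).card := by exact_mod_cast fib_pos p
  have hK := card_SN_pos (B := B) N
  have h1 : ∑ q ∈ fib N (rv p), hit C (insert q S) = (fib N (rv p)).card * (frac N C (rv p) * hit C S) := by
    unfold hit frac
    rw [← Finset.sum_div, ← Nat.cast_sum, hs]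
    push_cast
    field_simp
  have h2 : |∑ q ∈ fib N (rv p), (hit C (insert p S) - hit C (insert q S))| ≤ S.card := by
    have h3 : ∑ q ∈ fib N (rv p), (hit C (insert p S) - hit C (insert q S)) =
        ∑ q ∈ (fib N (rv p)).filter (fun q => q ∈ S), (hit C (insert p S) - hit C (insert q S)) := by
      rw [Finset.sum_filter]
      apply Finset.sum_congr rfl
      intro q hq
      split_ifs with h
      · rfl
      · unfold hit
        rw [hitC_swap C S hp h (mem_fib.1 hq).symm, sub_self]
    rw [h3]
    refine (Finset.abs_sum_le_sum_abs _ _).trans ?_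
    have h4 : ∀ q ∈ (fib N (rv p)).filter (fun q => q ∈ S), |hit C (insert p S) - hit C (insert q S)| ≤ 1 := by
      intro q _
      rw [abs_le]
      have a1 := hit_nonneg C (insert p S)
      have a2 := hit_nonneg C (insert q S)
      have a3 := hit_le_one C (insert p S)
      have a4 := hit_le_one C (insert q S)
      constructor <;> linarith
    refine (Finset.sum_le_sum h4).trans ?_
    simp only [Finset.sum_const, nsmul_eq_mul, mul_one, Nat.cast_le]
    apply Finset.card_le_card
    intro q hq
    exact (Finset.mem_filter.1 hq).2
  rw [Finset.sum_sub_distrib, h1, Finset.sum_const, nsmul_eq_mul, ← mul_sub, abs_mul, abs_of_pos hF] at h2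
  rw [le_div_iff₀ hF]
  linarith

theorem hit_est {N : ℕ} (C : Set (B.P N)) {h : ℝ} (hh : 0 < h) (hfib : ∀ c : B.P N, h ≤ (fib N (rv c)).card)
    (S : Finset (B.P N)) :
    |hit C S - ∏ p ∈ S, frac N C (rv p)| ≤ (S.card : ℝ) ^ 2 / h := by
  classical
  induction S using Finset.induction_on with
  | empty =>
    have : hit C ∅ = 1 := by
      unfold hit hitC
      simp
    simp [this]
  | insert p S hp ih =>
    rw [Finset.prod_insert hp, Finset.card_insert_of_notMem hp]
    have h1 := hit_step C S hp
    have h2 : (S.card : ℝ) / (fib N (rv p)).card ≤ S.card / h :=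
      div_le_div_of_nonneg_left (by positivity) hh (hfib p)
    have h3 : |frac N C (rv p) * hit C S - frac N C (rv p) * ∏ p ∈ S, frac N C (rv p)| ≤ (S.card : ℝ) ^ 2 / h := by
      rw [← mul_sub, abs_mul, abs_of_nonneg (frac_nonneg _ _)]
      calc _ ≤ 1 * |hit C S - ∏ p ∈ S, frac N C (rv p)| :=
            mul_le_mul_of_nonneg_right (frac_le_one _ _) (abs_nonneg _)
        _ ≤ _ := by rw [one_mul]; exact ih
    have h4 := abs_sub_le (hit C (insert p S)) (frac N C (rv p) * hit C S)
      (frac N C (rv p) * ∏ p ∈ S, frac N C (rv p))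
    have h5 : (S.card : ℝ) / h + (S.card : ℝ) ^ 2 / h ≤ ((S.card + 1 : ℕ) : ℝ) ^ 2 / h := by
      rw [← add_div]
      apply div_le_div_of_nonneg_right _ hh.le
      push_cast
      nlinarith [(Nat.cast_nonneg S.card : (0:ℝ) ≤ S.card)]
    linarith

/-- averaging over level permutations -/
theorem avg_hit {N : ℕ} (m : Finset (B.P N) → ℝ) (hm : ∀ (σ : SN B N) S, m (S.image σ.1) = m S)
    (C : Set (B.P N)) (Q : Finset (B.P N) → Prop) [DecidablePred Q] [DecidablePred fun S : Finset (B.P N) => ∀ p ∈ S, p ∈ C]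
    (hQ : ∀ (σ : SN B N) S, Q (S.image σ.1) ↔ Q S) :
    ∑ S ∈ Finset.univ.filter Q, m S * (if ∀ p ∈ S, p ∈ C then 1 else 0) =
      ∑ S ∈ Finset.univ.filter Q, m S * hit C S := by
  classical
  have h1 : ∀ σ : SN B N, ∑ S ∈ Finset.univ.filter Q, m S * (if ∀ p ∈ S, p ∈ C then 1 else 0) =
      ∑ S ∈ Finset.univ.filter Q, m S * (if ∀ p ∈ S, σ.1 p ∈ C then 1 else 0) := by
    intro σ
    symm
    apply Finset.sum_bij (fun S _ => S.image σ.1)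
    · intro S hS
      simpa [hQ] using hS
    · intro a _ b _ hab
      exact Finset.image_injective σ.1.injective hab
    · intro S hS
      refine ⟨S.image σ.1.symm, ?_, ?_⟩
      · have := hQ σ (S.image σ.1.symm)
        simp only [Finset.mem_filter, Finset.mem_univ, true_and] at hS ⊢
        rw [← this, Finset.image_image]
        simpa using hS
      · rw [Finset.image_image]; simp
    · intro S _
      rw [hm]
      simp
  have hK := card_SN_pos (B := B) N
  have h2 : (Fintype.card (SN B N) : ℝ) * ∑ S ∈ Finset.univ.filter Q, m S * (if ∀ p ∈ S, p ∈ C then 1 else 0) =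
      Fintype.card (SN B N) * ∑ S ∈ Finset.univ.filter Q, m S * hit C S := by
    calc _ = ∑ σ : SN B N, ∑ S ∈ Finset.univ.filter Q, m S * (if ∀ p ∈ S, σ.1 p ∈ C then 1 else 0) := by
          rw [← Finset.sum_congr rfl (fun σ _ => h1 σ)]
          simp
      _ = ∑ S ∈ Finset.univ.filter Q, m S * hitC C S := by
          rw [Finset.sum_comm]
          apply Finset.sum_congr rfl
          intro S _
          rw [← Finset.mul_sum, Finset.sum_boole]
          unfold hitC
          congr!
      _ = _ := by
          rw [Finset.mul_sum]
          apply Finset.sum_congr rfl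
          intro S _
          unfold hit
          field_simp
  exact mul_left_cancel₀ hK.ne' h2

end BratteliDiagram

namespace BratteliDiagram

variable {B : BratteliDiagram}

theorem isClosed_fix (g : FG B) : IsClosed {x : B.Path | g • x = x} :=
  isClosed_eq (continuous_fg g) continuous_id

theorem fixS_inter_empty {H : Subgroup (FG B)} {K : Set B.Path} (hK : IsCompact K) :
    (∀ x ∈ K, x ∉ FixS H) ↔ ∃ S : Finset (FG B), (∀ x ∈ K, ∃ s ∈ S, s • x ≠ x) ∧ ∀ s ∈ S, s ∈ H := by
  classical
  constructor
  · intro h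
    have h1 : K ∩ ⋂ g : H, {x : B.Path | g.1 • x = x} = ∅ := by
      ext x
      simp only [Set.mem_inter_iff, Set.mem_iInter, Set.mem_empty_iff_false, iff_false, not_and]
      intro hx hx'
      exact h x hx fun g hg => hx' ⟨g, hg⟩
    obtain ⟨u, hu⟩ := hK.elim_finite_subfamily_closed _ (fun g : H => isClosed_fix g.1) h1
    refine ⟨u.image (fun g => g.1), ?_, ?_⟩
    · intro x hx
      by_contra! hcon
      have : x ∈ K ∩ ⋂ g ∈ u, {x : B.Path | g.1 • x = x} := by
        refine ⟨hx, ?_⟩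
        simp only [Set.mem_iInter]
        intro g hg
        exact hcon g.1 (Finset.mem_image_of_mem _ hg)
      rw [hu] at this
      exact this
    · intro s hs
      obtain ⟨g, -, rfl⟩ := Finset.mem_image.1 hs
      exact g.2
  · rintro ⟨S, h1, h2⟩ x hx hF
    obtain ⟨s, hs, hne⟩ := h1 x hx
    exact hne (hF s (h2 s hs))

theorem measurableSet_fixS_empty {K : Set B.Path} (hK : IsCompact K) :
    MeasurableSet {H : Subgroup (FG B) | ∀ x ∈ K, x ∉ FixS H} := by
  have : {H : Subgroup (FG B) | ∀ x ∈ K, x ∉ FixS H} =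
      ⋃ S : {S : Finset (FG B) // ∀ x ∈ K, ∃ s ∈ S, s • x ≠ x}, ⋂ s ∈ S.1, {H : Subgroup (FG B) | s ∈ H} := by
    ext H
    simp only [Set.mem_iUnion, Set.mem_iInter, Set.mem_ofPred_eq]
    rw [fixS_inter_empty hK]
    constructor
    · rintro ⟨S, h1, h2⟩
      exact ⟨⟨S, h1⟩, h2⟩
    · rintro ⟨⟨S, h1⟩, h2⟩
      exact ⟨S, h1, h2⟩
  rw [this]
  apply MeasurableSet.iUnion
  intro S
  exact Finset.measurableSet_biInter _ fun s _ => measurableSet_memSub s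

open Classical in
/-- trace of the fixed set at level `N` -/
def FN (N : ℕ) (H : Subgroup (FG B)) : Finset (B.P N) :=
  Finset.univ.filter fun p => ∃ x ∈ FixS H, pr N x = p

theorem mem_FN {N : ℕ} {H : Subgroup (FG B)} {p : B.P N} : p ∈ FN N H ↔ ∃ x ∈ FixS H, pr N x = p := by
  simp [FN]

theorem measurableSet_mem_FN {N : ℕ} (p : B.P N) : MeasurableSet {H : Subgroup (FG B) | p ∈ FN N H} := by
  have h := (measurableSet_fixS_empty (B := B) (isClopen_cyl (B := B) {p}).isClosed.isCompact).compl
  convert h using 1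
  ext H
  simp only [Set.mem_ofPred_eq, Set.mem_compl_iff, mem_FN, mem_cyl, Set.mem_singleton_iff]
  push Not
  constructor
  · rintro ⟨x, h1, h2⟩; exact ⟨x, h2, h1⟩
  · rintro ⟨x, h1, h2⟩; exact ⟨x, h2, h1⟩

theorem measurableSet_FN {N : ℕ} (Q : Finset (B.P N) → Prop) : MeasurableSet {H : Subgroup (FG B) | Q (FN N H)} := by
  have h0 : ∀ S : Finset (B.P N), MeasurableSet {H : Subgroup (FG B) | FN N H = S} := by
    intro S
    have : {H : Subgroup (FG B) | FN N H = S} = ⋂ p : B.P N, {H | p ∈ FN N H ↔ p ∈ S} := by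
      ext H
      simp [Finset.ext_iff]
    rw [this]
    apply MeasurableSet.iInter
    intro p
    exact (measurableSet_mem_FN p).iff (MeasurableSet.const _)
  have : {H : Subgroup (FG B) | Q (FN N H)} = ⋃ S : {S : Finset (B.P N) // Q S}, {H | FN N H = S.1} := by
    ext H
    simp
  rw [this]
  exact MeasurableSet.iUnion fun S => h0 S.1

theorem mem_fixS_conj {g : FG B} {H : Subgroup (FG B)} {x : B.Path} :
    x ∈ FixS (conjSub g H) ↔ g⁻¹ • x ∈ FixS H := by
  constructor
  · intro h s hs
    have := h (g * s * g⁻¹) (mem_conjSub.2 (by simpa [mul_assoc] using hs))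
    rw [← smul_smul, ← smul_smul] at this
    exact (smul_eq_iff_eq_inv_smul _).1 this
  · intro h s hs
    have := h _ (mem_conjSub.1 hs)
    rw [← smul_smul, ← smul_smul, smul_inv_smul] at this
    exact smul_left_cancel _ this

theorem FN_conj {N : ℕ} (σ : SN B N) (H : Subgroup (FG B)) :
    FN N (conjSub (rho B N σ) H) = (FN N H).image σ.1 := by
  ext p
  simp only [Finset.mem_image, mem_FN, mem_fixS_conj]
  constructor
  · rintro ⟨x, hx, rfl⟩
    refine ⟨_, ⟨_, hx, rfl⟩, ?_⟩
    rw [← pr_rho, smul_inv_smul]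
  · rintro ⟨_, ⟨x, hx, rfl⟩, rfl⟩
    exact ⟨rho B N σ • x, by simpa using hx, pr_rho σ x⟩

theorem FN_res {n N : ℕ} (h : n ≤ N) (H : Subgroup (FG B)) : FN n H = (FN N H).image (res n) := by
  ext p
  simp only [Finset.mem_image, mem_FN]
  constructor
  · rintro ⟨x, hx, rfl⟩
    exact ⟨_, ⟨x, hx, rfl⟩, res_pr h x⟩
  · rintro ⟨_, ⟨x, hx, rfl⟩, rfl⟩
    exact ⟨x, hx, (res_pr h x).symm⟩

theorem card_FN_mono {n N : ℕ} (h : n ≤ N) (H : Subgroup (FG B)) : (FN n H).card ≤ (FN N H).card := by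
  rw [FN_res h]; exact Finset.card_image_le

theorem card_FN_conj {g : FG B} {N : ℕ} (hg : g ∈ B.levelIn N) (H : Subgroup (FG B)) :
    (FN N (conjSub g H)).card = (FN N H).card := by
  obtain ⟨σ, rfl⟩ := exists_rho hg
  rw [FN_conj, Finset.card_image_of_injective _ σ.1.injective]

/-- distribution of `FN` -/
def mF (φ : Measure (Subgroup (FG B))) (N : ℕ) (S : Finset (B.P N)) : ℝ := φ.real {H | FN N H = S}

theorem mF_nonneg (φ : Measure (Subgroup (FG B))) (N : ℕ) (S : Finset (B.P N)) : 0 ≤ mF φ N S :=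
  measureReal_nonneg

theorem mF_conj {φ : Measure (Subgroup (FG B))} (hφ : IsIRS (FG B) φ) {N : ℕ} (σ : SN B N) (S : Finset (B.P N)) :
    mF φ N (S.image σ.1) = mF φ N S := by
  unfold mF Measure.real
  rw [← hφ.2 (rho B N σ) _ (measurableSet_FN fun S' => S' = S.image σ.1)]
  congr 2
  ext H
  simp only [Set.mem_preimage, Set.mem_ofPred_eq, FN_conj]
  exact (Finset.image_injective σ.1.injective).eq_iff

open Classical in
theorem sum_mF {φ : Measure (Subgroup (FG B))} [IsProbabilityMeasure φ] {N : ℕ} (Q : Finset (B.P N) → Prop) :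
    φ.real {H | Q (FN N H)} = ∑ S ∈ Finset.univ.filter Q, mF φ N S := by
  unfold mF
  rw [← measureReal_biUnion_finset]
  · congr 1
    ext H
    simp
  · intro S _ S' _ hne
    rw [Function.onFun, Set.disjoint_left]
    intro H h1 h2
    exact hne (h1.symm.trans h2)
  · intro S _
    exact measurableSet_FN fun S' => S' = S

open Classical in
theorem real_hit {φ : Measure (Subgroup (FG B))} (hφ : IsIRS (FG B) φ) {N : ℕ} (C : Set (B.P N))
    (Q : Finset (B.P N) → Prop) (hQ : ∀ (σ : SN B N) S, Q (S.image σ.1) ↔ Q S) :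
    φ.real {H | Q (FN N H) ∧ ∀ p ∈ FN N H, p ∈ C} = ∑ S ∈ Finset.univ.filter Q, mF φ N S * hit C S := by
  have := hφ.1
  rw [sum_mF (fun S : Finset (B.P N) => Q S ∧ ∀ p ∈ S, p ∈ C),
    ← avg_hit (mF φ N) (fun σ S => mF_conj hφ σ S) C Q hQ]
  rw [Finset.sum_filter, Finset.sum_filter]
  apply Finset.sum_congr rfl
  intro S _
  by_cases h1 : Q S <;> by_cases h2 : ∀ p ∈ S, p ∈ C <;> simp [h1, h2]

/-- at least `s` fixed points -/
def Aev (B : BratteliDiagram) (s : ℕ) : Set (Subgroup (FG B)) := {H | ∃ N, s ≤ (FN N H).card}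

theorem measurableSet_Aev (s : ℕ) : MeasurableSet (Aev B s) := by
  have : Aev B s = ⋃ N, {H | s ≤ (FN N H).card} := by ext H; simp [Aev]
  rw [this]
  exact MeasurableSet.iUnion fun N => measurableSet_FN (N := N) fun S => s ≤ S.card

theorem Aev_inv (s : ℕ) (g : FG B) : conjSub g ⁻¹' Aev B s = Aev B s := by
  obtain ⟨M, hM⟩ := exists_level g
  ext H
  constructor
  · rintro ⟨N, hN⟩
    refine ⟨max N M, ?_⟩
    rw [← card_FN_conj (levelIn_mono (le_max_right N M) hM)]
    exact hN.trans (card_FN_mono (le_max_left N M) _)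
  · rintro ⟨N, hN⟩
    refine ⟨max N M, ?_⟩
    rw [card_FN_conj (levelIn_mono (le_max_right N M) hM)]
    exact hN.trans (card_FN_mono (le_max_left N M) _)

end BratteliDiagram

namespace BratteliDiagram

variable {B : BratteliDiagram}

open Classical in
theorem frac_compl {N : ℕ} (C : Set (B.P N)) (c0 : B.P N) : frac N Cᶜ (rv c0) = 1 - frac N C (rv c0) := by
  have hF : (0 : ℝ) < (fib N (rv c0)).card := by exact_mod_cast fib_pos c0
  unfold frac
  rw [eq_sub_iff_add_eq, ← add_div, div_eq_one_iff_eq hF.ne']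
  have := Finset.card_filter_add_card_filter_not (s := fib N (rv c0)) (fun c => c ∈ C)
  rw [← this]
  push_cast
  rw [add_comm]
  congr!

open Classical in
theorem real_hit_le {φ : Measure (Subgroup (FG B))} (hφ : IsIRS (FG B) φ) {N : ℕ} (C : Set (B.P N))
    (Q : Finset (B.P N) → Prop) (hQ : ∀ (σ : SN B N) S, Q (S.image σ.1) ↔ Q S) {b : ℝ} (hb0 : 0 ≤ b)
    (hb : ∀ S, Q S → hit C S ≤ b) :
    φ.real {H | Q (FN N H) ∧ ∀ p ∈ FN N H, p ∈ C} ≤ b := by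
  have := hφ.1
  rw [real_hit hφ C Q hQ]
  calc _ ≤ ∑ S ∈ Finset.univ.filter Q, mF φ N S * b := by
        apply Finset.sum_le_sum
        intro S hS
        exact mul_le_mul_of_nonneg_left (hb S (Finset.mem_filter.1 hS).2) (mF_nonneg _ _ _)
    _ = φ.real {H | Q (FN N H)} * b := by
        rw [← Finset.sum_mul, sum_mF Q]
    _ ≤ 1 * b := mul_le_mul_of_nonneg_right measureReal_le_one hb0
    _ = _ := one_mul _

theorem many_bound {φ : Measure (Subgroup (FG B))} (hφ : IsIRS (FG B) φ) {n N : ℕ} (hnN : n ≤ N) (p : B.P n)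
    {δ h : ℝ} (hδ1 : δ ≤ 1) (hδ : ∀ c0 : B.P N, δ ≤ frac N {c | res n c = p} (rv c0)) (hh : 0 < h)
    (hfib : ∀ c : B.P N, h ≤ (fib N (rv c)).card) (s : ℕ) :
    φ.real {H | s ≤ (FN N H).card ∧ p ∉ FN n H} ≤ (1 - δ) ^ s + (s : ℝ) ^ 2 / h := by
  classical
  have := hφ.1
  have h0 : {H : Subgroup (FG B) | s ≤ (FN N H).card ∧ p ∉ FN n H} =
      {H | s ≤ (FN N H).card ∧ ∀ c ∈ FN N H, c ∈ {c : B.P N | res n c = p}ᶜ} := by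
    ext H
    simp only [Set.mem_ofPred_eq, FN_res hnN, Finset.mem_image, not_exists, not_and, Set.mem_compl_iff]
  have hb : ∀ S : Finset (B.P N), s ≤ S.card → hit {c : B.P N | res n c = p}ᶜ S ≤ (1 - δ) ^ s + (s : ℝ) ^ 2 / h := by
    intro S hS
    obtain ⟨S', hS', hcard⟩ := Finset.exists_subset_card_eq hS
    refine (hit_anti _ hS').trans ?_
    have h1 := hit_est {c : B.P N | res n c = p}ᶜ hh hfib S'
    rw [hcard] at h1
    have h2 : ∏ q ∈ S', frac N {c : B.P N | res n c = p}ᶜ (rv q) ≤ (1 - δ) ^ s := by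
      rw [← hcard]
      rw [← Finset.prod_const]
      apply Finset.prod_le_prod
      · intro q _
        exact frac_nonneg _ _
      · intro q _
        rw [frac_compl]
        linarith [hδ q]
    have := (abs_le.1 h1).2
    linarith
  have hB : 0 ≤ (1 - δ) ^ s + (s : ℝ) ^ 2 / h := by
    have : 0 ≤ 1 - δ := by linarith
    positivity
  rw [h0]
  exact real_hit_le hφ _ (fun S => s ≤ S.card)
    (fun σ S => by rw [Finset.card_image_of_injective _ σ.1.injective]) hB hb

theorem real_iUnion_le {Ω : Type*} [MeasurableSpace Ω] {φ : Measure Ω} [IsProbabilityMeasure φ] {E : ℕ → Set Ω}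
    (hE : Monotone E) {b : ℝ} (h : ∀ ε > 0, ∃ N0, ∀ N ≥ N0, φ.real (E N) ≤ b + ε) :
    φ.real (⋃ N, E N) ≤ b := by
  apply le_of_forall_pos_le_add
  intro ε hε
  have h1 : Tendsto (fun N => φ.real (E N)) atTop (nhds (φ.real (⋃ N, E N))) :=
    (ENNReal.tendsto_toReal (measure_ne_top _ _)).comp (tendsto_measure_iUnion_atTop hE)
  obtain ⟨N0, hN0⟩ := h ε hε
  exact le_of_tendsto h1 (eventually_atTop.2 ⟨N0, hN0⟩)

theorem Aev_bound (heven : B.IsEven) {φ : Measure (Subgroup (FG B))} (hφ : IsIRS (FG B) φ) {n : ℕ} (p : B.P n) :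
    φ ((⋂ s, Aev B s) ∩ {H | p ∉ FN n H}) = 0 := by
  have := hφ.1
  obtain ⟨L, δ, hδ0, hδ1, hδ⟩ := frac_pos heven p
  have h1 : ∀ s : ℕ, φ.real (Aev B s ∩ {H | p ∉ FN n H}) ≤ (1 - δ) ^ s := by
    intro s
    have hU : Aev B s ∩ {H | p ∉ FN n H} = ⋃ N, {H | s ≤ (FN N H).card ∧ p ∉ FN n H} := by
      ext H
      simp [Aev]
    rw [hU]
    apply real_iUnion_le
    · intro N M hNM H hH
      exact ⟨hH.1.trans (card_FN_mono hNM H), hH.2⟩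
    · intro ε hε
      obtain ⟨M, hM⟩ := exists_nat_gt ((s : ℝ) ^ 2 / ε)
      obtain ⟨N0, hN0⟩ := fib_grow heven (M + 1)
      refine ⟨max N0 (max L n), fun N hN => ?_⟩
      have a1 : N0 ≤ N := (le_max_left _ _).trans hN
      have a2 : L ≤ N := (le_max_left _ _).trans ((le_max_right _ _).trans hN)
      have a3 : n ≤ N := (le_max_right _ _).trans ((le_max_right _ _).trans hN)
      refine (many_bound hφ a3 p hδ1 (hδ N a2) (h := ((M + 1 : ℕ) : ℝ)) (by positivity)
        (fun c => by exact_mod_cast hN0 N a1 c) s).trans ?_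
      gcongr
      rw [div_le_iff₀ (by positivity)]
      rw [div_lt_iff₀ hε] at hM
      push_cast
      nlinarith
  have h2 : φ.real ((⋂ s, Aev B s) ∩ {H | p ∉ FN n H}) ≤ 0 := by
    refine ge_of_tendsto (tendsto_pow_atTop_nhds_zero_of_lt_one (r := 1 - δ) (by linarith) (by linarith))
      (Eventually.of_forall fun s => ?_)
    refine le_trans ?_ (h1 s)
    refine measureReal_mono ?_ (measure_ne_top _ _)
    exact Set.inter_subset_inter_left _ (Set.iInter_subset _ s)
  have h3 := le_antisymm h2 measureReal_nonneg
  exact (measureReal_eq_zero_iff).1 h3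

theorem eq_bot_of_FN {H : Subgroup (FG B)} (h : ∀ n (p : B.P n), p ∈ FN n H) : H = ⊥ := by
  rw [Subgroup.eq_bot_iff_forall]
  intro g hg
  apply fg_ext
  intro x
  rw [one_smul]
  by_contra hne
  obtain ⟨n, hn⟩ := exists_cyl (isClosed_fix g).isOpen_compl (x := x) hne
  obtain ⟨y, hy, hyx⟩ := mem_FN.1 (h n (pr n x))
  exact hn y hyx (hy g hg)

theorem eq_dirac_of_ae {Ω : Type*} [MeasurableSpace Ω] {φ : Measure Ω} [IsProbabilityMeasure φ] {a : Ω}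
    (h : ∀ᵐ x ∂φ, x = a) : φ = Measure.dirac a := by
  ext s hs
  rw [Measure.dirac_apply' _ hs]
  by_cases ha : a ∈ s
  · simp only [Set.indicator_of_mem ha, Pi.one_apply]
    rw [← prob_compl_eq_zero_iff hs]
    exact measure_mono_null (fun x hx => by rintro rfl; exact hx ha) h
  · simp only [Set.indicator_of_notMem ha]
    exact measure_mono_null (fun x hx => by rintro rfl; exact ha hx) h

theorem exists_d (heven : B.IsEven) {φ : Measure (Subgroup (FG B))} (hφ : IsErgodicIRS (FG B) φ) :
    φ = Measure.dirac ⊥ ∨ ∃ d, φ (Aev B d) = 1 ∧ φ (Aev B (d + 1)) = 0 := by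
  have := hφ.1.1
  by_cases hall : ∀ s, φ (Aev B s) = 1
  · left
    apply eq_dirac_of_ae
    have h1 : ∀ᵐ H ∂φ, ∀ s, H ∈ Aev B s := by
      rw [ae_all_iff]
      intro s
      exact (prob_compl_eq_zero_iff (measurableSet_Aev s)).2 (hall s)
    have h2 : ∀ᵐ H ∂φ, ∀ n (p : B.P n), ¬ (H ∈ (⋂ s, Aev B s) ∩ {H | p ∉ FN n H}) := by
      rw [ae_all_iff]
      intro n
      rw [ae_all_iff]
      intro p
      exact measure_eq_zero_iff_ae_notMem.1 (Aev_bound heven hφ.1 p)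
    filter_upwards [h1, h2] with H h1 h2
    apply eq_bot_of_FN
    intro n p
    by_contra hp
    exact h2 n p ⟨Set.mem_iInter.2 h1, hp⟩
  · right
    push Not at hall
    classical
    let s := Nat.find hall
    have hs : φ (Aev B s) ≠ 1 := Nat.find_spec hall
    have hs0 : s ≠ 0 := by
      intro h
      apply hs
      rw [h]
      have : Aev B 0 = Set.univ := by ext H; simp [Aev]
      rw [this, measure_univ]
    obtain ⟨d, hd⟩ := Nat.exists_eq_succ_of_ne_zero hs0
    refine ⟨d, ?_, ?_⟩
    · have := Nat.find_min hall (m := d) (by show d < s; omega)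
      push Not at this
      exact this
    · have := (hφ.2 _ (measurableSet_Aev (B := B) s) (Aev_inv s)).resolve_right hs
      rw [hd] at this
      exact this

theorem tendsto_card {φ : Measure (Subgroup (FG B))} [IsProbabilityMeasure φ] {d : ℕ} (h1 : φ (Aev B d) = 1)
    (h0 : φ (Aev B (d + 1)) = 0) :
    Tendsto (fun N => φ.real {H | (FN N H).card = d}) atTop (nhds 1) := by
  have hU : Aev B d = ⋃ N, {H | d ≤ (FN N H).card} := by ext H; simp [Aev]
  have hm : Monotone fun N => {H : Subgroup (FG B) | d ≤ (FN N H).card} := by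
    intro N M hNM H hH
    exact le_trans hH (card_FN_mono hNM H)
  have h2 : Tendsto (fun N => φ.real {H | d ≤ (FN N H).card}) atTop (nhds (φ.real (Aev B d))) := by
    rw [hU]
    exact (ENNReal.tendsto_toReal (measure_ne_top _ _)).comp (tendsto_measure_iUnion_atTop hm)
  have h3 : φ.real (Aev B d) = 1 := by simp [Measure.real, h1]
  rw [h3] at h2
  refine h2.congr fun N => ?_
  apply measureReal_congr
  have := measure_eq_zero_iff_ae_notMem.1 h0
  filter_upwards [this] with H hH
  apply propext
  show d ≤ (FN N H).card ↔ (FN N H).card = d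
  have : ¬ (d + 1 ≤ (FN N H).card) := fun h => hH ⟨N, h⟩
  omega

end BratteliDiagram

namespace BratteliDiagram

variable {B : BratteliDiagram}

theorem abs_prod_sub {ι : Type*} (S : Finset ι) (a b : ι → ℝ) {ε : ℝ} (ha0 : ∀ i, 0 ≤ a i) (ha : ∀ i, a i ≤ 1)
    (hb0 : ∀ i, 0 ≤ b i) (hb : ∀ i, b i ≤ 1) (h : ∀ i, |a i - b i| ≤ ε) :
    |∏ i ∈ S, a i - ∏ i ∈ S, b i| ≤ S.card * ε := by
  classical
  induction S using Finset.induction_on with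
  | empty => simp
  | insert p S hp ih =>
    rw [Finset.prod_insert hp, Finset.prod_insert hp, Finset.card_insert_of_notMem hp]
    have e : a p * ∏ i ∈ S, a i - b p * ∏ i ∈ S, b i =
      a p * (∏ i ∈ S, a i - ∏ i ∈ S, b i) + (a p - b p) * ∏ i ∈ S, b i := by ring
    rw [e]
    refine (abs_add_le _ _).trans ?_
    rw [abs_mul, abs_mul, abs_of_nonneg (ha0 p)]
    have h1 : a p * |∏ i ∈ S, a i - ∏ i ∈ S, b i| ≤ 1 * (S.card * ε) :=
      mul_le_mul (ha p) ih (abs_nonneg _) zero_le_one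
    have hp0 : 0 ≤ ∏ i ∈ S, b i := Finset.prod_nonneg fun i _ => hb0 i
    have hp1 : ∏ i ∈ S, b i ≤ 1 := Finset.prod_le_one (fun i _ => hb0 i) fun i _ => hb i
    have h2 : |a p - b p| * |∏ i ∈ S, b i| ≤ ε * 1 := by
      rw [abs_of_nonneg hp0]
      exact mul_le_mul (h p) hp1 hp0 ((abs_nonneg _).trans (h p))
    push_cast
    linarith

theorem exists_enum {α : Type*} (d : ℕ) [Nonempty α] (S : Finset α) : ∃ e : Fin d → α, S.card = d →
    ∀ f : α → ℝ, ∏ p ∈ S, f p = ∏ j, f (e j) := by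
  by_cases h : S.card = d
  · let e := (S.equivFinOfCardEq h).symm
    refine ⟨fun j => (e j).1, fun _ f => ?_⟩
    rw [← Finset.prod_coe_sort]
    exact (Equiv.prod_comp e (fun p => f p.1)).symm
  · exact ⟨fun _ => Classical.arbitrary α, fun h' => absurd h' h⟩

theorem fixS_subset_iff {H : Subgroup (FG B)} {n N : ℕ} (h : n ≤ N) {T : Set (B.P n)} :
    FixS H ⊆ cyl n T ↔ ∀ c ∈ FN N H, c ∈ {c : B.P N | res n c ∈ T} := by
  constructor
  · intro hs c hc
    obtain ⟨x, hx, rfl⟩ := mem_FN.1 hc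
    show res n (pr N x) ∈ T
    rw [res_pr h]
    exact hs hx
  · intro hs x hx
    have : res n (pr N x) ∈ T := hs (pr N x) (mem_FN.2 ⟨x, hx, rfl⟩)
    rw [res_pr h] at this
    exact this

/-- distribution function of the fixed set -/
def Psi (φ : Measure (Subgroup (FG B))) (n : ℕ) (T : Set (B.P n)) : ℝ := φ.real {H | FixS H ⊆ cyl n T}

open Classical in
theorem Psi_approx {φ : Measure (Subgroup (FG B))} (hφ : IsIRS (FG B) φ) {k d n N : ℕ}
    {μ : Fin k → Measure B.Path} (hprob : ∀ i, IsProbabilityMeasure (μ i)) (hnN : n ≤ N) {ε' h ε : ℝ}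
    (hh : 0 < h) (hfib : ∀ c : B.P N, h ≤ (fib N (rv c)).card)
    (ht : ∀ c0 : B.P N, ∃ t ∈ stdSimplex ℝ (Fin k), ∀ T : Set (B.P n),
      |frac N {c | res n c ∈ T} (rv c0) - ∑ i, t i * (μ i).real (cyl n T)| ≤ ε')
    (hd : 1 - ε ≤ φ.real {H | (FN N H).card = d}) :
    ∃ w : (Fin d → Fin k) → ℝ, (∀ ι, 0 ≤ w ι) ∧ (∀ ι, w ι ≤ 1) ∧ ∀ T : Set (B.P n),
      |Psi φ n T - ∑ ι, w ι * ∏ j, (μ (ι j)).real (cyl n T)| ≤ ε + (d : ℝ) ^ 2 / h + d * ε' := by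
  have := hφ.1
  choose t ht1 ht2 using ht
  choose e he using exists_enum (α := B.P N) d
  have hsum : ∀ Q : Finset (B.P N) → Prop, ∑ S ∈ Finset.univ.filter Q, mF φ N S ≤ 1 := by
    intro Q
    rw [← sum_mF Q]
    exact measureReal_le_one
  have hsumd : ∑ S ∈ Finset.univ.filter (fun S : Finset (B.P N) => S.card = d), mF φ N S ≤ 1 := by
    convert hsum fun S => S.card = d
  refine ⟨fun ι => ∑ S ∈ Finset.univ.filter (fun S : Finset (B.P N) => S.card = d),
    mF φ N S * ∏ j, t (e S j) (ι j), ?_, ?_, ?_⟩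
  · intro ι
    exact Finset.sum_nonneg fun S _ => mul_nonneg (mF_nonneg _ _ _)
      (Finset.prod_nonneg fun j _ => (ht1 _).1 _)
  · intro ι
    refine le_trans (Finset.sum_le_sum fun S _ => ?_) hsumd
    have h1 : ∏ j, t (e S j) (ι j) ≤ 1 := by
      apply Finset.prod_le_one
      · intro j _; exact (ht1 _).1 _
      · intro j _
        rw [← (ht1 (e S j)).2]
        exact Finset.single_le_sum (f := fun i => t (e S j) i) (fun i _ => (ht1 _).1 i) (Finset.mem_univ _)
    calc _ ≤ mF φ N S * 1 := mul_le_mul_of_nonneg_left h1 (mF_nonneg _ _ _)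
      _ = _ := mul_one _
  · intro T
    set C : Set (B.P N) := {c | res n c ∈ T} with hC
    let u : B.P N → ℝ := fun p => ∑ i, t p i * (μ i).real (cyl n T)
    have hu0 : ∀ p, 0 ≤ u p := fun p => Finset.sum_nonneg fun i _ => mul_nonneg ((ht1 p).1 i) measureReal_nonneg
    have hu1 : ∀ p, u p ≤ 1 := by
      intro p
      rw [← (ht1 p).2]
      apply Finset.sum_le_sum
      intro i _
      have := hprob i
      calc _ ≤ t p i * 1 := mul_le_mul_of_nonneg_left measureReal_le_one ((ht1 p).1 i)
        _ = _ := mul_one _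
    have hw : ∑ ι : Fin d → Fin k, (∑ S ∈ Finset.univ.filter (fun S : Finset (B.P N) => S.card = d),
        mF φ N S * ∏ j, t (e S j) (ι j)) * ∏ j, (μ (ι j)).real (cyl n T) =
        ∑ S ∈ Finset.univ.filter (fun S : Finset (B.P N) => S.card = d), mF φ N S * ∏ p ∈ S, u p := by
      simp only [Finset.sum_mul]
      rw [Finset.sum_comm]
      apply Finset.sum_congr rfl
      intro S hS
      rw [he S (Finset.mem_filter.1 hS).2 u]
      simp only [u]
      rw [Finset.prod_univ_sum, Finset.mul_sum, Fintype.piFinset_univ]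
      apply Finset.sum_congr rfl
      intro ι _
      rw [Finset.prod_mul_distrib, mul_assoc]
    rw [hw]
    have hPsi : φ.real {H | (FN N H).card = d ∧ ∀ c ∈ FN N H, c ∈ C} =
        ∑ S ∈ Finset.univ.filter (fun S : Finset (B.P N) => S.card = d), mF φ N S * hit C S := by
      convert real_hit hφ C (fun S => S.card = d)
        (fun σ S => by rw [Finset.card_image_of_injective _ σ.1.injective])
    have h1 : |Psi φ n T - φ.real {H | (FN N H).card = d ∧ ∀ c ∈ FN N H, c ∈ C}| ≤ ε := by
      have hP : Psi φ n T = φ.real {H | ∀ c ∈ FN N H, c ∈ C} := by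
        unfold Psi
        congr 1
        ext H
        exact fixS_subset_iff hnN
      have hm1 : MeasurableSet {H : Subgroup (FG B) | (FN N H).card = d} := measurableSet_FN (N := N) fun S => S.card = d
      have hs1 := measureReal_inter_add_sdiff (μ := φ) (s := {H | ∀ c ∈ FN N H, c ∈ C}) hm1
      have hs2 : φ.real ({H | ∀ c ∈ FN N H, c ∈ C} \ {H | (FN N H).card = d}) ≤ ε := by
        have : φ.real ({H | (FN N H).card = d}ᶜ) ≤ ε := by
          rw [probReal_compl_eq_one_sub hm1]; linarith
        refine le_trans (measureReal_mono ?_ (measure_ne_top _ _)) this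
        intro H hH
        exact hH.2
      have hs3 : {H | ∀ c ∈ FN N H, c ∈ C} ∩ {H | (FN N H).card = d} =
          {H | (FN N H).card = d ∧ ∀ c ∈ FN N H, c ∈ C} := by
        ext H; exact and_comm
      rw [hs3] at hs1
      rw [hP, ← hs1, add_sub_cancel_left, abs_of_nonneg measureReal_nonneg]
      exact hs2
    have h2 : |∑ S ∈ Finset.univ.filter (fun S : Finset (B.P N) => S.card = d), mF φ N S * hit C S -
        ∑ S ∈ Finset.univ.filter (fun S : Finset (B.P N) => S.card = d), mF φ N S * ∏ p ∈ S, u p| ≤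
        (d : ℝ) ^ 2 / h + d * ε' := by
      rw [← Finset.sum_sub_distrib]
      refine (Finset.abs_sum_le_sum_abs _ _).trans ?_
      have hb0 : 0 ≤ (d : ℝ) ^ 2 / h + d * ε' := by
        have : 0 ≤ ε' := (abs_nonneg _).trans (ht2 (Classical.arbitrary _) Set.univ)
        positivity
      calc _ ≤ ∑ S ∈ Finset.univ.filter (fun S : Finset (B.P N) => S.card = d),
            mF φ N S * ((d : ℝ) ^ 2 / h + d * ε') := by
            apply Finset.sum_le_sum
            intro S hS
            have hSd := (Finset.mem_filter.1 hS).2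
            rw [← mul_sub, abs_mul, abs_of_nonneg (mF_nonneg _ _ _)]
            apply mul_le_mul_of_nonneg_left _ (mF_nonneg _ _ _)
            have a1 := hit_est C hh hfib S
            have a2 := abs_prod_sub S (fun p => frac N C (rv p)) u (fun p => frac_nonneg _ _)
              (fun p => frac_le_one _ _) hu0 hu1 (fun p => ht2 p T)
            rw [hSd] at a1 a2
            have a3 := abs_sub_le (hit C S) (∏ p ∈ S, frac N C (rv p)) (∏ p ∈ S, u p)
            linarith
        _ ≤ 1 * ((d : ℝ) ^ 2 / h + d * ε') := by
            rw [← Finset.sum_mul]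
            exact mul_le_mul_of_nonneg_right hsumd hb0
        _ = _ := one_mul _
    rw [hPsi] at h1
    have h3 := abs_sub_le (Psi φ n T)
      (∑ S ∈ Finset.univ.filter (fun S : Finset (B.P N) => S.card = d), mF φ N S * hit C S)
      (∑ S ∈ Finset.univ.filter (fun S : Finset (B.P N) => S.card = d), mF φ N S * ∏ p ∈ S, u p)
    linarith

theorem Psi_eq (heven : B.IsEven) {φ : Measure (Subgroup (FG B))} (hφ : IsIRS (FG B) φ) {k d : ℕ}
    {μ : Fin k → Measure B.Path} (hprob : ∀ i, IsProbabilityMeasure (μ i))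
    (hcomplete : ∀ ν : Measure B.Path, IsProbabilityMeasure ν →
      MeasInv (FG B) ν → MeasErg (FG B) ν → ∃ i, ν = μ i)
    (hd1 : φ (Aev B d) = 1) (hd0 : φ (Aev B (d + 1)) = 0) :
    ∃ w : (Fin d → Fin k) → ℝ, (∀ ι, 0 ≤ w ι) ∧ ∀ n (T : Set (B.P n)),
      Psi φ n T = ∑ ι, w ι * ∏ j, (μ (ι j)).real (cyl n T) := by
  have := hφ.1
  have step : ∀ n : ℕ, ∃ w : (Fin d → Fin k) → ℝ, w ∈ Set.Icc 0 1 ∧ ∀ T : Set (B.P n),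
      |Psi φ n T - ∑ ι, w ι * ∏ j, (μ (ι j)).real (cyl n T)| ≤ 1 / ((n : ℝ) + 1) := by
    intro n
    set ε : ℝ := 1 / ((n : ℝ) + 1) with hε
    have hε0 : 0 < ε := by positivity
    obtain ⟨N1, hN1⟩ := frac_approx hcomplete n (ε := ε / (3 * (d + 1))) (by positivity)
    obtain ⟨M, hM⟩ := exists_nat_gt (3 * (d : ℝ) ^ 2 / ε)
    obtain ⟨N2, hN2⟩ := fib_grow heven (M + 1)
    have h3 := tendsto_card hd1 hd0
    obtain ⟨N3, hN3⟩ := eventually_atTop.1 (h3.eventually (lt_mem_nhds (show 1 - ε / 3 < 1 by linarith)))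
    let N := max (max N1 N2) (max N3 n)
    have a1 : N1 ≤ N := (le_max_left _ _).trans (le_max_left _ _)
    have a2 : N2 ≤ N := (le_max_right _ _).trans (le_max_left _ _)
    have a3 : N3 ≤ N := (le_max_left _ _).trans (le_max_right _ _)
    have a4 : n ≤ N := (le_max_right _ _).trans (le_max_right _ _)
    obtain ⟨w, hw0, hw1, hw⟩ := Psi_approx hφ hprob a4 (h := ((M + 1 : ℕ) : ℝ)) (by positivity)
      (fun c => by exact_mod_cast hN2 N a2 c) (hN1 N a1) (hN3 N a3).le
    refine ⟨w, ⟨hw0, hw1⟩, fun T => (hw T).trans ?_⟩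
    have b1 : (d : ℝ) ^ 2 / ((M + 1 : ℕ) : ℝ) ≤ ε / 3 := by
      rw [div_le_iff₀ (by positivity)]
      rw [div_lt_iff₀ hε0] at hM
      push_cast
      nlinarith
    have b2 : (d : ℝ) * (ε / (3 * (d + 1))) ≤ ε / 3 := by
      rw [← mul_div_assoc, div_le_div_iff₀ (by positivity) (by positivity)]
      nlinarith
    linarith
  choose w hw hwT using step
  have hcomp : IsCompact (Set.Icc (0 : (Fin d → Fin k) → ℝ) 1) := isCompact_Icc
  obtain ⟨w0, hw0, hlim⟩ := hcomp.ultrafilter_le_nhds ((hyperfilter ℕ).map w)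
    (le_principal_iff.2 (Filter.mem_map.2 (Filter.univ_mem' hw)))
  have hlim : Tendsto w (hyperfilter ℕ : Filter ℕ) (nhds w0) := hlim
  have hle : (hyperfilter ℕ : Filter ℕ) ≤ atTop := by
    rw [← Nat.cofinite_eq_atTop]; exact hyperfilter_le_cofinite
  refine ⟨w0, fun ι => hw0.1 ι, fun n T => ?_⟩
  have h1 : Tendsto (fun j => ∑ ι, w j ι * ∏ i, (μ (ι i)).real (cyl n T)) (hyperfilter ℕ : Filter ℕ)
      (nhds (∑ ι, w0 ι * ∏ i, (μ (ι i)).real (cyl n T))) := by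
    apply tendsto_finsetSum
    intro ι _
    exact (((continuous_apply ι).tendsto _).comp hlim).mul_const _
  have h2 : Tendsto (fun j => ∑ ι, w j ι * ∏ i, (μ (ι i)).real (cyl n T)) (hyperfilter ℕ : Filter ℕ)
      (nhds (Psi φ n T)) := by
    rw [tendsto_iff_norm_sub_tendsto_zero]
    refine squeeze_zero' (Eventually.of_forall fun _ => norm_nonneg _) ?_
      (tendsto_one_div_add_atTop_nhds_zero_nat.mono_left hle)
    filter_upwards [hle (eventually_ge_atTop n)] with j hj
    have := hwT j {p | res n p ∈ T}
    unfold Psi at this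
    rw [← cyl_up hj] at this
    rw [Real.norm_eq_abs, abs_sub_comm]
    exact this
  exact tendsto_nhds_unique h2 h1

end BratteliDiagram

theorem subgroup_generate {Γ : Type*} [Group Γ] : (subgroupMeasurableSpace : MeasurableSpace (Subgroup Γ)) =
    MeasurableSpace.generateFrom {A | ∃ s : Finset Γ, A = {H : Subgroup Γ | ∀ g ∈ s, g ∈ H}} := by
  apply le_antisymm
  · have : @Measurable _ _ (MeasurableSpace.generateFrom
        {A | ∃ s : Finset Γ, A = {H : Subgroup Γ | ∀ g ∈ s, g ∈ H}}) _ (fun H : Subgroup Γ => (H : Set Γ)) := by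
      refine (@measurable_set_iff _ _ (_) _).2 fun g => ?_
      refine @measurable_to_prop _ (_) _ ?_
      apply MeasurableSpace.measurableSet_generateFrom
      refine ⟨{g}, ?_⟩
      ext H
      simp
    exact this.comap_le
  · apply MeasurableSpace.generateFrom_le
    rintro _ ⟨s, rfl⟩
    have : {H : Subgroup Γ | ∀ g ∈ s, g ∈ H} = ⋂ g ∈ s, {H : Subgroup Γ | g ∈ H} := by
      ext H; simp
    rw [this]
    exact Finset.measurableSet_biInter _ fun g _ => measurableSet_memSub g

theorem measurableSet_fin {Γ : Type*} [Group Γ] (s : Finset Γ) :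
    MeasurableSet {H : Subgroup Γ | ∀ g ∈ s, g ∈ H} := by
  rw [subgroup_generate]
  exact MeasurableSpace.measurableSet_generateFrom ⟨s, rfl⟩

theorem ext_sub {Γ : Type*} [Group Γ] {φ ψ : Measure (Subgroup Γ)} [IsFiniteMeasure φ]
    (h : ∀ s : Finset Γ, φ {H : Subgroup Γ | ∀ g ∈ s, g ∈ H} = ψ {H : Subgroup Γ | ∀ g ∈ s, g ∈ H}) : φ = ψ := by
  classical
  refine ext_of_generate_finite _ subgroup_generate ?_ ?_ ?_
  · rintro _ ⟨s, rfl⟩ _ ⟨t, rfl⟩ -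
    refine ⟨s ∪ t, ?_⟩
    ext H
    simp only [Set.mem_inter_iff, Set.mem_ofPred_eq, Finset.mem_union]
    constructor
    · rintro ⟨h1, h2⟩ g (hg | hg)
      · exact h1 g hg
      · exact h2 g hg
    · intro h
      exact ⟨fun g hg => h g (Or.inl hg), fun g hg => h g (Or.inr hg)⟩
  · rintro _ ⟨s, rfl⟩
    exact h s
  · have := h ∅
    simpa using this

theorem measurable_to_sub {Γ Ω : Type*} [Group Γ] [MeasurableSpace Ω] {f : Ω → Subgroup Γ}
    (h : ∀ g, MeasurableSet {x | g ∈ f x}) : Measurable f := by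
  rw [measurable_comap_iff]
  rw [measurable_set_iff]
  intro g
  exact measurableSet_setOfPred.1 (h g)

theorem measurable_conjSub {Γ : Type*} [Group Γ] (g : Γ) : Measurable (conjSub g : Subgroup Γ → Subgroup Γ) := by
  apply measurable_to_sub
  intro x
  simp only [mem_conjSub]
  exact measurableSet_memSub _

theorem conjSub_mul {Γ : Type*} [Group Γ] (a b : Γ) (H : Subgroup Γ) : conjSub a (conjSub b H) = conjSub (a * b) H := by
  ext x
  simp [mem_conjSub, mul_assoc]

/-- an invariant measure absolutely continuous w.r.t. an ergodic one coincides with it -/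
theorem erg_unique {Γ : Type*} [Group Γ] [Countable Γ] {φ ψ : Measure (Subgroup Γ)} (hφ : IsErgodicIRS Γ φ)
    (hψ : IsIRS Γ ψ) (hac : ψ ≪ φ) : φ = ψ := by
  have i1 := hφ.1.1
  have i2 := hψ.1
  obtain ⟨s, hs, h1, h2⟩ := hahn_decomposition φ ψ
  let A : Set (Subgroup Γ) := ⋃ g : Γ, conjSub g ⁻¹' s
  have hA : MeasurableSet A := MeasurableSet.iUnion fun g => measurable_conjSub g hs
  have hAi : ∀ g : Γ, conjSub g ⁻¹' A = A := by
    intro g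
    ext H
    simp only [A, Set.mem_preimage, Set.mem_iUnion, conjSub_mul]
    constructor
    · rintro ⟨a, ha⟩; exact ⟨a * g, ha⟩
    · rintro ⟨a, ha⟩; exact ⟨a * g⁻¹, by simpa using ha⟩
  have hsA : s ⊆ A := by
    intro H hH
    refine Set.mem_iUnion.2 ⟨1, ?_⟩
    have : conjSub 1 H = H := by ext x; simp [mem_conjSub]
    rw [Set.mem_preimage, this]
    exact hH
  have k1 : ∀ t, MeasurableSet t → t ⊆ A → ψ t ≤ φ t := by
    intro t ht htA
    obtain ⟨e, he⟩ := exists_surjective_nat Γ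
    let D : ℕ → Set (Subgroup Γ) := disjointed fun n => conjSub (e n) ⁻¹' s
    have hD : ∀ n, MeasurableSet (D n) := MeasurableSet.disjointed fun n => measurable_conjSub _ hs
    have hDs : ∀ n, D n ⊆ conjSub (e n) ⁻¹' s := fun n => disjointed_subset _ n
    have hU : t = ⋃ n, t ∩ D n := by
      rw [← Set.inter_iUnion, iUnion_disjointed]
      symm
      rw [Set.inter_eq_left]
      intro H hH
      obtain ⟨g, hg⟩ := Set.mem_iUnion.1 (htA hH)
      obtain ⟨n, rfl⟩ := he g
      exact Set.mem_iUnion.2 ⟨n, hg⟩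
    have hdis : Pairwise (Function.onFun Disjoint fun n => t ∩ D n) := by
      intro i j hij
      exact (disjoint_disjointed _ hij).mono Set.inter_subset_right Set.inter_subset_right
    rw [hU, measure_iUnion hdis fun n => ht.inter (hD n), measure_iUnion hdis fun n => ht.inter (hD n)]
    apply ENNReal.tsum_le_tsum
    intro n
    rw [← hψ.2 (e n)⁻¹ _ (ht.inter (hD n)), ← hφ.1.2 (e n)⁻¹ _ (ht.inter (hD n))]
    apply h1 _ (measurable_conjSub _ (ht.inter (hD n)))
    intro H hH
    have := hDs n hH.2
    rw [Set.mem_preimage, conjSub_mul, mul_inv_cancel] at this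
    have e1 : conjSub 1 H = H := by ext x; simp [mem_conjSub]
    rwa [e1] at this
  have k2 : ∀ t, MeasurableSet t → t ⊆ Aᶜ → φ t ≤ ψ t := by
    intro t ht htA
    exact h2 t ht (htA.trans (Set.compl_subset_compl.2 hsA))
  rcases hφ.2 A hA hAi with h0 | h0
  · apply Measure.eq_of_le_of_measure_univ_eq
    · rw [Measure.le_iff]
      intro t ht
      rw [← measure_sdiff_null (s := t) h0]
      exact (k2 _ (ht.diff hA) (fun x hx => hx.2)).trans (measure_mono Set.sdiff_subset)
    · simp
  · symm
    apply Measure.eq_of_le_of_measure_univ_eq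
    · rw [Measure.le_iff]
      intro t ht
      have h0' : ψ Aᶜ = 0 := hac ((prob_compl_eq_zero_iff hA).2 h0)
      rw [← measure_sdiff_null (s := t) h0']
      refine (k1 _ (ht.diff hA.compl) (fun x hx => by simpa using hx.2)).trans (measure_mono Set.sdiff_subset)
    · simp

namespace BratteliDiagram

variable {B : BratteliDiagram}

/-- common fixed points -/
def FixF (s : Finset (FG B)) : Set B.Path := {x | ∀ g ∈ s, g • x = x}

theorem exists_level_fin (s : Finset (FG B)) : ∃ N, ∀ g ∈ s, g ∈ B.levelIn N := by
  classical
  induction s using Finset.induction_on with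
  | empty => exact ⟨0, by simp⟩
  | insert a s _ ih =>
    obtain ⟨N, hN⟩ := ih
    obtain ⟨M, hM⟩ := exists_level a
    refine ⟨max N M, fun g hg => ?_⟩
    rcases Finset.mem_insert.1 hg with rfl | hg
    · exact levelIn_mono (le_max_right N M) hM
    · exact levelIn_mono (le_max_left N M) (hN g hg)

theorem FixF_cyl (s : Finset (FG B)) : ∃ n T, FixF s = cyl n T := by
  obtain ⟨N, hN⟩ := exists_level_fin s
  refine ⟨N, {p | ∃ x ∈ FixF s, pr N x = p}, ?_⟩
  ext y
  constructor
  · intro hy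
    exact ⟨y, hy, rfl⟩
  · rintro ⟨x, hx, hxy⟩ g hg
    refine path_ext (n := N) ?_ (fun i hi => level_tail (hN g hg) y hi)
    rw [← level_pr (hN g hg) hxy, hx g hg, hxy]

theorem measurableSet_FixF (s : Finset (FG B)) : MeasurableSet (FixF s) := by
  obtain ⟨n, T, h⟩ := FixF_cyl s
  rw [h]
  exact measurableSet_cyl T

theorem phi_fin (heven : B.IsEven) {φ : Measure (Subgroup (FG B))} (hφ : IsIRS (FG B) φ) (s : Finset (FG B)) :
    φ {H : Subgroup (FG B) | ∀ g ∈ s, g ∈ H} = φ {H | FixS H ⊆ FixF s} := by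
  apply measure_congr
  filter_upwards [ae_good heven hφ] with H hH
  apply propext
  show (∀ g ∈ s, g ∈ H) ↔ FixS H ⊆ FixF s
  constructor
  · intro h x hx g hg
    exact hx g (h g hg)
  · intro h g hg
    exact mem_of_fix heven hH fun x hx => h hx g hg

theorem measurable_stab (ι : Type*) [Countable ι] :
    Measurable fun y : ι → B.Path => MulAction.stabilizer ↥B.fullGroup y := by
  apply measurable_to_sub
  intro g
  have : {y : ι → B.Path | g ∈ MulAction.stabilizer ↥B.fullGroup y} =
      ⋂ i, (fun y : ι → B.Path => y i) ⁻¹' {x : B.Path | g • x = x} := by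
    ext y
    simp only [Set.mem_ofPred_eq, MulAction.mem_stabilizer_iff, Set.mem_iInter, Set.mem_preimage]
    exact funext_iff
  rw [this]
  exact MeasurableSet.iInter fun i => measurable_pi_apply i (isClosed_fix g).measurableSet

theorem stabDist_fin {k : ℕ} {μ : Fin k → Measure B.Path} (hprob : ∀ i, IsProbabilityMeasure (μ i))
    (α : Fin k → ℕ) (s : Finset (FG B)) :
    B.stabDist μ α {H : Subgroup (FG B) | ∀ g ∈ s, g ∈ H} = ∏ i, μ i (FixF s) ^ α i := by
  unfold stabDist prodMeasure
  rw [Measure.map_apply (measurable_stab _) (measurableSet_fin s)]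
  have : (fun y : (Σ i : Fin k, Fin (α i)) → B.Path => MulAction.stabilizer ↥B.fullGroup y) ⁻¹'
      {H : Subgroup (FG B) | ∀ g ∈ s, g ∈ H} = Set.pi Set.univ fun _ => FixF s := by
    ext y
    simp only [Set.mem_preimage, Set.mem_ofPred_eq, MulAction.mem_stabilizer_iff, Set.mem_pi, Set.mem_univ,
      true_implies]
    constructor
    · intro h i g hg
      exact congrFun (h g hg) i
    · intro h g hg
      exact funext fun i => h i g hg
  rw [this, Measure.pi_pi, Fintype.prod_sigma]
  simp

instance stabDist_prob {k : ℕ} {μ : Fin k → Measure B.Path} [∀ i, IsProbabilityMeasure (μ i)]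
    (α : Fin k → ℕ) : IsProbabilityMeasure (B.stabDist μ α) := by
  unfold stabDist prodMeasure
  exact Measure.isProbabilityMeasure_map (measurable_stab _).aemeasurable

theorem stabDist_irs {k : ℕ} {μ : Fin k → Measure B.Path} (hprob : ∀ i, IsProbabilityMeasure (μ i))
    (hinv : ∀ i, MeasInv (FG B) (μ i)) (α : Fin k → ℕ) : IsIRS (FG B) (B.stabDist μ α) := by
  classical
  refine ⟨inferInstance, fun g A hA => ?_⟩
  have : Measure.map (conjSub g) (B.stabDist μ α) = B.stabDist μ α := by
    have : IsProbabilityMeasure (Measure.map (conjSub g) (B.stabDist μ α)) :=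
      Measure.isProbabilityMeasure_map (measurable_conjSub g).aemeasurable
    apply ext_sub
    intro s
    rw [Measure.map_apply (measurable_conjSub g) (measurableSet_fin s)]
    have e1 : conjSub g ⁻¹' {H : Subgroup (FG B) | ∀ a ∈ s, a ∈ H} =
        {H : Subgroup (FG B) | ∀ a ∈ s.image (fun a => g⁻¹ * a * g), a ∈ H} := by
      ext H
      simp only [Set.mem_preimage, Set.mem_ofPred_eq, mem_conjSub, Finset.forall_mem_image]
    rw [e1, stabDist_fin hprob, stabDist_fin hprob]
    apply Finset.prod_congr rfl
    intro i _
    congr 1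
    rw [← hinv i g _ (measurableSet_FixF s)]
    congr 1
    ext x
    simp only [FixF, Set.mem_preimage, Set.mem_ofPred_eq, Finset.forall_mem_image]
    apply forall₂_congr
    intro a _
    rw [← smul_smul, ← smul_smul, inv_smul_eq_iff]
  conv_rhs => rw [← this]
  rw [Measure.map_apply (measurable_conjSub g) hA]

end BratteliDiagram

namespace BratteliDiagram

variable {B : BratteliDiagram}

theorem irs_decomp {k d : ℕ} {μ : Fin k → Measure B.Path} (heven : B.IsEven)
    (hprob : ∀ i, IsProbabilityMeasure (μ i)) {φ : Measure (Subgroup (FG B))}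
    (hφ : IsIRS (FG B) φ) {w : (Fin d → Fin k) → ℝ} (hw : ∀ ι, 0 ≤ w ι)
    (hP : ∀ n T, Psi φ n T = ∑ ι, w ι * ∏ j, (μ (ι j)).real (cyl n T)) :
    φ = ∑ ι, ENNReal.ofReal (w ι) •
      B.stabDist μ (fun i => (Finset.univ.filter fun j => ι j = i).card) := by
  have := hφ.1
  apply ext_sub
  intro s
  obtain ⟨n, T, hT⟩ := FixF_cyl s
  rw [phi_fin heven hφ, hT, Measure.finsetSum_apply]
  have h1 : φ {H : Subgroup (FG B) | FixS H ⊆ cyl n T} = ENNReal.ofReal (Psi φ n T) := by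
    rw [Psi, ofReal_measureReal]
  rw [h1, hP, ENNReal.ofReal_sum_of_nonneg]
  · apply Finset.sum_congr rfl
    intro ι _
    rw [ENNReal.ofReal_mul (hw ι), Measure.smul_apply, stabDist_fin hprob, smul_eq_mul, hT]
    congr 1
    rw [ENNReal.ofReal_prod_of_nonneg (fun _ _ => measureReal_nonneg)]
    have h2 : ∀ j, ENNReal.ofReal ((μ (ι j)).real (cyl n T)) = μ (ι j) (cyl n T) := by
      intro j
      rw [ofReal_measureReal]
    simp only [h2]
    rw [← Finset.prod_fiberwise' Finset.univ ι (fun i => μ i (cyl n T))]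
    simp only [Finset.prod_const]
  · intro ι _
    exact mul_nonneg (hw ι) (Finset.prod_nonneg fun _ _ => measureReal_nonneg)

end BratteliDiagram

open BratteliDiagram in
theorem final_aux (B : BratteliDiagram)
    (heven : B.IsEven)
    (k : ℕ) (μ : Fin k → Measure B.Path)
    (hprob : ∀ i, IsProbabilityMeasure (μ i))
    (hinv : ∀ i, MeasInv ↥B.fullGroup (μ i))
    (hcomplete : ∀ ν : Measure B.Path, IsProbabilityMeasure ν →
      MeasInv ↥B.fullGroup ν → MeasErg ↥B.fullGroup ν → ∃ i, ν = μ i)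
    (φ : Measure (Subgroup ↥B.fullGroup))
    (hφ : IsErgodicIRS ↥B.fullGroup φ) :
    φ = Measure.dirac ⊥ ∨ ∃ α : Fin k → ℕ, φ = B.stabDist μ α := by
  rcases exists_d heven hφ with h | ⟨d, hd1, hd0⟩
  · exact Or.inl h
  right
  obtain ⟨w, hw, hP⟩ := Psi_eq heven hφ.1 hprob hcomplete hd1 hd0
  have hdec := irs_decomp heven hprob hφ.1 hw hP
  have hex : ∃ ι, 0 < w ι := by
    by_contra hno
    push Not at hno
    have hz : φ = 0 := by
      rw [hdec]
      apply Finset.sum_eq_zero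
      intro ι _
      rw [ENNReal.ofReal_eq_zero.2 (hno ι), zero_smul]
    have := hφ.1.1
    have h1 : φ Set.univ = 1 := measure_univ
    rw [hz] at h1
    simp at h1
  obtain ⟨ι, hι⟩ := hex
  refine ⟨_, erg_unique hφ (stabDist_irs hprob hinv
    (fun i => (Finset.univ.filter fun j => ι j = i).card)) ?_⟩
  intro t ht
  rw [hdec, Measure.finsetSum_apply, Finset.sum_eq_zero_iff] at ht
  have := ht ι (Finset.mem_univ _)
  rw [Measure.smul_apply, smul_eq_mul, mul_eq_zero] at this
  rcases this with h | h
  · exact absurd (ENNReal.ofReal_eq_zero.1 h) (not_le.2 hι)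
  · exact h

/-- every ergodic invariant random subgroup of a simple (even) AF full group
with finitely many ergodic measures is either the Dirac measure at the trivial subgroup or
one of the stabilizer distributions `φ_α`. -/
theorem ergodicIRS_classification (B : BratteliDiagram)
    (hsimple : B.IsSimple) (heven : B.IsEven)
    (k : ℕ) (hk : 1 ≤ k) (μ : Fin k → Measure B.Path)
    (hprob : ∀ i, IsProbabilityMeasure (μ i))
    (hinv : ∀ i, MeasInv ↥B.fullGroup (μ i))
    (herg : ∀ i, MeasErg ↥B.fullGroup (μ i))
    (hdistinct : Function.Injective μ)
    (hcomplete : ∀ ν : Measure B.Path, IsProbabilityMeasure ν →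
      MeasInv ↥B.fullGroup ν → MeasErg ↥B.fullGroup ν → ∃ i, ν = μ i)
    (φ : Measure (Subgroup ↥B.fullGroup))
    (hφ : IsErgodicIRS ↥B.fullGroup φ) :
    φ = Measure.dirac ⊥ ∨ ∃ α : Fin k → ℕ, φ = B.stabDist μ α := by
  exact final_aux B heven k μ hprob hinv hcomplete φ hφ
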